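/- arXiv:2503.12179 — 2 statements merged into one kernel-verified Lean document; each statement's English description precedes it below -/
import Mathlib

section
/- Let p = {p_i, i ∈ 𝓛} be a strictly stationary random field with almost surely bounded perturbations (there exists M < ∞ with |p_0| ≤ M almost surely). If ∑_{i ∈ 𝓛} α(|i|) < ∞, where α is the strong mixing coefficient of p, then the perturbed lattice Ξ = {i + p_i + U : i ∈ 𝓛} is class I hyperuniform, i.e. Var(#(Ξ ∩ B_r))/λ^d(B_r) = O(r^{-1}) as r → ∞. -/
open MeasureTheory ProbabilityTheory Filter Asymptotics

noncomputable section

/-- The strong mixing coefficient between two sub-σ-fields. -/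
def alphaSigma {Ω : Type*} [MeasurableSpace Ω] (P : Measure Ω)
    (m₁ m₂ : MeasurableSpace Ω) : ℝ :=
  sSup {x : ℝ | ∃ A B : Set Ω, MeasurableSet[m₁] A ∧ MeasurableSet[m₂] B ∧
    x = |(P A).toReal * (P B).toReal - (P (A ∩ B)).toReal|}

/-- The σ-field generated by the random variables `p i`, `i ∈ C`. -/
def sigmaGen {Ω ι F : Type*} [MeasurableSpace F] (p : ι → Ω → F) (C : Set ι) :
    MeasurableSpace Ω :=
  ⨆ i ∈ C, MeasurableSpace.comap (p i) inferInstance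

/-- The strong (α-)mixing coefficient of the random field `p`, whose indices are located
at positions `pos`, evaluated at distance `n`. -/
def mixCoef {Ω ι F : Type*} [MeasurableSpace Ω] [MeasurableSpace F]
    {d : ℕ} (P : Measure Ω) (pos : ι → EuclideanSpace ℝ (Fin d))
    (p : ι → Ω → F) (n : ℝ) : ℝ :=
  sSup {x : ℝ | ∃ A B : Finset ι,
    (∀ i ∈ A, ∀ j ∈ B, n ≤ ‖pos i - pos j‖) ∧
    x = alphaSigma P (sigmaGen p (A : Set ι)) (sigmaGen p (B : Set ι))}


/-- cosine Bessel type integral -/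
def bI (n : ℕ) (s : ℝ) : ℝ := ∫ x in (-1:ℝ)..1, Real.cos (s * x) * Real.sqrt (1 - x^2) ^ n
def bI1 (n : ℕ) (s : ℝ) : ℝ := ∫ x in (-1:ℝ)..1, -(x * Real.sin (s * x)) * Real.sqrt (1 - x^2) ^ n
def bI2 (n : ℕ) (s : ℝ) : ℝ := ∫ x in (-1:ℝ)..1, -(x^2 * Real.cos (s * x)) * Real.sqrt (1 - x^2) ^ n

lemma sqrt_pow_le_one (n : ℕ) (x : ℝ) : |Real.sqrt (1 - x^2) ^ n| ≤ 1 := by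
  rw [abs_of_nonneg (by positivity)]
  apply pow_le_one₀ (Real.sqrt_nonneg _)
  rw [Real.sqrt_le_iff]
  refine ⟨zero_le_one, ?_⟩
  nlinarith [sq_nonneg x]

lemma bI_deriv (n : ℕ) (s : ℝ) : HasDerivAt (bI n) (bI1 n s) s := by
  have := (intervalIntegral.hasDerivAt_integral_of_dominated_loc_of_deriv_le (μ := volume)
    (a := (-1:ℝ)) (b := 1) (F := fun s x => Real.cos (s * x) * Real.sqrt (1 - x^2) ^ n)
    (F' := fun s x => -(x * Real.sin (s * x)) * Real.sqrt (1 - x^2) ^ n)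
    (x₀ := s) (s := Set.univ) (bound := fun _ => 1) Filter.univ_mem
    (Filter.Eventually.of_forall fun x => by
      apply Continuous.aestronglyMeasurable; fun_prop)
    (by apply Continuous.intervalIntegrable; fun_prop)
    (by apply Continuous.aestronglyMeasurable; fun_prop)
    (Filter.Eventually.of_forall fun x hx y _ => by
      rw [Set.uIoc_of_le (by norm_num)] at hx
      have hx1 : |x| ≤ 1 := abs_le.2 ⟨hx.1.le, hx.2⟩
      rw [Real.norm_eq_abs, abs_mul, abs_neg, abs_mul]
      have h1 := Real.abs_sin_le_one (y * x)
      have h2 := sqrt_pow_le_one n x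
      have h3 : |x| * |Real.sin (y * x)| ≤ 1 := by
        nlinarith [abs_nonneg x, abs_nonneg (Real.sin (y * x))]
      exact mul_le_one₀ h3 (abs_nonneg _) h2)
    (by simp)
    (Filter.Eventually.of_forall fun x hx y _ => by
      have h0 : HasDerivAt (fun y => y * x) x y := by simpa using (hasDerivAt_id y).mul_const x
      have := (h0.cos).mul_const (Real.sqrt (1 - x^2) ^ n)
      refine HasDerivAt.congr_deriv this ?_
      ring)).2
  exact this

lemma bI1_deriv (n : ℕ) (s : ℝ) : HasDerivAt (bI1 n) (bI2 n s) s := by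
  have := (intervalIntegral.hasDerivAt_integral_of_dominated_loc_of_deriv_le (μ := volume)
    (a := (-1:ℝ)) (b := 1) (F := fun s x => -(x * Real.sin (s * x)) * Real.sqrt (1 - x^2) ^ n)
    (F' := fun s x => -(x^2 * Real.cos (s * x)) * Real.sqrt (1 - x^2) ^ n)
    (x₀ := s) (s := Set.univ) (bound := fun _ => 1) Filter.univ_mem
    (Filter.Eventually.of_forall fun x => by
      apply Continuous.aestronglyMeasurable; fun_prop)
    (by apply Continuous.intervalIntegrable; fun_prop)
    (by apply Continuous.aestronglyMeasurable; fun_prop)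
    (Filter.Eventually.of_forall fun x hx y _ => by
      rw [Set.uIoc_of_le (by norm_num)] at hx
      have hx1 : |x| ≤ 1 := abs_le.2 ⟨hx.1.le, hx.2⟩
      rw [Real.norm_eq_abs, abs_mul, abs_neg, abs_mul, abs_pow]
      have h1 := Real.abs_cos_le_one (y * x)
      have h2 := sqrt_pow_le_one n x
      have h4 : |x|^2 ≤ 1 := pow_le_one₀ (abs_nonneg _) hx1
      have h3 : |x|^2 * |Real.cos (y * x)| ≤ 1 := mul_le_one₀ h4 (abs_nonneg _) h1
      exact mul_le_one₀ h3 (abs_nonneg _) h2)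
    (by simp)
    (Filter.Eventually.of_forall fun x hx y _ => by
      have h0 : HasDerivAt (fun y => y * x) x y := by simpa using (hasDerivAt_id y).mul_const x
      have := ((h0.sin).const_mul x).neg.mul_const (Real.sqrt (1 - x^2) ^ n)
      refine HasDerivAt.congr_deriv this ?_
      ring)).2
  exact this

lemma bI_ode (n : ℕ) (s : ℝ) : s * bI2 n s + (n + 2) * bI1 n s + s * bI n s = 0 := by
  have key : ∫ x in (-1:ℝ)..1, (s * Real.cos (s * x) * Real.sqrt (1 - x^2) ^ (n+2)
      - (n+2) * x * Real.sin (s * x) * Real.sqrt (1 - x^2) ^ n) = 0 := by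
    have := intervalIntegral.integral_eq_sub_of_hasDerivAt_of_le (a := (-1:ℝ)) (b := 1)
      (f := fun x => Real.sin (s * x) * Real.sqrt (1 - x^2) ^ (n+2))
      (f' := fun x => (s * Real.cos (s * x) * Real.sqrt (1 - x^2) ^ (n+2)
      - (n+2) * x * Real.sin (s * x) * Real.sqrt (1 - x^2) ^ n)) (by norm_num)
      (by apply Continuous.continuousOn; fun_prop) ?_ 
      (by apply Continuous.intervalIntegrable; fun_prop)
    · rw [this]; simp
    · intro x hx
      have hpos : 0 < 1 - x^2 := by nlinarith [hx.1, hx.2]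
      have h0 : HasDerivAt (fun y => s * y) s x := by simpa using (hasDerivAt_id x).const_mul s
      have h1 : HasDerivAt (fun y:ℝ => 1 - y^2) (-(2*x)) x := by
        simpa using ((hasDerivAt_id x).pow 2).const_sub 1
      have h2 := h0.sin.mul ((h1.sqrt hpos.ne').pow (n+2))
      refine HasDerivAt.congr_deriv h2 ?_
      have hs : Real.sqrt (1 - x^2) ≠ 0 := (Real.sqrt_pos.2 hpos).ne'
      simp only [show n + 2 - 1 = n + 1 by omega, Pi.pow_apply]
      push_cast
      field_simp
      ring
  rw [bI, bI1, bI2, ← intervalIntegral.integral_const_mul, ← intervalIntegral.integral_const_mul,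
    ← intervalIntegral.integral_const_mul, ← intervalIntegral.integral_add,
    ← intervalIntegral.integral_add, ← key]
  · apply intervalIntegral.integral_congr
    intro x hx
    rw [Set.uIcc_of_le (by norm_num)] at hx
    have hpos : 0 ≤ 1 - x^2 := by nlinarith [hx.1, hx.2]
    have := Real.sq_sqrt hpos
    simp only [pow_add, this]
    ring
  all_goals apply Continuous.intervalIntegrable; fun_prop

lemma bI_bound (n : ℕ) : ∃ C : ℝ, 0 ≤ C ∧ ∀ s : ℝ, 0 < s → (bI n s) ^ 2 * s ^ (n+2) ≤ C := by
  set a : ℝ := n + 2 with ha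
  have ha0 : 0 < a := by positivity
  let E : ℝ → ℝ := fun s => s ^ (n+2) * ((bI n s)^2 + (bI1 n s)^2) + 
    a * s ^ (n+1) * (bI n s * bI1 n s)
  have hE : ∀ s : ℝ, 0 < s → HasDerivAt E (- a * s ^ n * (bI n s * bI1 n s)) s := by
    intro s hs
    have h0 := bI_deriv n s
    have h1 := bI1_deriv n s
    have ode := bI_ode n s
    have p1 := hasDerivAt_pow (n+2) s
    have p2 := hasDerivAt_pow (n+1) s
    have := (p1.mul ((h0.pow 2).add (h1.pow 2))).add ((p2.const_mul a).mul (h0.mul h1))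
    refine HasDerivAt.congr_deriv this ?_
    have e : bI2 n s = -(a * bI1 n s) / s - bI n s := by
      field_simp
      linarith
    simp only [show n + 2 - 1 = n + 1 by omega, show n + 1 - 1 = n by omega, e, Pi.mul_apply, Pi.add_apply, Pi.pow_apply]
    push_cast
    field_simp
    rw [show (n:ℝ) = a - 2 by rw [ha]; ring]
    ring
  have hlow : ∀ s, a ≤ s → s ^ (n+2) * ((bI n s)^2 + (bI1 n s)^2) ≤ 2 * E s := by
    intro s hs
    have hs0 : 0 < s := ha0.trans_le hs
    have h1 : |a * s^(n+1) * (bI n s * bI1 n s)| ≤ s^(n+2) * (((bI n s)^2 + (bI1 n s)^2)/2) := by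
      rw [abs_mul, abs_of_nonneg (by positivity), pow_succ s (n+1)]
      have : |bI n s * bI1 n s| ≤ ((bI n s)^2 + (bI1 n s)^2)/2 := by
        rw [abs_le]; constructor <;> nlinarith [sq_nonneg (bI n s + bI1 n s), sq_nonneg (bI n s - bI1 n s)]
      calc _ ≤ s * s^(n+1) * (((bI n s)^2 + (bI1 n s)^2)/2) := by gcongr
        _ = _ := by ring
    have := (abs_le.1 h1).1
    simp only [E]
    linarith
  have hE0 : ∀ s, a ≤ s → 0 ≤ E s := by
    intro s hs
    have hs0 : 0 < s := ha0.trans_le hs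
    have := hlow s hs
    have h2 : 0 ≤ s ^ (n+2) * ((bI n s)^2 + (bI1 n s)^2) := by positivity
    linarith
  let W : ℝ → ℝ := fun s => E s * Real.exp (a * s⁻¹)
  have hW : ∀ s, 0 < s → HasDerivAt W ((- a * s ^ n * (bI n s * bI1 n s)) * Real.exp (a * s⁻¹) 
      + E s * (Real.exp (a * s⁻¹) * (a * (-(s^2)⁻¹)))) s := by
    intro s hs
    exact (hE s hs).mul (((hasDerivAt_inv hs.ne').const_mul a).exp)
  have hanti : AntitoneOn W (Set.Ici a) := by
    apply antitoneOn_of_deriv_nonpos (convex_Ici a)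
    · intro s hs
      exact (hW s (ha0.trans_le hs)).continuousAt.continuousWithinAt
    · intro s hs
      rw [interior_Ici] at hs
      exact (hW s (ha0.trans hs)).differentiableAt.differentiableWithinAt
    · intro s hs
      rw [interior_Ici] at hs
      have hs0 : 0 < s := ha0.trans hs
      rw [(hW s hs0).deriv]
      have h1 := hlow s (le_of_lt hs)
      have : - a * s ^ n * (bI n s * bI1 n s) ≤ a * (s^2)⁻¹ * E s := by
        have h3 : -(bI n s * bI1 n s) ≤ ((bI n s)^2 + (bI1 n s)^2)/2 := by
          nlinarith [sq_nonneg (bI n s + bI1 n s)]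
        calc - a * s ^ n * (bI n s * bI1 n s) = a * s^n * (-(bI n s * bI1 n s)) := by ring
          _ ≤ a * s^n * (((bI n s)^2 + (bI1 n s)^2)/2) := by gcongr
          _ = a * (s^2)⁻¹ * ((s ^ (n+2) * ((bI n s)^2 + (bI1 n s)^2))/2) := by
            field_simp
            ring
          _ ≤ a * (s^2)⁻¹ * E s := by
            gcongr
            linarith
      have he := Real.exp_pos (a * s⁻¹)
      nlinarith
  refine ⟨max (2 * W a) (4 * a^(n+2)), by positivity, ?_⟩
  intro s hs
  rcases le_total a s with h | h
  · refine le_trans ?_ (le_max_left _ _)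
    have h1 := hlow s h
    have h2 := hanti (Set.mem_Ici.2 le_rfl) (Set.mem_Ici.2 h) h
    have h3 : E s ≤ W s := by
      have : 1 ≤ Real.exp (a * s⁻¹) := Real.one_le_exp (by positivity)
      have := hE0 s h
      simp only [W]; nlinarith
    have h4 : 0 ≤ s^(n+2) * (bI1 n s)^2 := by positivity
    nlinarith
  · refine le_trans ?_ (le_max_right _ _)
    have h1 : |bI n s| ≤ 2 := by
      have := intervalIntegral.norm_integral_le_of_norm_le_const (a := (-1:ℝ)) (b := 1) (C := 1)
        (f := fun x => Real.cos (s * x) * Real.sqrt (1 - x^2) ^ n) (by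
          intro x hx
          rw [Real.norm_eq_abs, abs_mul]
          exact mul_le_one₀ (Real.abs_cos_le_one _) (abs_nonneg _) (sqrt_pow_le_one n x))
      rw [Real.norm_eq_abs] at this
      norm_num at this
      exact this
    have h2 : (bI n s)^2 ≤ 4 := by
      rw [← sq_abs]; nlinarith [abs_nonneg (bI n s)]
    gcongr

lemma vol_slice (n : ℕ) (x : ℝ) (hx : |x| ≤ 1) :
    volume.real {w : Fin n → ℝ | x^2 + ∑ i, (w i)^2 ≤ 1} =
      Real.sqrt (1 - x^2) ^ n * volume.real (Metric.ball (0 : EuclideanSpace ℝ (Fin n)) 1) := by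
  have hx2 : 0 ≤ 1 - x^2 := by
    have := sq_abs x
    nlinarith [abs_nonneg x]
  have h1 : {w : Fin n → ℝ | x^2 + ∑ i, (w i)^2 ≤ 1} =
      (WithLp.toLp 2) ⁻¹' (Metric.closedBall (0 : EuclideanSpace ℝ (Fin n)) (Real.sqrt (1-x^2))) := by
    ext w
    simp only [Set.mem_ofPred_eq, Set.mem_preimage, mem_closedBall_zero_iff]
    rw [EuclideanSpace.norm_eq, Real.sqrt_le_sqrt_iff hx2]
    simp only [Real.norm_eq_abs, sq_abs]
    constructor <;> intro h <;> linarith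
  rw [h1, measureReal_def, (PiLp.volume_preserving_toLp (Fin n)).measure_preimage
    measurableSet_closedBall.nullMeasurableSet, Measure.addHaar_closedBall _ _ (Real.sqrt_nonneg _),
    ENNReal.toReal_mul, ENNReal.toReal_ofReal (by positivity), finrank_euclideanSpace_fin]
  rfl

lemma slice (n : ℕ) (s : ℝ) :
    ∫ y in Metric.closedBall (0 : EuclideanSpace ℝ (Fin (n+1))) 1, Real.cos (s * y 0) =
      volume.real (Metric.ball (0 : EuclideanSpace ℝ (Fin n)) 1) * bI n s := by
  set f : EuclideanSpace ℝ (Fin (n+1)) → ℝ :=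
    (Metric.closedBall (0 : EuclideanSpace ℝ (Fin (n+1))) 1).indicator (fun y => Real.cos (s * y 0))
    with hf
  have hfi : Integrable f := by
    rw [hf, integrable_indicator_iff measurableSet_closedBall]
    apply ContinuousOn.integrableOn_compact (isCompact_closedBall _ _)
    apply Continuous.continuousOn
    fun_prop
  rw [← integral_indicator measurableSet_closedBall, ← hf]
  have e1 := PiLp.volume_preserving_toLp (Fin (n+1))
  have m1 : MeasurableEmbedding (WithLp.toLp 2 : (Fin (n+1) → ℝ) → EuclideanSpace ℝ (Fin (n+1))) :=
    (MeasurableEquiv.toLp 2 (Fin (n+1) → ℝ)).measurableEmbedding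
  have e2 := (volume_preserving_piFinSuccAbove (fun _ : Fin (n+1) => ℝ) 0).symm
  have m2 := (MeasurableEquiv.piFinSuccAbove (fun _ : Fin (n+1) => ℝ) 0).symm.measurableEmbedding
  have i1 := (e1.integrable_comp_emb m1).2 hfi
  have i2 := (e2.integrable_comp_emb m2).2 i1
  rw [← e1.integral_comp m1, ← e2.integral_comp m2]
  simp only [Function.comp_def] at i2
  rw [Measure.volume_eq_prod, integral_prod _ i2]
  have key : ∀ (x : ℝ), (∫ w : Fin n → ℝ, f (WithLp.toLp 2
      ((MeasurableEquiv.piFinSuccAbove (fun _ : Fin (n+1) => ℝ) 0).symm (x, w)))) =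
      (Set.Icc (-1:ℝ) 1).indicator (fun x => Real.cos (s * x) * (Real.sqrt (1 - x^2) ^ n * 
        volume.real (Metric.ball (0 : EuclideanSpace ℝ (Fin n)) 1))) x := by
    intro x
    have hS : MeasurableSet {w : Fin n → ℝ | x^2 + ∑ i, (w i)^2 ≤ 1} := by
      apply measurableSet_le <;> fun_prop
    have : ∀ w : Fin n → ℝ, f (WithLp.toLp 2
      ((MeasurableEquiv.piFinSuccAbove (fun _ : Fin (n+1) => ℝ) 0).symm (x, w))) =
      {w : Fin n → ℝ | x^2 + ∑ i, (w i)^2 ≤ 1}.indicator (fun _ => Real.cos (s * x)) w := by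
      intro w
      have : (WithLp.toLp 2
      ((MeasurableEquiv.piFinSuccAbove (fun _ : Fin (n+1) => ℝ) 0).symm (x, w))) ∈ 
        (Metric.closedBall (0 : EuclideanSpace ℝ (Fin (n+1))) 1) ↔ 
        w ∈ {w : Fin n → ℝ | x^2 + ∑ i, (w i)^2 ≤ 1} := by
        simp only [Set.mem_ofPred_eq, mem_closedBall_zero_iff]
        rw [EuclideanSpace.norm_eq, Real.sqrt_le_iff, Fin.sum_univ_succ]
        simp [MeasurableEquiv.piFinSuccAbove]
      rw [hf]
      by_cases h : w ∈ {w : Fin n → ℝ | x^2 + ∑ i, (w i)^2 ≤ 1}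
      · rw [Set.indicator_of_mem h, Set.indicator_of_mem (this.2 h)]
        simp [MeasurableEquiv.piFinSuccAbove]
      · rw [Set.indicator_of_notMem h, Set.indicator_of_notMem (fun h' => h (this.1 h'))]
    simp_rw [this]
    rw [integral_indicator_const _ hS]
    by_cases hx : x ∈ Set.Icc (-1:ℝ) 1
    · rw [Set.indicator_of_mem hx, vol_slice n x (abs_le.2 hx), smul_eq_mul, mul_comm]
    · rw [Set.indicator_of_notMem hx]
      have : {w : Fin n → ℝ | x^2 + ∑ i, (w i)^2 ≤ 1} = ∅ := by
        ext w
        simp only [Set.mem_ofPred_eq, Set.mem_empty_iff_false, iff_false, not_le]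
        have h0 : 0 ≤ ∑ i, (w i)^2 := Finset.sum_nonneg fun i _ => sq_nonneg _
        have : 1 < |x| := by
          by_contra h
          exact hx (abs_le.1 (not_lt.1 h))
        have h2 := sq_abs x
        nlinarith
      rw [this]; simp
  have : (fun x : ℝ => ∫ w : Fin n → ℝ, f (WithLp.toLp 2
      ((MeasurableEquiv.piFinSuccAbove (fun _ : Fin (n+1) => ℝ) 0).symm (x, w)))) = _ := funext key
  rw [this, integral_indicator measurableSet_Icc, integral_Icc_eq_integral_Ioc,
    ← intervalIntegral.integral_of_le (by norm_num), bI, ← intervalIntegral.integral_const_mul]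
  congr 1
  ext x
  ring

lemma ball_rot (n : ℕ) (ξ : EuclideanSpace ℝ (Fin (n+1))) (hξ : ξ ≠ 0) :
    ∫ y in Metric.closedBall (0 : EuclideanSpace ℝ (Fin (n+1))) 1, Real.cos (inner ℝ ξ y) =
      ∫ y in Metric.closedBall (0 : EuclideanSpace ℝ (Fin (n+1))) 1, Real.cos (‖ξ‖ * y 0) := by
  have hn : ‖ξ‖ ≠ 0 := norm_ne_zero_iff.2 hξ
  obtain ⟨b, hb⟩ := Orthonormal.exists_orthonormalBasis_extension_of_card_eq (𝕜 := ℝ)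
    (E := EuclideanSpace ℝ (Fin (n+1))) (ι := Fin (n+1)) (by simp)
    (v := fun _ => ‖ξ‖⁻¹ • ξ) (s := {0}) (by
      constructor
      · intro i
        simp [norm_smul, hn]
      · intro i j hij
        exact absurd (Subsingleton.elim i j) hij)
  have hb0 : b 0 = ‖ξ‖⁻¹ • ξ := hb 0 (by simp)
  have hmp := b.repr.measurePreserving
  have hpre : b.repr ⁻¹' (Metric.closedBall (0 : EuclideanSpace ℝ (Fin (n+1))) 1) =
      Metric.closedBall (0 : EuclideanSpace ℝ (Fin (n+1))) 1 := by
    ext y; simp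
  rw [← hmp.setIntegral_preimage_emb b.repr.toHomeomorph.measurableEmbedding
    (fun y => Real.cos (‖ξ‖ * y 0)), hpre]
  congr 1
  ext y
  have : b.repr y 0 = inner ℝ (b 0) y := b.repr_apply_apply y 0
  rw [this, hb0, inner_smul_left]
  simp [hn]

lemma ball_ft (n : ℕ) : ∃ C : ℝ, 0 ≤ C ∧ ∀ (r : ℝ) (ξ : EuclideanSpace ℝ (Fin (n+1))), 0 < r → ξ ≠ 0 →
    (∫ y in Metric.closedBall (0 : EuclideanSpace ℝ (Fin (n+1))) r, Real.cos (inner ℝ ξ y))^2 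
      ≤ C * r^n / ‖ξ‖^(n+2) := by
  obtain ⟨C, hC, h⟩ := bI_bound n
  set v := volume.real (Metric.ball (0 : EuclideanSpace ℝ (Fin n)) 1)
  refine ⟨v^2 * C, by positivity, ?_⟩
  intro r ξ hr hξ
  have hn : 0 < ‖ξ‖ := norm_pos_iff.2 hξ
  have h1 := Measure.setIntegral_comp_smul_of_pos (volume : Measure (EuclideanSpace ℝ (Fin (n+1))))
    (fun y => Real.cos (inner ℝ ξ y)) (Metric.closedBall (0 : EuclideanSpace ℝ (Fin (n+1))) 1) hr
  rw [smul_unitClosedBall_of_nonneg hr.le] at h1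
  simp only [inner_smul_right, finrank_euclideanSpace_fin, smul_eq_mul] at h1
  have h2 : ∀ y, r * inner ℝ ξ y = inner ℝ (r • ξ) y := fun y => by simp [inner_smul_left]
  simp_rw [h2] at h1
  rw [ball_rot n (r • ξ) (smul_ne_zero hr.ne' hξ), slice] at h1
  have h3 : (∫ y in Metric.closedBall (0 : EuclideanSpace ℝ (Fin (n+1))) r, Real.cos (inner ℝ ξ y))
     = r^(n+1) * (v * bI n (‖r • ξ‖)) := by
    rw [h1]; field_simp
  rw [h3, norm_smul, Real.norm_eq_abs, abs_of_pos hr]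
  have h4 := h (r * ‖ξ‖) (by positivity)
  rw [le_div_iff₀ (by positivity)]
  calc _ = v^2 * r^n * (bI n (r * ‖ξ‖) ^ 2 * (r * ‖ξ‖) ^ (n + 2)) := by ring
    _ ≤ v^2 * r^n * C := by gcongr
    _ = _ := by ring


section torus

attribute [local instance] instMeasureSpaceUnitAddCircle

/-- The measure on `ℝ / ℤ` is a probability measure. -/
local instance probUnitCircle : IsProbabilityMeasure (volume : Measure UnitAddCircle) :=
  inferInstanceAs (IsProbabilityMeasure AddCircle.haarAddCircle)

/-- integer vector as real vector -/
def zc {d : ℕ} (m : Fin d → ℤ) : Fin d → ℝ := fun i => (m i : ℝ)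

/-- half-open cube -/
def cube (d : ℕ) : Set (Fin d → ℝ) := {x | ∀ i, x i ∈ Set.Ioc (0:ℝ) 1}

/-- character -/
def ek {d : ℕ} (k : Fin d → ℤ) (t : Fin d → ℝ) : ℂ :=
  Complex.exp (((-(2 * Real.pi * ∑ i, (k i : ℝ) * t i) : ℝ) : ℂ) * Complex.I)

lemma cube_meas (d : ℕ) : MeasurableSet (cube d) :=
  MeasurableSet.univ_pi' (fun _ => measurableSet_Ioc)

lemma mFourier_ek {d : ℕ} (k : Fin d → ℤ) (t : Fin d → ℝ) :
    UnitAddTorus.mFourier (-k) (fun i => (t i : UnitAddCircle)) = ek k t := by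
  simp only [UnitAddTorus.mFourier, ContinuousMap.coe_mk, fourier_coe_apply, ← Complex.exp_sum, ek]
  congr 1
  push_cast
  rw [Finset.mul_sum, ← Finset.sum_neg_distrib, Finset.sum_mul]
  apply Finset.sum_congr rfl
  intro i _
  simp
  ring

lemma torus_meas {d : ℕ} (F : (Fin d → ℝ) → ℝ) (hF : Measurable F) :
    Measurable (fun x : UnitAddTorus (Fin d) => F (fun i => (AddCircle.equivIoc 1 0 (x i)).1)) := by
  apply hF.comp
  apply measurable_pi_lambda
  intro i
  exact measurable_subtype_coe.comp
    ((AddCircle.measurableEquivIoc (1:ℝ) 0).measurable.comp (measurable_pi_apply i))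

lemma torus_lift {d : ℕ} (F : (Fin d → ℝ) → ℝ) (hper : ∀ t m, F (t + zc m) = F t) (t : Fin d → ℝ) :
    F (fun i => (AddCircle.equivIoc (1:ℝ) 0 ((t i : ℝ) : UnitAddCircle)).1) = F t := by
  have : ∀ i, ∃ m : ℤ, (AddCircle.equivIoc (1:ℝ) 0 ((t i : ℝ) : UnitAddCircle)).1 = t i + m := by
    intro i
    have h := AddCircle.coe_equivIoc (p := (1:ℝ)) (a := 0) (y := ((t i : ℝ) : UnitAddCircle))
    rw [← sub_eq_zero, ← AddCircle.coe_sub, AddCircle.coe_eq_zero_iff] at h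
    obtain ⟨m, hm⟩ := h
    refine ⟨m, ?_⟩
    rw [zsmul_eq_mul, mul_one] at hm
    linarith
  choose m hm using this
  rw [← hper t m]
  congr 1
  ext i
  exact hm i

lemma cube_shift {d : ℕ} (F : (Fin d → ℝ) → ℝ) (hper : ∀ t m, F (t + zc m) = F t) (q : Fin d → ℝ) :
    ∫ t in cube d, F (t + q) = ∫ t in cube d, F t := by
  let G : UnitAddTorus (Fin d) → ℝ := fun x => F (fun i => (AddCircle.equivIoc 1 0 (x i)).1)
  have h1 := UnitAddTorus.integral_preimage G 0
  have h2 := UnitAddTorus.integral_preimage G q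
  rw [h1] at h2
  simp only [G, torus_lift F hper] at h2
  have h0 : {x : Fin d → ℝ | ∀ i, x i ∈ Set.Ioc ((0 : Fin d → ℝ) i) ((0 : Fin d → ℝ) i + 1)} = cube d := by
    simp [cube]
  have h3 : (fun t => t + q) ⁻¹' {x : Fin d → ℝ | ∀ i, x i ∈ Set.Ioc (q i) (q i + 1)} = cube d := by
    ext t
    simp only [cube, Set.mem_preimage, Set.mem_ofPred_eq, Set.mem_Ioc, Pi.add_apply]
    refine forall_congr' fun i => ?_
    constructor <;> rintro ⟨h, h'⟩ <;> constructor <;> linarith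
  rw [h0] at h2
  have h4 := (measurePreserving_add_right volume q).setIntegral_preimage_emb
    (measurableEmbedding_addRight q) F {x : Fin d → ℝ | ∀ i, x i ∈ Set.Ioc (q i) (q i + 1)}
  rw [h2, ← h4, h3]

lemma cube_parseval {d : ℕ} (F : (Fin d → ℝ) → ℝ) (hper : ∀ t m, F (t + zc m) = F t)
    (hF : Measurable F) (K : ℝ) (hK : ∀ t, |F t| ≤ K) :
    HasSum (fun k : Fin d → ℤ => ‖∫ t in cube d, ek k t * (F t : ℂ)‖ ^ 2)
      (∫ t in cube d, (F t)^2) := by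
  let G : UnitAddTorus (Fin d) → ℂ := fun x => ((F (fun i => (AddCircle.equivIoc 1 0 (x i)).1) : ℝ) : ℂ)
  have hG : MemLp G 2 volume := by
    apply MemLp.of_bound (C := K)
    · exact (Complex.measurable_ofReal.comp (torus_meas F hF)).aestronglyMeasurable
    · refine Filter.Eventually.of_forall fun x => ?_
      simpa [G] using hK _
  have h0 : {x : Fin d → ℝ | ∀ i, x i ∈ Set.Ioc ((0 : Fin d → ℝ) i) ((0 : Fin d → ℝ) i + 1)} = cube d := by
    simp [cube]
  have h := UnitAddTorus.hasSum_sq_mFourierCoeff (hG.toLp G)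
  have e1 : ∫ t, ‖(hG.toLp G) t‖^2 = ∫ t in cube d, (F t)^2 := by
    have : ∫ t, ‖(hG.toLp G) t‖^2 = ∫ t, ‖G t‖^2 := by
      apply integral_congr_ae
      filter_upwards [hG.coeFn_toLp] with x hx
      rw [hx]
    rw [this, UnitAddTorus.integral_preimage _ 0, h0]
    simp only [G, torus_lift F hper]
    simp
  have e2 : ∀ k, UnitAddTorus.mFourierCoeff (hG.toLp G) k = ∫ t in cube d, ek k t * (F t : ℂ) := by
    intro k
    have : UnitAddTorus.mFourierCoeff (hG.toLp G) k = UnitAddTorus.mFourierCoeff G k := by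
      apply integral_congr_ae
      filter_upwards [hG.coeFn_toLp] with x hx
      rw [hx]
    rw [this, UnitAddTorus.mFourierCoeff_eq_integral _ _ 0, h0]
    simp only [G, torus_lift F hper, mFourier_ek, smul_eq_mul]
  rw [e1] at h
  simpa only [e2] using h

end torus

lemma unfold_cube {d : ℕ} {F : Type*} [NormedAddCommGroup F] [NormedSpace ℝ F]
    (h : (Fin d → ℝ) → F) (hi : Integrable h) (S : Finset (Fin d → ℤ))
    (hS : ∀ m ∉ S, ∀ t ∈ cube d, h (t + zc m) = 0) :
    ∑ m ∈ S, ∫ t in cube d, h (t + zc m) = ∫ x, h x := by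
  let s : (Fin d → ℤ) → Set (Fin d → ℝ) := fun m => {x | ∀ i, x i ∈ Set.Ioc (m i : ℝ) (m i + 1)}
  have hsm : ∀ m, MeasurableSet (s m) := fun m => MeasurableSet.univ_pi' (fun _ => measurableSet_Ioc)
  have hU : ⋃ m, s m = Set.univ := by
    ext x
    simp only [Set.mem_iUnion, Set.mem_univ, iff_true]
    refine ⟨fun i => ⌈x i⌉ - 1, fun i => ?_⟩
    have h1 := Int.ceil_lt_add_one (x i)
    have h2 := Int.le_ceil (x i)
    push_cast
    constructor <;> linarith
  have hd : Pairwise (Function.onFun Disjoint s) := by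
    intro m m' hmm
    rw [Function.onFun, Set.disjoint_left]
    intro x hx hx'
    apply hmm
    ext i
    have h1 := hx i
    have h2 := hx' i
    have a1 : (m i : ℝ) < m' i + 1 := h1.1.trans_le h2.2
    have a2 : (m' i : ℝ) < m i + 1 := h2.1.trans_le h1.2
    have b1 : m i < m' i + 1 := by exact_mod_cast a1
    have b2 : m' i < m i + 1 := by exact_mod_cast a2
    omega
  have key := integral_iUnion (f := h) (μ := volume) hsm hd (by rw [hU]; exact hi.integrableOn)
  rw [hU, setIntegral_univ] at key
  have hpre : ∀ m, (fun t => t + zc m) ⁻¹' (s m) = cube d := by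
    intro m
    ext t
    simp only [cube, s, zc, Set.mem_preimage, Set.mem_ofPred_eq, Set.mem_Ioc, Pi.add_apply]
    refine forall_congr' fun i => ?_
    constructor <;> rintro ⟨h, h'⟩ <;> constructor <;> linarith
  have hI : ∀ m, ∫ x in s m, h x = ∫ t in cube d, h (t + zc m) := by
    intro m
    rw [← (measurePreserving_add_right volume (zc m)).setIntegral_preimage_emb
      (measurableEmbedding_addRight (zc m)), hpre]
  simp_rw [hI] at key
  rw [key, tsum_eq_sum]
  intro m hm
  rw [setIntegral_congr_fun (cube_meas d) (fun t ht => hS m hm t ht)]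
  simp


section lattice

variable {d : ℕ}

lemma zc_add (m k : Fin d → ℤ) : zc (m + k) = zc m + zc k := by
  ext i; simp [zc]

lemma exists_box (ρ : ℝ) : ∃ S : Finset (Fin d → ℤ), ∀ m, ‖zc m‖ ≤ ρ → m ∈ S := by
  refine ⟨Fintype.piFinset fun _ => Finset.Icc (-⌈ρ⌉) ⌈ρ⌉, fun m hm => ?_⟩
  rw [Fintype.mem_piFinset]
  intro i
  have h1 : |(m i : ℝ)| ≤ ρ := (norm_le_pi_norm (zc m) i).trans hm
  have h2 := abs_le.1 (h1.trans (Int.le_ceil ρ))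
  rw [Finset.mem_Icc]
  exact ⟨by exact_mod_cast h2.1, by exact_mod_cast h2.2⟩

lemma exists_supp (A : (Fin d → ℝ) ≃L[ℝ] EuclideanSpace ℝ (Fin d)) (r R : ℝ) :
    ∃ S : Finset (Fin d → ℤ), ∀ m ∉ S, ∀ t, ‖t‖ ≤ R → r < ‖A (t + zc m)‖ := by
  obtain ⟨S, hS⟩ := exists_box (d := d) (‖(A.symm : EuclideanSpace ℝ (Fin d) →L[ℝ] (Fin d → ℝ))‖ * r + R)
  refine ⟨S, fun m hm t ht => ?_⟩
  by_contra h
  apply hm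
  apply hS
  have h1 : zc m = A.symm (A (t + zc m)) - t := by simp
  rw [h1]
  refine (norm_sub_le _ _).trans (add_le_add ?_ ht)
  refine ((A.symm : EuclideanSpace ℝ (Fin d) →L[ℝ] (Fin d → ℝ)).le_opNorm _).trans ?_
  gcongr
  exact not_lt.1 h

/-- lattice point count -/
def cnt (A : (Fin d → ℝ) ≃L[ℝ] EuclideanSpace ℝ (Fin d)) (r : ℝ) (t : Fin d → ℝ) : ℝ :=
  ∑' m : Fin d → ℤ, (Metric.closedBall (0 : EuclideanSpace ℝ (Fin d)) r).indicator (fun _ => (1:ℝ))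
    (A (t + zc m))

variable (A : (Fin d → ℝ) ≃L[ℝ] EuclideanSpace ℝ (Fin d))

lemma cnt_per (r : ℝ) (t : Fin d → ℝ) (k : Fin d → ℤ) : cnt A r (t + zc k) = cnt A r t := by
  unfold cnt
  rw [← (Equiv.addLeft k).tsum_eq (fun m => (Metric.closedBall (0 : EuclideanSpace ℝ (Fin d)) r).indicator (fun _ => (1:ℝ))
    (A (t + zc m)))]
  simp only [Equiv.coe_addLeft, zc_add, add_assoc]

lemma cnt_eq_sum {r R : ℝ} {S : Finset (Fin d → ℤ)}
    (hS : ∀ m ∉ S, ∀ t, ‖t‖ ≤ R → r < ‖A (t + zc m)‖) (t : Fin d → ℝ) (ht : ‖t‖ ≤ R) :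
    cnt A r t = ∑ m ∈ S, (Metric.closedBall (0 : EuclideanSpace ℝ (Fin d)) r).indicator
      (fun _ => (1:ℝ)) (A (t + zc m)) := by
  unfold cnt
  rw [tsum_eq_sum]
  intro m hm
  apply Set.indicator_of_notMem
  rw [mem_closedBall_zero_iff, not_le]
  exact hS m hm t ht

lemma ind_meas (r : ℝ) : Measurable ((Metric.closedBall (0 : EuclideanSpace ℝ (Fin d)) r).indicator
      (fun _ => (1:ℝ))) := measurable_const.indicator measurableSet_closedBall

lemma ind_nonneg (r : ℝ) (x) : 0 ≤ (Metric.closedBall (0 : EuclideanSpace ℝ (Fin d)) r).indicator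
      (fun _ => (1:ℝ)) x := Set.indicator_nonneg (fun _ _ => zero_le_one) x

lemma ind_le_one (r : ℝ) (x) : (Metric.closedBall (0 : EuclideanSpace ℝ (Fin d)) r).indicator
      (fun _ => (1:ℝ)) x ≤ 1 := Set.indicator_le_self' (fun _ _ => zero_le_one) x

lemma cnt_meas (r : ℝ) : Measurable (cnt A r) := by
  have : cnt A r = fun t => (∑' m : Fin d → ℤ, ENNReal.ofReal
      ((Metric.closedBall (0 : EuclideanSpace ℝ (Fin d)) r).indicator (fun _ => (1:ℝ))
    (A (t + zc m)))).toReal := by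
    ext t
    rw [ENNReal.tsum_toReal_eq (fun _ => ENNReal.ofReal_ne_top)]
    unfold cnt
    congr 1
    ext m
    rw [ENNReal.toReal_ofReal (ind_nonneg _ _)]
  rw [this]
  apply Measurable.ennreal_toReal
  apply Measurable.ennreal_tsum
  intro m
  apply Measurable.ennreal_ofReal
  apply (ind_meas r).comp
  fun_prop

lemma cube_norm (t : Fin d → ℝ) (ht : t ∈ cube d) : ‖t‖ ≤ 1 := by
  rw [pi_norm_le_iff_of_nonneg zero_le_one]
  intro i
  rw [Real.norm_eq_abs, abs_of_pos (ht i).1]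
  exact (ht i).2

lemma cnt_bdd (r : ℝ) : ∃ K, ∀ t, |cnt A r t| ≤ K := by
  obtain ⟨S, hS⟩ := exists_supp A r 1
  refine ⟨S.card, fun t => ?_⟩
  have : cnt A r t = cnt A r (t + zc (fun i => 1 - ⌈t i⌉)) := (cnt_per A r t _).symm
  rw [this, cnt_eq_sum A hS]
  · rw [abs_of_nonneg (Finset.sum_nonneg fun m _ => ind_nonneg _ _)]
    refine (Finset.sum_le_sum fun m _ => ind_le_one _ _).trans ?_
    simp
  · apply cube_norm
    intro i
    simp only [zc, Pi.add_apply]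
    have h1 := Int.ceil_lt_add_one (t i)
    have h2 := Int.le_ceil (t i)
    push_cast
    constructor <;> linarith

lemma preim_compact (r : ℝ) :
    IsCompact (A ⁻¹' (Metric.closedBall (0 : EuclideanSpace ℝ (Fin d)) r)) :=
  A.toHomeomorph.isCompact_preimage.2 (isCompact_closedBall _ _)

lemma ek_cont (k : Fin d → ℤ) : Continuous (ek k) := by
  unfold ek
  fun_prop

lemma ek_per (k m : Fin d → ℤ) (t : Fin d → ℝ) : ek k (t + zc m) = ek k t := by
  unfold ek
  rw [Complex.exp_eq_exp_iff_exists_int]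
  refine ⟨-∑ i, k i * m i, ?_⟩
  simp only [zc, Pi.add_apply, mul_add, Finset.sum_add_distrib]
  push_cast
  ring

lemma coef_eq (r : ℝ) (k : Fin d → ℤ) :
    ∫ t in cube d, ek k t * (cnt A r t : ℂ) =
      ∫ x in A ⁻¹' (Metric.closedBall (0 : EuclideanSpace ℝ (Fin d)) r), ek k x := by
  obtain ⟨S, hS⟩ := exists_supp A r 1
  set h : (Fin d → ℝ) → ℂ := (A ⁻¹' (Metric.closedBall (0 : EuclideanSpace ℝ (Fin d)) r)).indicator (ek k)
    with hh
  have hm : MeasurableSet (A ⁻¹' (Metric.closedBall (0 : EuclideanSpace ℝ (Fin d)) r)) :=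
    (preim_compact A r).measurableSet
  have hi : Integrable h := by
    rw [hh, integrable_indicator_iff hm]
    exact (ek_cont k).continuousOn.integrableOn_compact (preim_compact A r)
  have hS' : ∀ m ∉ S, ∀ t ∈ cube d, h (t + zc m) = 0 := by
    intro m hm t ht
    apply Set.indicator_of_notMem
    rw [Set.mem_preimage, mem_closedBall_zero_iff, not_le]
    exact hS m hm t (cube_norm t ht)
  rw [← integral_indicator hm, ← hh, ← unfold_cube h hi S hS', ← integral_finsetSum]
  · apply setIntegral_congr_fun (cube_meas d)
    intro t ht
    simp only
    rw [cnt_eq_sum A hS t (cube_norm t ht)]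
    push_cast
    rw [Finset.mul_sum]
    apply Finset.sum_congr rfl
    intro m _
    by_cases hb : A (t + zc m) ∈ Metric.closedBall (0 : EuclideanSpace ℝ (Fin d)) r
    · rw [Set.indicator_of_mem hb, hh, Set.indicator_of_mem (by exact hb), ek_per]
      simp
    · rw [Set.indicator_of_notMem hb, hh, Set.indicator_of_notMem (by exact hb)]
      simp
  · intro m _
    exact (hi.comp_add_right (zc m)).integrableOn

lemma exists_scale : ∃ c : NNReal, 0 < c ∧ Measure.map A volume = c • volume := by
  have := A.isAddHaarMeasure_map volume
  refine ⟨_, Measure.addHaarScalarFactor_pos_of_isAddHaarMeasure _ _, 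
    Measure.isAddLeftInvariant_eq_smul (Measure.map A volume) volume⟩

lemma coef_sq (n : ℕ) (A : (Fin (n+1) → ℝ) ≃L[ℝ] EuclideanSpace ℝ (Fin (n+1))) :
    ∃ C : ℝ, 0 ≤ C ∧ ∀ (r : ℝ) (k : Fin (n+1) → ℤ), 0 < r → k ≠ 0 →
    ‖∫ x in A ⁻¹' (Metric.closedBall (0 : EuclideanSpace ℝ (Fin (n+1))) r), ek k x‖^2 ≤ 
      C * r^n * (‖zc k‖⁻¹)^(n+2) := by
  obtain ⟨c, hc, hmap⟩ := exists_scale A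
  obtain ⟨C, hC, hft⟩ := ball_ft n
  set a : ℝ := ‖(A : (Fin (n+1) → ℝ) →L[ℝ] EuclideanSpace ℝ (Fin (n+1)))‖ with ha
  refine ⟨c^2 * C * a^(n+2), by positivity, ?_⟩
  intro r k hr hk
  set B := A ⁻¹' (Metric.closedBall (0 : EuclideanSpace ℝ (Fin (n+1))) r) with hB
  have hBm : MeasurableSet B := (preim_compact A r).measurableSet
  set L : EuclideanSpace ℝ (Fin (n+1)) →L[ℝ] ℝ := 
    (∑ i, (2 * Real.pi * (k i : ℝ)) • (ContinuousLinearMap.proj (R := ℝ) (φ := fun _ : Fin (n+1) => ℝ) i)).comp 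
      (A.symm : EuclideanSpace ℝ (Fin (n+1)) →L[ℝ] (Fin (n+1) → ℝ)) with hL
  set ξ := (InnerProductSpace.toDual ℝ (EuclideanSpace ℝ (Fin (n+1)))).symm L with hξ
  have hin : ∀ x, inner ℝ ξ (A x) = 2 * Real.pi * ∑ i, (k i : ℝ) * x i := by
    intro x
    rw [hξ, InnerProductSpace.toDual_symm_apply, hL]
    simp [Finset.mul_sum, mul_assoc]
  have hIntE : IntegrableOn (ek k) B := 
    (ek_cont k).continuousOn.integrableOn_compact (preim_compact A r)
  have hzk : 0 < ‖zc k‖ := by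
    rw [norm_pos_iff]
    intro h
    apply hk
    ext i
    have := congrFun h i
    simpa [zc] using this
  have hxk : ‖zc k‖ ≤ ‖ξ‖ * a := by
    rw [pi_norm_le_iff_of_nonneg (by positivity)]
    intro i
    have h1 := hin (Pi.single i 1)
    simp [Pi.single_apply] at h1
    have h2 : |inner ℝ ξ (A (Pi.single i 1))| ≤ ‖ξ‖ * a := by
      refine (abs_real_inner_le_norm _ _).trans ?_
      gcongr
      refine ((A : (Fin (n+1) → ℝ) →L[ℝ] EuclideanSpace ℝ (Fin (n+1))).le_opNorm _).trans ?_
      rw [Pi.norm_single]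
      simp [ha]
    rw [h1, abs_mul, abs_of_pos (by positivity)] at h2
    refine le_trans ?_ h2
    have : (1:ℝ) ≤ 2 * Real.pi := by linarith [Real.pi_gt_three]
    have h3 := abs_nonneg (k i : ℝ)
    simp only [zc, Real.norm_eq_abs]
    nlinarith
  have hξ0 : ξ ≠ 0 := by
    intro h
    rw [h] at hxk
    simp at hxk
    exact hzk.ne' (by simpa using hxk)
  have hξp : 0 < ‖ξ‖ := norm_pos_iff.2 hξ0
  have hap : 0 < a := by
    by_contra h
    have : ‖ξ‖ * a ≤ 0 := mul_nonpos_of_nonneg_of_nonpos hξp.le (not_lt.1 h)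
    linarith
  -- the integral is real
  have him : (∫ x in B, ek k x) = ((∫ x in B, Real.cos (inner ℝ ξ (A x)) : ℝ) : ℂ) := by
    have hsin : ∫ x in B, Real.sin (inner ℝ ξ (A x)) = 0 := by
      have h1 := integral_neg_eq_self (B.indicator fun x => Real.sin (inner ℝ ξ (A x))) volume
      have h2 : ∀ x, (B.indicator fun x => Real.sin (inner ℝ ξ (A x))) (-x) = 
          -(B.indicator fun x => Real.sin (inner ℝ ξ (A x))) x := by
        intro x
        have : -x ∈ B ↔ x ∈ B := by simp [hB]
        by_cases hx : x ∈ B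
        · rw [Set.indicator_of_mem hx, Set.indicator_of_mem (this.2 hx)]
          simp
        · rw [Set.indicator_of_notMem hx, Set.indicator_of_notMem (fun h => hx (this.1 h))]
          simp
      simp_rw [h2] at h1
      rw [integral_neg, integral_indicator hBm] at h1
      linarith
    have he : ∀ x, ek k x = ((Real.cos (inner ℝ ξ (A x)) : ℝ) : ℂ) - 
        ((Real.sin (inner ℝ ξ (A x)) : ℝ) : ℂ) * Complex.I := by
      intro x
      rw [ek, hin, Complex.exp_mul_I]
      push_cast
      rw [Complex.cos_neg, Complex.sin_neg]
      ring
    simp_rw [he]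
    rw [integral_sub, integral_mul_const, integral_complex_ofReal, integral_complex_ofReal, hsin]
    · simp
    · apply ContinuousOn.integrableOn_compact (preim_compact A r)
      apply Continuous.continuousOn
      fun_prop
    · apply ContinuousOn.integrableOn_compact (preim_compact A r)
      apply Continuous.continuousOn
      fun_prop
  have hcv : (∫ x in B, Real.cos (inner ℝ ξ (A x))) = 
      c * ∫ y in Metric.closedBall (0 : EuclideanSpace ℝ (Fin (n+1))) r, Real.cos (inner ℝ ξ y) := by
    have h1 := (A.toHomeomorph.measurableEmbedding).setIntegral_map (μ := volume)
      (fun y => Real.cos (inner ℝ ξ y)) (Metric.closedBall (0 : EuclideanSpace ℝ (Fin (n+1))) r)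
    have h2 : Measure.map A.toHomeomorph volume = c • volume := hmap
    rw [h2] at h1
    rw [Measure.restrict_smul, integral_smul_nnreal_measure] at h1
    exact h1.symm
  rw [him, Complex.norm_real, Real.norm_eq_abs, sq_abs, hcv, mul_pow]
  calc (c:ℝ)^2 * _ ≤ c^2 * (C * r^n / ‖ξ‖^(n+2)) := by gcongr; exact hft r ξ hr hξ0
    _ = c^2 * C * r^n * (‖ξ‖⁻¹)^(n+2) := by rw [inv_pow]; ring
    _ ≤ c^2 * C * r^n * (a * ‖zc k‖⁻¹)^(n+2) := by
      gcongr
      rw [inv_le_iff_one_le_mul₀ hξp, ← div_eq_mul_inv, div_mul_eq_mul_div, le_div_iff₀ hzk]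
      linarith
    _ = _ := by rw [mul_pow]; ring

lemma summ_zc (d : ℕ) : Summable (fun k : Fin d → ℤ => (‖zc k‖⁻¹)^(d+1)) := by
  set L := Submodule.span ℤ (Set.range (Pi.basisFun ℝ (Fin d))) with hL
  have h := ZLattice.summable_norm_sub_inv_pow L (d+1) (by 
    rw [ZLattice.rank ℝ L]; simp) 0
  have hmem : ∀ k : Fin d → ℤ, zc k ∈ L := by
    intro k
    have : zc k = ∑ i, k i • (Pi.basisFun ℝ (Fin d)) i := by
      ext j
      simp [zc, Pi.single_apply]
    rw [this]
    exact Submodule.sum_mem _ fun i _ => Submodule.smul_mem _ _ (Submodule.subset_span ⟨i, rfl⟩)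
  have hinj : Function.Injective (fun k : Fin d → ℤ => (⟨zc k, hmem k⟩ : L)) := by
    intro k k' hk
    ext i
    have := congrFun (Subtype.ext_iff.1 hk) i
    simpa [zc] using this
  have := h.comp_injective hinj
  simpa [Function.comp_def] using this

lemma lat_var (n : ℕ) (A : (Fin (n+1) → ℝ) ≃L[ℝ] EuclideanSpace ℝ (Fin (n+1))) :
    ∃ C : ℝ, 0 ≤ C ∧ ∀ (r : ℝ), 0 < r → ∀ q,
    ∫ t in cube (n+1), (cnt A r (t + q) - 
      volume.real (A ⁻¹' (Metric.closedBall (0 : EuclideanSpace ℝ (Fin (n+1))) r)))^2 ≤ C * r^n := by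
  obtain ⟨C, hC, hco⟩ := coef_sq n A
  have hs := summ_zc (n+1)
  refine ⟨C * ∑' k : Fin (n+1) → ℤ, (‖zc k‖⁻¹)^(n+2), by positivity, ?_⟩
  intro r hr q
  set V := volume.real (A ⁻¹' (Metric.closedBall (0 : EuclideanSpace ℝ (Fin (n+1))) r)) with hV
  rw [cube_shift (fun t => (cnt A r t - V)^2) (fun t m => by rw [cnt_per])]
  obtain ⟨K, hK⟩ := cnt_bdd A r
  have hpar := cube_parseval (cnt A r) (fun t m => by rw [cnt_per]) (cnt_meas A r) K hK
  have hvol : volume.real (cube (n+1)) = 1 := by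
    have : cube (n+1) = Set.pi Set.univ (fun _ => Set.Ioc (0:ℝ) 1) := by
      ext; simp [cube]
    rw [measureReal_def, this, Real.volume_pi_Ioc]
    simp
  have hfin : IsFiniteMeasure (volume.restrict (cube (n+1))) := by
    refine ⟨?_⟩
    rw [Measure.restrict_apply_univ]
    by_contra h
    rw [not_lt, top_le_iff] at h
    rw [measureReal_def, h] at hvol
    simp at hvol
  have hi1 : Integrable (cnt A r) (volume.restrict (cube (n+1))) :=
    Integrable.of_bound (cnt_meas A r).aestronglyMeasurable K (ae_of_all _ hK)
  have hi2 : Integrable (fun t => (cnt A r t)^2) (volume.restrict (cube (n+1))) := by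
    refine Integrable.of_bound ((cnt_meas A r).pow_const 2).aestronglyMeasurable (K^2)
      (ae_of_all _ fun t => ?_)
    rw [norm_pow]
    gcongr
    exact hK t
  have hek0 : ∀ t : Fin (n+1) → ℝ, ek 0 t = 1 := by
    intro t; simp [ek]
  have hc0 := coef_eq A r 0
  have hmean : ∫ t in cube (n+1), cnt A r t = V := by
    simp only [hek0, one_mul] at hc0
    rw [integral_complex_ofReal] at hc0
    have h2 : (∫ x in A ⁻¹' (Metric.closedBall (0 : EuclideanSpace ℝ (Fin (n+1))) r), (1:ℂ)) = (V : ℂ) := by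
      rw [setIntegral_const, ← hV]; simp
    rw [h2] at hc0
    exact_mod_cast hc0
  have hexp : ∫ t in cube (n+1), (cnt A r t - V)^2 = (∫ t in cube (n+1), (cnt A r t)^2) - V^2 := by
    have : ∀ t, (cnt A r t - V)^2 = (cnt A r t)^2 - 2 * V * cnt A r t + V^2 := fun t => by ring
    simp only [this]
    have h3 : Integrable (fun t => (cnt A r t)^2 - 2 * V * cnt A r t) (volume.restrict (cube (n+1))) :=
      hi2.sub (hi1.const_mul _)
    rw [integral_add h3 (integrable_const _),
      integral_sub hi2 (hi1.const_mul _), integral_const_mul, hmean, setIntegral_const, hvol]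
    simp only [one_smul]
    ring
  have hpar2 := hpar.update 0 0
  rw [hexp]
  have hc0' : ‖∫ t in cube (n+1), ek 0 t * (cnt A r t : ℂ)‖^2 = V^2 := by
    have : ∫ t in cube (n+1), ek 0 t * (cnt A r t : ℂ) = (V : ℂ) := by
      simp only [hek0, one_mul]
      rw [integral_complex_ofReal, hmean]
    rw [this]
    simp
  rw [hc0'] at hpar2
  have he : (∫ t in cube (n+1), (cnt A r t)^2) - V^2 = 0 - V^2 + ∫ t in cube (n+1), (cnt A r t)^2 := by
    ring
  rw [he, ← hpar2.tsum_eq]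
  refine (hpar2.summable.tsum_le_tsum (fun k => ?_) (hs.mul_left (C * r^n))).trans ?_
  · by_cases hk : k = 0
    · subst hk
      rw [Function.update_self]
      positivity
    · rw [Function.update_of_ne hk, coef_eq]
      exact hco r k hr hk
  · rw [tsum_mul_left]
    apply le_of_eq; ring

end lattice

section mixing

variable {Ω : Type*} [MeasurableSpace Ω] (P : Measure Ω) [IsProbabilityMeasure P]

lemma prob_diff_le (A B : Set Ω) :
    |(P A).toReal * (P B).toReal - (P (A ∩ B)).toReal| ≤ 1 := by
  change |P.real A * P.real B - P.real (A ∩ B)| ≤ 1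
  have h1 : P.real A ≤ 1 := measureReal_le_one
  have h2 : P.real B ≤ 1 := measureReal_le_one
  have h3 : P.real (A ∩ B) ≤ 1 := measureReal_le_one
  have h4 : 0 ≤ P.real A := measureReal_nonneg
  have h5 : 0 ≤ P.real B := measureReal_nonneg
  have h6 : 0 ≤ P.real (A ∩ B) := measureReal_nonneg
  rw [abs_le]
  constructor <;> nlinarith [mul_nonneg h4 h5]

lemma le_alphaSigma {Ω : Type*} (m₁ m₂ : MeasurableSpace Ω) [MeasurableSpace Ω] (P : Measure Ω)
    [IsProbabilityMeasure P] (A B : Set Ω) (hA : MeasurableSet[m₁] A)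
    (hB : MeasurableSet[m₂] B) :
    |(P A).toReal * (P B).toReal - (P (A ∩ B)).toReal| ≤ alphaSigma P m₁ m₂ := by
  apply le_csSup
  · refine ⟨1, ?_⟩
    rintro x ⟨A, B, -, -, rfl⟩
    exact prob_diff_le P A B
  · exact ⟨A, B, hA, hB, rfl⟩

lemma alphaSigma_le_one {Ω : Type*} (m₁ m₂ : MeasurableSpace Ω) [MeasurableSpace Ω] (P : Measure Ω)
    [IsProbabilityMeasure P] : alphaSigma P m₁ m₂ ≤ 1 := by
  apply Real.sSup_le _ zero_le_one
  rintro x ⟨A, B, -, -, rfl⟩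
  exact prob_diff_le P A B

lemma alphaSigma_nonneg {Ω : Type*} (m₁ m₂ : MeasurableSpace Ω) [MeasurableSpace Ω] (P : Measure Ω) :
    0 ≤ alphaSigma P m₁ m₂ := by
  apply Real.sSup_nonneg
  rintro x ⟨A, B, -, -, rfl⟩
  exact abs_nonneg _

lemma meas_sigmaGen {Ω : Type*} {d : ℕ} (p : (Fin d → ℤ) → Ω → EuclideanSpace ℝ (Fin d))
    (m : Fin d → ℤ) (G : Set (EuclideanSpace ℝ (Fin d))) (hG : MeasurableSet G) :
    MeasurableSet[sigmaGen p (({m} : Finset (Fin d → ℤ)) : Set (Fin d → ℤ))] (p m ⁻¹' G) := by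
  have : MeasurableSpace.comap (p m) inferInstance ≤
      sigmaGen p (({m} : Finset (Fin d → ℤ)) : Set (Fin d → ℤ)) :=
    le_iSup₂ (f := fun i (_ : i ∈ (({m} : Finset (Fin d → ℤ)) : Set (Fin d → ℤ))) =>
      MeasurableSpace.comap (p i) inferInstance) m (by simp)
  exact this _ ⟨G, hG, rfl⟩

variable {d : ℕ} (Lpt : (Fin d → ℤ) → EuclideanSpace ℝ (Fin d))
    (p : (Fin d → ℤ) → Ω → EuclideanSpace ℝ (Fin d))

lemma mixCoef_nonneg (x : ℝ) : 0 ≤ mixCoef P Lpt p x := by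
  apply Real.sSup_nonneg
  rintro x ⟨A, B, -, rfl⟩
  exact alphaSigma_nonneg _ _ _

lemma le_mixCoef (m k : Fin d → ℤ) (G H : Set (EuclideanSpace ℝ (Fin d)))
    (hG : MeasurableSet G) (hH : MeasurableSet H) :
    |P.real (p m ⁻¹' G) * P.real (p k ⁻¹' H) - P.real (p m ⁻¹' G ∩ p k ⁻¹' H)| ≤
      mixCoef P Lpt p ‖Lpt m - Lpt k‖ := by
  refine (le_alphaSigma _ _ P _ _ (meas_sigmaGen p m G hG) (meas_sigmaGen p k H hH)).trans ?_
  apply le_csSup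
  · refine ⟨1, ?_⟩
    rintro x ⟨A, B, -, rfl⟩
    exact alphaSigma_le_one _ _ _
  · refine ⟨{m}, {k}, ?_, rfl⟩
    intro i hi j hj
    rw [Finset.mem_singleton] at hi hj
    rw [hi, hj]

lemma memLp_ind (hpm : ∀ m, Measurable (p m)) (m : Fin d → ℤ) (G : Set (EuclideanSpace ℝ (Fin d)))
    (hG : MeasurableSet G) : MemLp (fun ω => G.indicator (fun _ => (1:ℝ)) (p m ω)) 2 P := by
  refine MemLp.of_bound (C := 1) ((measurable_const.indicator hG).comp (hpm m)).aestronglyMeasurable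
    (ae_of_all _ fun ω => ?_)
  rw [Real.norm_eq_abs]
  by_cases h : p m ω ∈ G <;> simp [h]

lemma cov_ind_le (hpm : ∀ m, Measurable (p m)) (m k : Fin d → ℤ)
    (G H : Set (EuclideanSpace ℝ (Fin d)))
    (hG : MeasurableSet G) (hH : MeasurableSet H) :
    cov[fun ω => G.indicator (fun _ => (1:ℝ)) (p m ω), fun ω => H.indicator (fun _ => (1:ℝ)) (p k ω); P]
      ≤ mixCoef P Lpt p ‖Lpt m - Lpt k‖ := by
  rw [covariance_eq_sub (memLp_ind P p hpm m G hG) (memLp_ind P p hpm k H hH)]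
  have e1 : ∀ (m : Fin d → ℤ) (G : Set (EuclideanSpace ℝ (Fin d))), MeasurableSet G → 
      ∫ ω, G.indicator (fun _ => (1:ℝ)) (p m ω) ∂P = P.real (p m ⁻¹' G) := by
    intro m G hG
    rw [← integral_indicator_one (hpm m hG)]
    rfl
  have e2 : ∫ ω, ((fun ω => G.indicator (fun _ => (1:ℝ)) (p m ω)) *
      (fun ω => H.indicator (fun _ => (1:ℝ)) (p k ω))) ω ∂P = P.real (p m ⁻¹' G ∩ p k ⁻¹' H) := by
    rw [← integral_indicator_one ((hpm m hG).inter (hpm k hH)), Set.inter_indicator_one]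
    rfl
  rw [e1 m G hG, e1 k H hH, e2]
  refine le_trans ?_ (le_mixCoef P Lpt p m k G H hG hH)
  rw [abs_sub_comm]
  exact le_abs_self _

lemma cov_const (X Y : Ω → ℝ) (c : ℝ) (h : X =ᵐ[P] fun _ => c) : cov[X, Y; P] = 0 := by
  unfold covariance
  have h1 : ∫ ω, X ω ∂P = c := by
    rw [integral_congr_ae h]; simp
  rw [h1]
  have : (fun ω => (X ω - c) * (Y ω - ∫ ω, Y ω ∂P)) =ᵐ[P] fun _ => 0 := by
    filter_upwards [h] with ω hω
    rw [hω]; simp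
  rw [integral_congr_ae this]; simp

lemma var_sum_le (hpm : ∀ m, Measurable (p m)) (hsub : ∀ m k, Lpt (m - k) = Lpt m - Lpt k)
    (hsum : Summable (fun m : Fin d → ℤ => mixCoef P Lpt p ‖Lpt m‖))
    (G : (Fin d → ℤ) → Set (EuclideanSpace ℝ (Fin d))) (hG : ∀ m, MeasurableSet (G m))
    (S : Finset (Fin d → ℤ)) (w : (Fin d → ℤ) → ℝ) (hw0 : ∀ m, 0 ≤ w m)
    (hw : ∀ m, 1 ≤ w m ∨ ∃ c : ℝ, (fun ω => (G m).indicator (fun _ => (1:ℝ)) (p m ω)) =ᵐ[P] fun _ => c) :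
    Var[fun ω => ∑ m ∈ S, (G m).indicator (fun _ => (1:ℝ)) (p m ω); P] ≤
      (∑' m, mixCoef P Lpt p ‖Lpt m‖) * ∑ m ∈ S, w m := by
  rw [variance_fun_sum' (fun m _ => memLp_ind P p hpm m (G m) (hG m)), Finset.mul_sum]
  refine Finset.sum_le_sum fun m _ => ?_
  have hK : 0 ≤ ∑' m, mixCoef P Lpt p ‖Lpt m‖ := tsum_nonneg fun m => mixCoef_nonneg _ _ _ _
  rcases hw m with h | ⟨c, hc⟩
  · refine le_trans ?_ (le_mul_of_one_le_right hK h)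
    refine (Finset.sum_le_sum fun k _ => cov_ind_le P Lpt p hpm m k _ _ (hG m) (hG k)).trans ?_
    simp only [← hsub]
    rw [← (Equiv.subLeft m).tsum_eq]
    exact Summable.sum_le_tsum S (fun k _ => mixCoef_nonneg _ _ _ _)
      ((Equiv.subLeft m).summable_iff.2 hsum)
  · rw [Finset.sum_eq_zero fun k _ => cov_const P _ _ c hc]
    exact mul_nonneg hK (hw0 m)

end mixing

section geom

lemma cube_vol (d : ℕ) : volume (cube d) = 1 := by
  have : cube d = Set.pi Set.univ (fun _ => Set.Ioc (0:ℝ) 1) := by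
    ext; simp [cube]
  rw [this, Real.volume_pi_Ioc]
  simp

lemma law_U {d : ℕ} (A : (Fin d → ℝ) ≃L[ℝ] EuclideanSpace ℝ (Fin d))
    (μ : Measure (EuclideanSpace ℝ (Fin d))) [IsProbabilityMeasure μ]
    (h : μ = (volume (A '' {t | ∀ i, t i ∈ Set.Ico (0:ℝ) 1}))⁻¹ •
      volume.restrict (A '' {t | ∀ i, t i ∈ Set.Ico (0:ℝ) 1})) :
    μ = Measure.map A (volume.restrict (cube d)) := by
  obtain ⟨c, hc, hmap⟩ := exists_scale A
  set Q : Set (Fin d → ℝ) := {t | ∀ i, t i ∈ Set.Ico (0:ℝ) 1} with hQ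
  have hQc : Q =ᵐ[volume] cube d := by
    have e1 : Q = Set.pi Set.univ (fun _ => Set.Ico (0:ℝ) 1) := by
      ext; simp [hQ]
    have e2 : cube d = Set.pi Set.univ (fun _ => Set.Ioc (0:ℝ) 1) := by
      ext; simp [cube]
    rw [e1, e2]
    exact Measure.univ_pi_Ico_ae_eq_Icc.trans Measure.univ_pi_Ioc_ae_eq_Icc.symm
  have hpre : A ⁻¹' (A '' Q) = Q := Set.preimage_image_eq _ A.injective
  have hQm : MeasurableSet (A '' Q) := by
    rw [A.image_eq_preimage_symm]
    exact A.symm.continuous.measurable (MeasurableSet.univ_pi' (fun _ => measurableSet_Ico))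
  have h1 : Measure.map A (volume.restrict (cube d)) = (c : ENNReal) • volume.restrict (A '' Q) := by
    have h2 := Measure.restrict_map (μ := volume) A.continuous.measurable hQm
    rw [hpre] at h2
    rw [← Measure.restrict_congr_set hQc, ← h2, hmap]
    simp [Measure.restrict_smul]
  have hprob : (Measure.map A (volume.restrict (cube d))) Set.univ = 1 := by
    rw [Measure.map_apply A.continuous.measurable MeasurableSet.univ]
    simp [cube_vol]
  have hQv : (c : ENNReal) * volume (A '' Q) = 1 := by
    rw [h1] at hprob
    simpa using hprob
  rw [h, h1]
  congr 1
  exact (ENNReal.eq_inv_of_mul_eq_one_left hQv).symm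

lemma ann_vol (n : ℕ) (A : (Fin (n+1) → ℝ) ≃L[ℝ] EuclideanSpace ℝ (Fin (n+1))) (M : ℝ) (hM : 0 ≤ M) :
    ∃ C : ℝ, 0 ≤ C ∧ ∀ r : ℝ, 1 ≤ r → M < r →
      volume.real (A ⁻¹' (Metric.closedBall (0 : EuclideanSpace ℝ (Fin (n+1))) (r + M) \
        Metric.ball 0 (r - M))) ≤ C * r^n := by
  obtain ⟨c, hc, hmap⟩ := exists_scale A
  set v := volume.real (Metric.ball (0 : EuclideanSpace ℝ (Fin (n+1))) 1) with hv
  have hv0 : 0 ≤ v := measureReal_nonneg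
  refine ⟨c * (2 * M * (n+1) * (1 + M)^n * v), by positivity, fun r hr hMr => ?_⟩
  have hms : MeasurableSet (Metric.closedBall (0 : EuclideanSpace ℝ (Fin (n+1))) (r + M) \
        Metric.ball 0 (r - M)) := measurableSet_closedBall.diff measurableSet_ball
  have e1 : volume.real (A ⁻¹' (Metric.closedBall (0 : EuclideanSpace ℝ (Fin (n+1))) (r + M) \
        Metric.ball 0 (r - M))) = c * volume.real (Metric.closedBall (0 : EuclideanSpace ℝ (Fin (n+1))) (r + M) \
        Metric.ball 0 (r - M)) := by
    rw [measureReal_def, ← Measure.map_apply A.continuous.measurable hms, hmap]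
    simp [measureReal_def]
  rw [e1, measureReal_sdiff ?_ measurableSet_ball measure_closedBall_lt_top.ne]
  · have e2 : volume.real (Metric.closedBall (0 : EuclideanSpace ℝ (Fin (n+1))) (r + M)) = (r+M)^(n+1) * v := by
      rw [Measure.addHaar_real_closedBall _ _ (by linarith)]
      simp [hv]
    have e3 : volume.real (Metric.ball (0 : EuclideanSpace ℝ (Fin (n+1))) (r - M)) = (r-M)^(n+1) * v := by
      rw [measureReal_def, Measure.addHaar_ball _ _ (by linarith)]
      simp [hv, measureReal_def, hMr.le]
    rw [e2, e3]
    have h := abs_pow_sub_pow_le (r+M) (r-M) (n+1)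
    have h1 : |r + M| = r + M := abs_of_nonneg (by linarith)
    have h2 : |r - M| = r - M := abs_of_nonneg (by linarith)
    rw [h1, h2, max_eq_left (by linarith)] at h
    have h3 : |r + M - (r - M)| = 2 * M := by
      rw [abs_of_nonneg (by linarith)]; ring
    rw [h3] at h
    have h4 := (le_abs_self _).trans h
    have h5 : (r + M)^n ≤ ((1+M) * r)^n := by
      apply pow_le_pow_left₀ (by linarith)
      nlinarith
    rw [mul_pow] at h5
    simp only [Nat.add_sub_cancel] at h4
    push_cast at h4
    have h6 : 2 * M * (n+1) * (r+M)^n ≤ 2 * M * (n+1) * ((1+M)^n * r^n) := by gcongr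
    calc _ = c * (((r+M)^(n+1) - (r-M)^(n+1)) * v) := by ring
      _ ≤ c * ((2 * M * (n+1) * ((1+M)^n * r^n)) * v) := by
          gcongr; exact h4.trans h6
      _ = _ := by ring
  · intro x hx
    rw [Metric.mem_ball] at hx
    rw [Metric.mem_closedBall]
    linarith

end geom

section main

variable {Ω : Type*} [MeasurableSpace Ω] (P : Measure Ω) [IsProbabilityMeasure P]

lemma sq_split (X : Ω → ℝ) (hX : MemLp X 2 P) (c : ℝ) :
    ∫ ω, (X ω - c)^2 ∂P = Var[X; P] + (∫ ω, X ω ∂P - c)^2 := by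
  have h1 := variance_sub_const hX.aestronglyMeasurable c
  have h2 := variance_eq_sub (hX.sub (memLp_const c))
  have h3 : (X - fun _ => c) = fun ω => X ω - c := rfl
  rw [h3, h1] at h2
  rw [h2, integral_sub (hX.integrable (by norm_num)) (integrable_const c)]
  simp [Pi.pow_apply]

variable {n : ℕ} (A : (Fin (n+1) → ℝ) ≃L[ℝ] EuclideanSpace ℝ (Fin (n+1)))
    (Lpt : (Fin (n+1) → ℤ) → EuclideanSpace ℝ (Fin (n+1)))
    (p : (Fin (n+1) → ℤ) → Ω → EuclideanSpace ℝ (Fin (n+1)))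

lemma cond_bound (hA : ∀ m, Lpt m = A (zc m)) (hpm : ∀ m, Measurable (p m))
    (hmap : ∀ m, Measure.map (p m) P = Measure.map (p 0) P) (M : ℝ)
    (hbd : ∀ m, ∀ᵐ ω ∂P, ‖p m ω‖ ≤ M)
    (hsum : Summable (fun m => mixCoef P Lpt p ‖Lpt m‖)) (r : ℝ)
    (S : Finset (Fin (n+1) → ℤ)) (hS : ∀ m ∉ S, ∀ t, ‖t‖ ≤ 1 → r + M < ‖A (t + zc m)‖)
    (t : Fin (n+1) → ℝ) (ht : ‖t‖ ≤ 1) (c : ℝ) :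
    ∫ ω, (∑ m ∈ S, (Metric.closedBall (0 : EuclideanSpace ℝ (Fin (n+1))) r).indicator (fun _ => (1:ℝ))
        (A (t + zc m) + p m ω) - c)^2 ∂P ≤
      (∑' m, mixCoef P Lpt p ‖Lpt m‖) * (∑ m ∈ S,
        (Metric.closedBall (0 : EuclideanSpace ℝ (Fin (n+1))) (r + M) \
        Metric.ball 0 (r - M)).indicator (fun _ => (1:ℝ)) (A (t + zc m))) +
      ∫ ω, (cnt A r (t + A.symm (p 0 ω)) - c)^2 ∂P := by
  set I := (Metric.closedBall (0 : EuclideanSpace ℝ (Fin (n+1))) r).indicator (fun _ => (1:ℝ)) with hI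
  set G : (Fin (n+1) → ℤ) → Set (EuclideanSpace ℝ (Fin (n+1))) :=
    fun m => (fun x => A (t + zc m) + x) ⁻¹' (Metric.closedBall 0 r) with hGdef
  have hG : ∀ m, MeasurableSet (G m) := fun m =>
    (measurable_const_add _) measurableSet_closedBall
  have hGI : ∀ m x, (G m).indicator (fun _ => (1:ℝ)) x = I (A (t + zc m) + x) := fun m x => rfl
  have hImeas : Measurable I := ind_meas r
  have hX2 : ∀ m k, MemLp (fun ω => I (A (t + zc m) + p k ω)) 2 P := by
    intro m k
    simp only [← hGI]
    exact memLp_ind P p hpm k (G m) (hG m)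
  have hsub : ∀ m k, Lpt (m - k) = Lpt m - Lpt k := by
    intro m k
    rw [hA, hA, hA, ← map_sub]
    congr 1
    ext i
    simp [zc]
  have hvar := var_sum_le P Lpt p hpm hsub hsum G hG S
    (fun m => (Metric.closedBall (0 : EuclideanSpace ℝ (Fin (n+1))) (r + M) \
        Metric.ball 0 (r - M)).indicator (fun _ => (1:ℝ)) (A (t + zc m)))
    (fun m => Set.indicator_nonneg (fun _ _ => zero_le_one) _) (by
      intro m
      by_cases h : A (t + zc m) ∈ (Metric.closedBall (0 : EuclideanSpace ℝ (Fin (n+1))) (r + M) \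
        Metric.ball 0 (r - M))
      · left; simp only [Set.indicator_of_mem h]; exact le_rfl
      · right
        simp only [hGI]
        rw [Set.mem_sdiff, not_and_or, not_not, mem_closedBall_zero_iff, mem_ball_zero_iff, not_le] at h
        rcases h with h | h
        · refine ⟨0, ?_⟩
          filter_upwards [hbd m] with ω hω
          rw [hI, Set.indicator_of_notMem]
          rw [mem_closedBall_zero_iff, not_le]
          have := norm_sub_le (A (t + zc m) + p m ω) (p m ω)
          rw [add_sub_cancel_right] at this
          linarith
        · refine ⟨1, ?_⟩
          filter_upwards [hbd m] with ω hω
          rw [hI, Set.indicator_of_mem]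
          rw [mem_closedBall_zero_iff]
          have := norm_add_le (A (t + zc m)) (p m ω)
          linarith)
  simp only [hGI] at hvar
  have hXs : MemLp (fun ω => ∑ m ∈ S, I (A (t + zc m) + p m ω)) 2 P :=
    memLp_finsetSum S fun m _ => hX2 m m
  rw [sq_split P _ hXs c]
  refine add_le_add hvar ?_
  have hY : (fun ω => cnt A r (t + A.symm (p 0 ω))) =ᵐ[P] fun ω => ∑ m ∈ S, I (A (t + zc m) + p 0 ω) := by
    filter_upwards [hbd 0] with ω hω
    have e : ∀ m, A (t + A.symm (p 0 ω) + zc m) = A (t + zc m) + p 0 ω := by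
      intro m
      simp only [map_add, ContinuousLinearEquiv.apply_symm_apply]
      abel
    unfold cnt
    simp only [e]
    rw [tsum_eq_sum]
    intro m hm
    rw [Set.indicator_of_notMem]
    rw [mem_closedBall_zero_iff, not_le]
    have := norm_sub_le (A (t + zc m) + p 0 ω) (p 0 ω)
    rw [add_sub_cancel_right] at this
    have := hS m hm t ht
    linarith
  have hYs : MemLp (fun ω => ∑ m ∈ S, I (A (t + zc m) + p 0 ω)) 2 P :=
    memLp_finsetSum S fun m _ => hX2 m 0
  have hYsq : ∫ ω, (cnt A r (t + A.symm (p 0 ω)) - c)^2 ∂P =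
      ∫ ω, (∑ m ∈ S, I (A (t + zc m) + p 0 ω) - c)^2 ∂P := by
    apply integral_congr_ae
    filter_upwards [hY] with ω hω
    rw [hω]
  rw [hYsq, sq_split P _ hYs c]
  have hmean : ∫ ω, ∑ m ∈ S, I (A (t + zc m) + p m ω) ∂P = ∫ ω, ∑ m ∈ S, I (A (t + zc m) + p 0 ω) ∂P := by
    rw [integral_finsetSum _ fun m _ => (hX2 m m).integrable (by norm_num),
      integral_finsetSum _ fun m _ => (hX2 m 0).integrable (by norm_num)]
    refine Finset.sum_congr rfl fun m _ => ?_
    have hs : StronglyMeasurable fun x => I (A (t + zc m) + x) :=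
      (hImeas.comp (measurable_const_add _)).stronglyMeasurable
    rw [← integral_map (hpm m).aemeasurable hs.aestronglyMeasurable,
      ← integral_map (hpm 0).aemeasurable hs.aestronglyMeasurable, hmap m]
  rw [hmean]
  exact le_add_of_nonneg_left (variance_nonneg _ _)

end main

section main

variable {Ω : Type*} [MeasurableSpace Ω] (P : Measure Ω) [IsProbabilityMeasure P]

variable {n : ℕ} (A : (Fin (n+1) → ℝ) ≃L[ℝ] EuclideanSpace ℝ (Fin (n+1)))
    (Lpt : (Fin (n+1) → ℤ) → EuclideanSpace ℝ (Fin (n+1)))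
    (p : (Fin (n+1) → ℤ) → Ω → EuclideanSpace ℝ (Fin (n+1)))

set_option maxHeartbeats 1000000 in
lemma main_bound (hA : ∀ m, Lpt m = A (zc m)) (hpm : ∀ m, Measurable (p m))
    (hmap : ∀ m, Measure.map (p m) P = Measure.map (p 0) P) (M : ℝ) (hM : 0 ≤ M)
    (hbd : ∀ m, ∀ᵐ ω ∂P, ‖p m ω‖ ≤ M)
    (hsum : Summable (fun m => mixCoef P Lpt p ‖Lpt m‖))
    (U : Ω → EuclideanSpace ℝ (Fin (n+1))) (hUmeas : Measurable U)
    (hU : Measure.map U P = Measure.map A (volume.restrict (cube (n+1))))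
    (hindep : IndepFun U (fun ω => fun m => p m ω) P)
    (N : ℝ → Ω → ℝ)
    (hN : ∀ r ω, N r ω = ∑' m,
      (Metric.closedBall (0 : EuclideanSpace ℝ (Fin (n+1))) r).indicator (fun _ => (1:ℝ))
        (Lpt m + p m ω + U ω)) :
    ∃ C : ℝ, 0 ≤ C ∧ ∀ r, 1 ≤ r → M < r → Var[N r; P] ≤ C * r^n := by
  obtain ⟨C1, hC1, hann⟩ := ann_vol n A M hM
  obtain ⟨C2, hC2, hlat⟩ := lat_var n A
  set K := ∑' m, mixCoef P Lpt p ‖Lpt m‖ with hK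
  have hK0 : 0 ≤ K := tsum_nonneg fun m => mixCoef_nonneg _ _ _ _
  refine ⟨K * C1 + C2, by positivity, fun r hr hMr => ?_⟩
  obtain ⟨S, hS⟩ := exists_supp A (r + M) 1
  have hprobc : IsProbabilityMeasure (volume.restrict (cube (n+1))) := ⟨by
    rw [Measure.restrict_apply_univ, cube_vol]⟩
  set c := volume.real (A ⁻¹' (Metric.closedBall (0 : EuclideanSpace ℝ (Fin (n+1))) r)) with hc
  set I := (Metric.closedBall (0 : EuclideanSpace ℝ (Fin (n+1))) r).indicator (fun _ => (1:ℝ)) with hI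
  set ann := (Metric.closedBall (0 : EuclideanSpace ℝ (Fin (n+1))) (r + M) \
        Metric.ball 0 (r - M)) with hanndef
  have hImeas : Measurable I := ind_meas r
  have hI0 : ∀ x, 0 ≤ I x := ind_nonneg r
  have hI1 : ∀ x, I x ≤ 1 := ind_le_one r
  have hpp : Measurable (fun ω => fun m => p m ω) := measurable_pi_lambda _ hpm
  -- almost sure finite representation
  have hUc : ∀ᵐ ω ∂P, U ω ∈ A '' (cube (n+1)) := by
    have hms : MeasurableSet (A '' (cube (n+1))) := by
      rw [A.image_eq_preimage_symm]
      exact A.symm.continuous.measurable (cube_meas _)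
    have : ∀ᵐ x ∂(Measure.map U P), x ∈ A '' (cube (n+1)) := by
      rw [hU]
      refine (ae_map_iff (p := fun x => x ∈ A '' (cube (n+1)))
        A.continuous.measurable.aemeasurable hms).2 ?_
      filter_upwards [ae_restrict_mem (cube_meas (n+1))] with t ht
      exact ⟨t, ht, rfl⟩
    exact ae_of_ae_map hUmeas.aemeasurable this
  have hNae : N r =ᵐ[P] fun ω => ∑ m ∈ S, I (Lpt m + p m ω + U ω) := by
    filter_upwards [hUc, ae_all_iff.2 hbd] with ω hω hb
    obtain ⟨t, ht, htU⟩ := hω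
    rw [hN, tsum_eq_sum]
    intro m hm
    rw [Set.indicator_of_notMem]
    rw [mem_closedBall_zero_iff, not_le]
    have h1 := hS m hm t (cube_norm t ht)
    have h2 := norm_sub_le (Lpt m + p m ω + U ω) (p m ω)
    have h3 : Lpt m + p m ω + U ω - p m ω = A (t + zc m) := by
      rw [← htU, hA, map_add]; abel
    rw [h3] at h2
    have := hb m
    linarith
  -- the squared deviation as a function on the product space
  set h : EuclideanSpace ℝ (Fin (n+1)) × ((Fin (n+1) → ℤ) → EuclideanSpace ℝ (Fin (n+1))) → ℝ :=
    fun z => (∑ m ∈ S, I (Lpt m + z.2 m + z.1) - c)^2 with hh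
  have hhm : Measurable h := by
    refine (Measurable.sub_const (Finset.measurable_sum _ fun m _ => hImeas.comp ?_) _).pow_const 2
    exact (measurable_const.add ((measurable_pi_apply m).comp measurable_snd)).add measurable_fst
  have hhb : ∀ z, ‖h z‖ ≤ (S.card + |c|)^2 := by
    intro z
    simp only [hh]
    rw [norm_pow, Real.norm_eq_abs]
    gcongr
    refine (abs_sub _ _).trans ?_
    gcongr
    rw [abs_of_nonneg (Finset.sum_nonneg fun m _ => hI0 _)]
    refine (Finset.sum_le_sum fun m _ => hI1 _).trans ?_
    simp
  have hstep1 : Var[N r; P] ≤ ∫ ω, h (U ω, fun m => p m ω) ∂P := by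
    rw [variance_congr hNae]
    have hXm : Measurable (fun ω => ∑ m ∈ S, I (Lpt m + p m ω + U ω)) :=
      Finset.measurable_sum _ fun m _ => hImeas.comp ((measurable_const.add (hpm m)).add hUmeas)
    rw [← variance_sub_const hXm.aestronglyMeasurable c]
    exact variance_le_expectation_sq (hXm.sub_const c).aestronglyMeasurable
  have hprobp : IsProbabilityMeasure (Measure.map (fun ω => fun m => p m ω) P) :=
    Measure.isProbabilityMeasure_map hpp.aemeasurable
  have hprobU : IsProbabilityMeasure (Measure.map U P) :=
    Measure.isProbabilityMeasure_map hUmeas.aemeasurable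
  have hIntg : Integrable h ((Measure.map U P).prod (Measure.map (fun ω => fun m => p m ω) P)) :=
    Integrable.of_bound hhm.aestronglyMeasurable _ (ae_of_all _ hhb)
  have hstep2 : ∫ ω, h (U ω, fun m => p m ω) ∂P =
      ∫ t in cube (n+1), ∫ ω, h (A t, fun m => p m ω) ∂P := by
    have e1 := (indepFun_iff_map_prod_eq_prod_map_map hUmeas.aemeasurable hpp.aemeasurable).1 hindep
    rw [← integral_map (f := h) (hUmeas.prodMk hpp).aemeasurable hhm.aestronglyMeasurable, e1,
      integral_prod _ hIntg, hU, integral_map A.continuous.measurable.aemeasurable]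
    · refine integral_congr_ae (ae_of_all _ fun t => ?_)
      simp only
      rw [integral_map hpp.aemeasurable]
      exact (hhm.comp measurable_prodMk_left).aestronglyMeasurable
    · rw [← hU]
      exact hIntg.integral_prod_left.aestronglyMeasurable
  -- the shifted lattice term
  set g : (Fin (n+1) → ℝ) × Ω → ℝ := fun z => (cnt A r (z.1 + A.symm (p 0 z.2)) - c)^2 with hg
  obtain ⟨Kc, hKc⟩ := cnt_bdd A r
  have hgm : Measurable g := by
    refine (Measurable.sub_const ((cnt_meas A r).comp ?_) _).pow_const 2
    exact measurable_fst.add (A.symm.continuous.measurable.comp ((hpm 0).comp measurable_snd))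
  have hgint : Integrable g ((volume.restrict (cube (n+1))).prod P) := by
    refine Integrable.of_bound hgm.aestronglyMeasurable ((Kc + |c|)^2) (ae_of_all _ fun z => ?_)
    simp only [hg]
    rw [norm_pow, Real.norm_eq_abs]
    gcongr
    refine (abs_sub _ _).trans ?_
    gcongr
    exact hKc _
  have hannm : MeasurableSet ann := measurableSet_closedBall.diff measurableSet_ball
  have hannf : Integrable (fun x => ann.indicator (fun _ => (1:ℝ)) (A x)) := by
    have : (fun x => ann.indicator (fun _ => (1:ℝ)) (A x)) = (A ⁻¹' ann).indicator (fun _ => (1:ℝ)) := rfl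
    rw [this, integrable_indicator_iff (A.continuous.measurable hannm)]
    refine integrableOn_const ?_
    refine ((measure_mono ?_).trans_lt (preim_compact A (r+M)).measure_lt_top).ne
    exact Set.preimage_mono Set.sdiff_subset
  have hannint : ∀ m, Integrable (fun t => ann.indicator (fun _ => (1:ℝ)) (A (t + zc m)))
      (volume.restrict (cube (n+1))) := fun m => (hannf.comp_add_right (zc m)).integrableOn
  have hIntL : Integrable (fun t => ∫ ω, h (A t, fun m => p m ω) ∂P) (volume.restrict (cube (n+1))) := by
    have : Integrable (fun z : (Fin (n+1) → ℝ) × Ω => h (A z.1, fun m => p m z.2))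
        ((volume.restrict (cube (n+1))).prod P) := by
      refine Integrable.of_bound (hhm.comp ?_).aestronglyMeasurable ((S.card + |c|)^2)
        (ae_of_all _ fun z => hhb _)
      exact (A.continuous.measurable.comp measurable_fst).prodMk (hpp.comp measurable_snd)
    exact this.integral_prod_left
  have hsumint : Integrable (fun t => K * ∑ m ∈ S, ann.indicator (fun _ => (1:ℝ)) (A (t + zc m)))
      (volume.restrict (cube (n+1))) := (integrable_finsetSum S fun m _ => hannint m).const_mul K
  have hJ : Integrable (fun t => ∫ ω, g (t, ω) ∂P) (volume.restrict (cube (n+1))) :=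
    hgint.integral_prod_left
  have hstep3 : ∫ t in cube (n+1), ∫ ω, h (A t, fun m => p m ω) ∂P ≤
      ∫ t in cube (n+1), (K * ∑ m ∈ S, ann.indicator (fun _ => (1:ℝ)) (A (t + zc m)) +
        ∫ ω, g (t, ω) ∂P) := by
    refine setIntegral_mono_on hIntL (hsumint.add hJ) (cube_meas _) fun t ht => ?_
    have := cond_bound P A Lpt p hA hpm hmap M hbd hsum r S hS t (cube_norm t ht) c
    refine le_trans (le_of_eq ?_) this
    refine integral_congr_ae (ae_of_all _ fun ω => ?_)
    simp only [hh]
    have e : ∀ m, Lpt m + p m ω + A t = A (t + zc m) + p m ω := by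
      intro m
      rw [hA, map_add]; abel
    simp only [e]
    rfl
  rw [integral_add hsumint hJ, integral_const_mul,
    integral_finsetSum _ (fun m _ => hannint m),
    unfold_cube (fun x => ann.indicator (fun _ => (1:ℝ)) (A x)) hannf S] at hstep3
  · have hA1 : ∫ x, ann.indicator (fun _ => (1:ℝ)) (A x) = volume.real (A ⁻¹' ann) := by
      rw [← integral_indicator_one (A.continuous.measurable hannm)]
      rfl
    have hJ2 : ∫ t in cube (n+1), ∫ ω, g (t, ω) ∂P ≤ C2 * r^n := by
      rw [integral_integral_swap hgint]
      have : ∀ ω, ∫ t in cube (n+1), g (t, ω) ≤ C2 * r^n := fun ω => hlat r (by linarith) (A.symm (p 0 ω))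
      calc _ ≤ ∫ ω, C2 * r^n ∂P := integral_mono hgint.integral_prod_right (integrable_const _) this
        _ = _ := by simp
    have hA2 := hann r hr hMr
    rw [hA1] at hstep3
    rw [hstep2] at hstep1
    have := mul_le_mul_of_nonneg_left hA2 hK0
    nlinarith
  · intro m hm t ht
    have := hS m hm t (cube_norm t ht)
    rw [Set.indicator_of_notMem]
    intro hmem
    have h2 := hmem.1
    rw [mem_closedBall_zero_iff] at h2
    linarith

end main

theorem statement2
    {Ω : Type*} [MeasurableSpace Ω] (P : Measure Ω) [IsProbabilityMeasure P]
    (d : ℕ) (hd : 1 ≤ d)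
    -- the lattice 𝓛, generated by a basis `a` of ℝ^d
    (a : Fin d → EuclideanSpace ℝ (Fin d))
    (ha : LinearIndependent ℝ a)
    (Lpt : (Fin d → ℤ) → EuclideanSpace ℝ (Fin d))
    (hLpt : ∀ m, Lpt m = ∑ i, (m i : ℝ) • a i)
    -- the fundamental domain 𝒟
    (D : Set (EuclideanSpace ℝ (Fin d)))
    (hD : D = {x | ∃ t : Fin d → ℝ, (∀ i, t i ∈ Set.Ico (0:ℝ) 1) ∧ x = ∑ i, t i • a i})
    -- the random field of perturbations
    (p : (Fin d → ℤ) → Ω → EuclideanSpace ℝ (Fin d))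
    (hpm : ∀ m, Measurable (p m))
    -- strict stationarity of the field
    (hstat : ∀ (j : Fin d → ℤ) (Λ : Finset (Fin d → ℤ)),
      Measure.map (fun ω => fun m : Λ => p (↑m + j) ω) P =
      Measure.map (fun ω => fun m : Λ => p ↑m ω) P)
    -- U uniform on 𝒟, independent of the field
    (U : Ω → EuclideanSpace ℝ (Fin d))
    (hUmeas : Measurable U)
    (hU : Measure.map U P = (volume D)⁻¹ • volume.restrict D)
    (hindep : IndepFun U (fun ω => fun m : Fin d → ℤ => p m ω) P)
    -- almost surely bounded perturbations
    (hbdd : ∃ M : ℝ, ∀ᵐ ω ∂P, ‖p 0 ω‖ ≤ M)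
    -- ∑_{i ∈ 𝓛} α(|i|) < ∞
    (hsum : Summable (fun m : Fin d → ℤ => mixCoef P Lpt p ‖Lpt m‖))
    -- the number of points of the perturbed lattice Ξ in the closed ball B_r
    (N : ℝ → Ω → ℝ)
    (hN : ∀ r ω, N r ω = ∑' m : Fin d → ℤ,
      (Metric.closedBall (0 : EuclideanSpace ℝ (Fin d)) r).indicator (fun _ => (1:ℝ))
        (Lpt m + p m ω + U ω)) :
    -- Ξ is class I hyperuniform
    (fun r : ℝ =>
      variance (N r) P /
        (volume (Metric.closedBall (0 : EuclideanSpace ℝ (Fin d)) r)).toReal)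
      =O[atTop] (fun r : ℝ => r⁻¹) := by
  obtain ⟨n, rfl⟩ : ∃ n, d = n + 1 := ⟨d - 1, by omega⟩
  -- the linear map sending the standard basis to `a`
  let b := basisOfLinearIndependentOfCardEqFinrank ha (by simp)
  let A : (Fin (n+1) → ℝ) ≃L[ℝ] EuclideanSpace ℝ (Fin (n+1)) := b.equivFun.symm.toContinuousLinearEquiv
  have hAt : ∀ t, A t = ∑ i, t i • a i := by
    intro t
    have : A t = b.equivFun.symm t := rfl
    rw [this, Module.Basis.equivFun_symm_apply]
    simp [b]
  have hA : ∀ m, Lpt m = A (zc m) := by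
    intro m
    rw [hAt, hLpt]
    rfl
  have hD' : D = A '' {t | ∀ i, t i ∈ Set.Ico (0:ℝ) 1} := by
    rw [hD]
    ext x
    constructor
    · rintro ⟨t, ht, rfl⟩
      exact ⟨t, ht, hAt t⟩
    · rintro ⟨t, ht, rfl⟩
      exact ⟨t, ht, hAt t⟩
  have hprobU : IsProbabilityMeasure (Measure.map U P) :=
    Measure.isProbabilityMeasure_map hUmeas.aemeasurable
  have hlaw := law_U A (Measure.map U P) (by rw [hU, hD'])
  have hmap : ∀ m, Measure.map (p m) P = Measure.map (p 0) P := by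
    intro m
    have h := hstat m {0}
    have h2 := congrArg (Measure.map (fun f : (({0} : Finset (Fin (n+1) → ℤ)) → EuclideanSpace ℝ (Fin (n+1))) =>
      f ⟨0, Finset.mem_singleton_self 0⟩)) h
    rw [Measure.map_map (measurable_pi_apply _) (measurable_pi_lambda _ fun k => hpm _),
      Measure.map_map (measurable_pi_apply _) (measurable_pi_lambda _ fun k => hpm _)] at h2
    have e : p m = fun ω => p (0 + m) ω := by rw [zero_add]
    rw [e]
    exact h2
  obtain ⟨M0, hM0⟩ := hbdd
  have hbd : ∀ m, ∀ᵐ ω ∂P, ‖p m ω‖ ≤ max M0 0 := by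
    intro m
    have hms : MeasurableSet {x : EuclideanSpace ℝ (Fin (n+1)) | ‖x‖ ≤ max M0 0} :=
      measurableSet_le measurable_norm measurable_const
    have h0 : ∀ᵐ x ∂(Measure.map (p 0) P), ‖x‖ ≤ max M0 0 := by
      refine (ae_map_iff (hpm 0).aemeasurable hms).2 ?_
      filter_upwards [hM0] with ω hω
      exact hω.trans (le_max_left _ _)
    rw [← hmap m] at h0
    exact ae_of_ae_map (hpm m).aemeasurable h0
  obtain ⟨C, hC, hvar⟩ := main_bound P A Lpt p hA hpm hmap (max M0 0) (le_max_right _ _) hbd hsum U hUmeas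
    hlaw hindep N hN
  set v := volume.real (Metric.ball (0 : EuclideanSpace ℝ (Fin (n+1))) 1) with hv
  have hv0 : 0 < v := ENNReal.toReal_pos (Metric.measure_ball_pos _ _ one_pos).ne' measure_ball_lt_top.ne
  refine IsBigO.of_bound (C / v) ?_
  filter_upwards [eventually_ge_atTop 1, eventually_gt_atTop (max M0 0)] with r hr hMr
  have hr0 : 0 < r := by linarith
  have e2 : (volume (Metric.closedBall (0 : EuclideanSpace ℝ (Fin (n+1))) r)).toReal = r^(n+1) * v := by
    have := Measure.addHaar_real_closedBall (volume : Measure (EuclideanSpace ℝ (Fin (n+1)))) 0 hr0.le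
    rw [measureReal_def] at this
    rw [this]
    simp [hv]
  rw [e2, Real.norm_eq_abs, Real.norm_eq_abs, abs_of_nonneg (div_nonneg (variance_nonneg _ _) (by positivity)),
    abs_of_pos (inv_pos.2 hr0), div_le_iff₀ (by positivity)]
  refine (hvar r hr hMr).trans (le_of_eq ?_)
  field_simp
  ring
end
end

section
/- For some m ∈ ℕ, let p = {p_i, i ∈ 𝓛} be a strictly stationary m-dependent random field (p_i and p_j are independent whenever |i − j| > m) such that E|p_0|^d < ∞. Then the perturbed lattice Ξ = {i + p_i + U : i ∈ 𝓛} is hyperuniform, i.e. Var(#(Ξ ∩ B_r))/λ^d(B_r) → 0 as r → ∞. -/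
open MeasureTheory ProbabilityTheory Filter

noncomputable section

lemma hu_sqrt_cont (n : ℕ) : Continuous fun s : ℝ => Real.sqrt (1 - s^2) ^ n := by fun_prop

lemma hu_deriv_cos (w : ℝ → ℝ) (hw : Continuous w) (t : ℝ) :
    HasDerivAt (fun t => ∫ s in (-1:ℝ)..1, w s * Real.cos (t * s))
      (∫ s in (-1:ℝ)..1, w s * (-Real.sin (t * s) * s)) t := by
  have hc : Continuous fun s => |w s * s| := by fun_prop
  refine (intervalIntegral.hasDerivAt_integral_of_dominated_loc_of_deriv_le
    (μ := volume) (F := fun t s => w s * Real.cos (t * s))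
    (F' := fun t s => w s * (-Real.sin (t * s) * s)) (bound := fun s => |w s * s|)
    (s := Set.univ) Filter.univ_mem ?_ ?_ ?_ ?_ ?_ ?_).2
  · exact Eventually.of_forall fun x => (by fun_prop : Continuous _).aestronglyMeasurable
  · exact (by fun_prop : Continuous fun s => w s * Real.cos (t * s)).intervalIntegrable _ _
  · exact (by fun_prop : Continuous fun s => w s * (-Real.sin (t * s) * s)).aestronglyMeasurable
  · refine Eventually.of_forall fun s _ x _ => ?_
    rw [Real.norm_eq_abs, show w s * (-Real.sin (x * s) * s) = (w s * s) * (-Real.sin (x*s)) by ring,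
      abs_mul, abs_neg]
    exact mul_le_of_le_one_right (abs_nonneg _) (Real.abs_sin_le_one _)
  · exact hc.intervalIntegrable _ _
  · refine Eventually.of_forall fun s _ x _ => ?_
    have := ((hasDerivAt_id x).mul_const s).cos.const_mul (w s)
    simpa using this

lemma hu_deriv_sin (w : ℝ → ℝ) (hw : Continuous w) (t : ℝ) :
    HasDerivAt (fun t => ∫ s in (-1:ℝ)..1, w s * Real.sin (t * s))
      (∫ s in (-1:ℝ)..1, w s * (Real.cos (t * s) * s)) t := by
  have hc : Continuous fun s => |w s * s| := by fun_prop
  refine (intervalIntegral.hasDerivAt_integral_of_dominated_loc_of_deriv_le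
    (μ := volume) (F := fun t s => w s * Real.sin (t * s))
    (F' := fun t s => w s * (Real.cos (t * s) * s)) (bound := fun s => |w s * s|)
    (s := Set.univ) Filter.univ_mem ?_ ?_ ?_ ?_ ?_ ?_).2
  · exact Eventually.of_forall fun x => (by fun_prop : Continuous _).aestronglyMeasurable
  · exact (by fun_prop : Continuous fun s => w s * Real.sin (t * s)).intervalIntegrable _ _
  · exact (by fun_prop : Continuous fun s => w s * (Real.cos (t * s) * s)).aestronglyMeasurable
  · refine Eventually.of_forall fun s _ x _ => ?_
    rw [Real.norm_eq_abs, show w s * (Real.cos (x * s) * s) = (w s * s) * (Real.cos (x*s)) by ring,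
      abs_mul]
    exact mul_le_of_le_one_right (abs_nonneg _) (Real.abs_cos_le_one _)
  · exact hc.intervalIntegrable _ _
  · refine Eventually.of_forall fun s _ x _ => ?_
    have := ((hasDerivAt_id x).mul_const s).sin.const_mul (w s)
    simpa using this

/-- the Bessel type integral -/
def huI (n : ℕ) (t : ℝ) : ℝ := ∫ s in (-1:ℝ)..1, Real.sqrt (1 - s^2) ^ n * Real.cos (t * s)
def huI1 (n : ℕ) (t : ℝ) : ℝ := ∫ s in (-1:ℝ)..1, (-(Real.sqrt (1 - s^2) ^ n * s)) * Real.sin (t * s)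
def huI2 (n : ℕ) (t : ℝ) : ℝ :=
  ∫ s in (-1:ℝ)..1, (-(Real.sqrt (1 - s^2) ^ n * s)) * (Real.cos (t * s) * s)

lemma huI_deriv (n : ℕ) (t : ℝ) : HasDerivAt (huI n) (huI1 n t) t := by
  have := hu_deriv_cos _ (hu_sqrt_cont n) t
  unfold huI huI1
  convert this using 1
  congr 1; ext s; ring

lemma huI1_deriv (n : ℕ) (t : ℝ) : HasDerivAt (huI1 n) (huI2 n t) t :=
  hu_deriv_sin (fun s => (-(Real.sqrt (1 - s^2) ^ n * s))) (by fun_prop) t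

lemma huI_ode (n : ℕ) (t : ℝ) : t * (huI n t + huI2 n t) + (n + 2) * huI1 n t = 0 := by
  have hc := hu_sqrt_cont n
  have key : ∫ s in (-1:ℝ)..1, (t * (Real.sqrt (1 - s^2) ^ n * Real.cos (t * s)
      + (-(Real.sqrt (1 - s^2) ^ n * s)) * (Real.cos (t * s) * s))
      + (n+2) * ((-(Real.sqrt (1 - s^2) ^ n * s)) * Real.sin (t * s))) =
      Real.sin (t * 1) * Real.sqrt (1 - 1^2)^(n+2)
        - Real.sin (t * (-1)) * Real.sqrt (1 - (-1)^2)^(n+2) := by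
    refine intervalIntegral.integral_eq_sub_of_hasDerivAt_of_le
      (f := fun s => Real.sin (t * s) * Real.sqrt (1 - s^2)^(n+2)) (by norm_num) ?_ ?_ ?_
    · fun_prop
    · intro s hs
      have hp : 0 < 1 - s^2 := by nlinarith [hs.1, hs.2]
      have h1 : HasDerivAt (fun s : ℝ => 1 - s^2) (-(2*s)) s := by
        simpa using (hasDerivAt_pow 2 s).const_sub 1
      have h2 := (h1.sqrt hp.ne').pow (n+2)
      have h3 : HasDerivAt (fun s : ℝ => Real.sin (t * s)) (Real.cos (t*s) * t) s := by
        simpa using ((hasDerivAt_id s).const_mul t).sin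
      have h4 := h3.mul h2
      refine h4.congr_deriv ?_
      have hq : Real.sqrt (1 - s^2) ^ 2 = 1 - s^2 := Real.sq_sqrt hp.le
      have hq0 : Real.sqrt (1 - s^2) ≠ 0 := (Real.sqrt_pos.2 hp).ne'
      simp only [Pi.pow_apply]
      push_cast
      set q := Real.sqrt (1 - s^2)
      have e1 : q ^ (n+1) = q^n * q := pow_succ _ _
      have e2 : q^(n+2) = q^n * (1 - s^2) := by rw [pow_add, hq]
      rw [e1, e2]
      field_simp
      ring
    · exact (by fun_prop : Continuous _).intervalIntegrable _ _
  rw [intervalIntegral.integral_add, intervalIntegral.integral_const_mul,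
    intervalIntegral.integral_const_mul, intervalIntegral.integral_add] at key
  · unfold huI huI1 huI2
    rw [key]; simp
  all_goals exact (by fun_prop : Continuous _).intervalIntegrable _ _

lemma huI_bound (n : ℕ) : ∃ C : ℝ, 0 ≤ C ∧ ∀ t : ℝ, 1 ≤ t → t^(n+2) * huI n t ^ 2 ≤ C := by
  set β : ℝ := (n+2)/2 with hβ
  set c : ℝ := β * (β - 1) with hc
  have hc0 : 0 ≤ c := by
    have : (0:ℝ) ≤ n := Nat.cast_nonneg n
    apply mul_nonneg <;> rw [hβ] <;> linarith
  let z : ℝ → ℝ := fun t => huI1 n t + β * huI n t / t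
  let F : ℝ → ℝ := fun t => (t^(n+2) * (huI n t ^2 + z t ^2)) * Real.exp (c / t)
  have hF : ∀ t : ℝ, 0 < t → HasDerivAt F
      (Real.exp (c/t) * t^n * (2 * c * huI n t * z t - c * (huI n t ^2 + z t ^2))) t := by
    intro t ht
    have hz : HasDerivAt z (huI2 n t + (β * huI1 n t * t - β * huI n t * 1) / t^2) t :=
      (huI1_deriv n t).add (((huI_deriv n t).const_mul β).div (hasDerivAt_id t) ht.ne')
    have hexp : HasDerivAt (fun t => Real.exp (c / t)) (Real.exp (c/t) * ((0 * t - c * 1)/t^2)) t :=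
      ((hasDerivAt_const t c).div (hasDerivAt_id t) ht.ne').exp
    have h := (((hasDerivAt_pow (n+2) t).mul (((huI_deriv n t).pow 2).add (hz.pow 2))).mul hexp)
    refine h.congr_deriv ?_
    have ode := huI_ode n t
    have e2 : huI2 n t = - huI n t - 2 * β / t * huI1 n t := by
      field_simp
      rw [hβ]; linear_combination ode
    simp only [Pi.pow_apply, Pi.add_apply, Pi.mul_apply]
    have hI1 : huI1 n t = z t - β * huI n t / t := by simp [z]
    rw [e2]
    set Z := z t
    rw [hI1]
    set y := huI n t
    have hn : (n:ℝ) = 2 * β - 2 := by rw [hβ]; ring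
    push_cast
    generalize Real.exp (c / t) = X
    rw [hn, hc, pow_succ, pow_add]
    field_simp
    ring
  have hanti : AntitoneOn F (Set.Ici 1) := by
    apply antitoneOn_of_deriv_nonpos (convex_Ici 1)
    · intro t ht
      exact (hF t (by have : (1:ℝ) ≤ t := ht
                      linarith)).continuousAt.continuousWithinAt
    · intro t ht
      rw [interior_Ici] at ht
      have : (1:ℝ) < t := ht
      exact (hF t (by linarith)).differentiableAt.differentiableWithinAt
    · intro t ht
      rw [interior_Ici] at ht
      have h1 : (1:ℝ) < t := ht
      have h0 : 0 < t := by linarith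
      rw [(hF t h0).deriv]
      apply mul_nonpos_of_nonneg_of_nonpos (by positivity)
      have := mul_nonneg hc0 (sq_nonneg (huI n t - z t))
      linarith
  have hle : ∀ t : ℝ, 1 ≤ t → t^(n+2) * huI n t ^ 2 ≤ F t := by
    intro t ht
    have h0 : 0 < t := by linarith
    have h1 : 1 ≤ Real.exp (c / t) := Real.one_le_exp (by positivity)
    calc t^(n+2) * huI n t ^ 2 ≤ t^(n+2) * (huI n t ^ 2 + z t ^2) := by
          gcongr; linarith [sq_nonneg (z t)]
      _ ≤ F t := le_mul_of_one_le_right (by positivity) h1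
  refine ⟨F 1, by positivity, fun t ht => (hle t ht).trans (hanti (by simp) ht ht)⟩
def huEquiv (n : ℕ) : EuclideanSpace ℝ (Fin (n+1)) ≃ᵐ ℝ × EuclideanSpace ℝ (Fin n) :=
  ((MeasurableEquiv.toLp 2 (Fin (n+1) → ℝ)).symm.trans
    (MeasurableEquiv.piFinSuccAbove (fun _ => ℝ) 0)).trans
    (MeasurableEquiv.prodCongr (MeasurableEquiv.refl ℝ) (MeasurableEquiv.toLp 2 (Fin n → ℝ)))

lemma huEquiv_mp (n : ℕ) : MeasurePreserving (huEquiv n) volume volume := by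
  refine MeasurePreserving.trans (MeasurePreserving.trans
    (EuclideanSpace.volume_preserving_symm_measurableEquiv_toLp _)
    (volume_preserving_piFinSuccAbove (fun _ => ℝ) 0)) ?_
  exact (MeasurePreserving.id volume).prod (PiLp.volume_preserving_toLp (Fin n))

lemma huEquiv_fst (n : ℕ) (y : EuclideanSpace ℝ (Fin (n+1))) : (huEquiv n y).1 = y 0 := rfl

lemma huEquiv_norm (n : ℕ) (y : EuclideanSpace ℝ (Fin (n+1))) :
    ‖y‖^2 = (huEquiv n y).1^2 + ‖(huEquiv n y).2‖^2 := by
  rw [EuclideanSpace.norm_sq_eq, EuclideanSpace.norm_sq_eq, Fin.sum_univ_succ]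
  simp [huEquiv, MeasurableEquiv.piFinSuccAbove, Fin.insertNthEquiv]
  rfl

lemma hu_slice (n : ℕ) (φ : ℝ → ℂ) (hφ : Continuous φ) (hb : ∀ s, ‖φ s‖ ≤ 1) :
    ∫ y in Metric.closedBall (0 : EuclideanSpace ℝ (Fin (n+1))) 1, φ (y 0) =
      (volume (Metric.ball (0 : EuclideanSpace ℝ (Fin n)) 1)).toReal *
        ∫ s in (-1:ℝ)..1, ((Real.sqrt (1 - s^2) ^ n : ℝ) : ℂ) * φ s := by
  set S : Set (ℝ × EuclideanSpace ℝ (Fin n)) := {x | x.1^2 + ‖x.2‖^2 ≤ 1} with hS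
  have hSm : MeasurableSet S := by
    apply measurableSet_le <;> fun_prop
  have hpre : Metric.closedBall (0 : EuclideanSpace ℝ (Fin (n+1))) 1 = huEquiv n ⁻¹' S := by
    ext y
    simp only [mem_closedBall_zero_iff, Set.mem_preimage, hS, Set.mem_ofPred_eq]
    rw [← huEquiv_norm]
    rw [sq_le_one_iff₀ (norm_nonneg _)]
  have hvol : volume S < ⊤ := by
    rw [← (huEquiv_mp n).measure_preimage hSm.nullMeasurableSet, ← hpre]
    exact measure_closedBall_lt_top
  rw [hpre]
  have := (huEquiv_mp n).setIntegral_preimage_emb (huEquiv n).measurableEmbedding (fun x => φ x.1) S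
  simp only [huEquiv_fst] at this
  rw [this]
  have hint : Integrable (S.indicator fun x : ℝ × EuclideanSpace ℝ (Fin n) => φ x.1)
      ((volume : Measure ℝ).prod (volume : Measure (EuclideanSpace ℝ (Fin n)))) := by
    rw [integrable_indicator_iff hSm]
    refine Measure.integrableOn_of_bounded (M := 1) hvol.ne ?_ ?_
    · exact (hφ.comp continuous_fst).aestronglyMeasurable
    · exact Eventually.of_forall fun x => hb _
  rw [← integral_indicator hSm, Measure.volume_eq_prod, integral_prod _ hint,
    intervalIntegral.integral_of_le (by norm_num), ← integral_Icc_eq_integral_Ioc,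
    ← integral_indicator measurableSet_Icc, ← integral_const_mul]
  congr 1
  ext s
  by_cases hs : s ∈ Set.Icc (-1:ℝ) 1
  · have hp : 0 ≤ 1 - s^2 := by nlinarith [hs.1, hs.2]
    rw [Set.indicator_of_mem hs]
    have : (fun y : EuclideanSpace ℝ (Fin n) => S.indicator (fun x => φ x.1) (s, y)) =
        (Metric.closedBall (0 : EuclideanSpace ℝ (Fin n)) (Real.sqrt (1-s^2))).indicator
          (fun _ => φ s) := by
      ext y
      simp only [Set.indicator, hS, Set.mem_ofPred_eq, mem_closedBall_zero_iff]
      congr 1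
      rw [Real.le_sqrt (norm_nonneg _) hp]
      apply propext; constructor <;> intro h <;> linarith
    rw [this, integral_indicator Metric.isClosed_closedBall.measurableSet, setIntegral_const,
      Measure.real, Measure.addHaar_closedBall _ _ (Real.sqrt_nonneg _), finrank_euclideanSpace_fin,
      ENNReal.toReal_mul, ENNReal.toReal_ofReal (by positivity)]
    rw [Complex.real_smul]; push_cast; ring
  · rw [Set.indicator_of_notMem hs, mul_zero]
    have : (fun y : EuclideanSpace ℝ (Fin n) => S.indicator (fun x => φ x.1) (s, y)) = 0 := by
      ext y
      apply Set.indicator_of_notMem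
      intro h
      apply hs
      simp only [hS, Set.mem_ofPred_eq] at h
      have : s^2 ≤ 1 := by nlinarith [sq_nonneg ‖y‖]
      exact abs_le.1 ((sq_le_one_iff_abs_le_one s).1 this)
    rw [this]; simp

lemma hu_exp_int (n : ℕ) (t : ℝ) :
    ∫ s in (-1:ℝ)..1, ((Real.sqrt (1 - s^2) ^ n : ℝ) : ℂ) * Complex.exp (Complex.I * ((t * s : ℝ) : ℂ)) =
      (huI n t : ℂ) := by
  have hc := hu_sqrt_cont n
  have h0 : ∫ s in (-1:ℝ)..1, Real.sqrt (1 - s^2) ^ n * Real.sin (t * s) = 0 := by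
    have := intervalIntegral.integral_comp_neg (a := (-1:ℝ)) (b := 1)
      (fun s => Real.sqrt (1 - s^2) ^ n * Real.sin (t * s))
    simp only [neg_sq, mul_neg, Real.sin_neg, neg_neg, intervalIntegral.integral_neg] at this
    linarith
  have e : ∀ s : ℝ, ((Real.sqrt (1 - s^2) ^ n : ℝ) : ℂ) * Complex.exp (Complex.I * ((t * s : ℝ) : ℂ))
    = ((Real.sqrt (1 - s^2) ^ n * Real.cos (t * s) : ℝ) : ℂ)
      + ((Real.sqrt (1 - s^2) ^ n * Real.sin (t * s) : ℝ) : ℂ) * Complex.I := by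
    intro s
    rw [mul_comm Complex.I, Complex.exp_mul_I]
    push_cast; ring
  simp_rw [e]
  rw [intervalIntegral.integral_add, intervalIntegral.integral_mul_const,
    intervalIntegral.integral_ofReal, intervalIntegral.integral_ofReal, h0]
  · simp [huI]
  all_goals exact (by fun_prop : Continuous _).intervalIntegrable _ _

/-- Fourier transform of the unit ball. -/
def huH (d : ℕ) (η : EuclideanSpace ℝ (Fin d)) : ℂ :=
  ∫ y in Metric.closedBall (0 : EuclideanSpace ℝ (Fin d)) 1,
    Complex.exp (Complex.I * ((inner ℝ η y : ℝ) : ℂ))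

lemma huH_rot (n : ℕ) (η : EuclideanSpace ℝ (Fin (n+1))) :
    huH (n+1) η = ∫ y in Metric.closedBall (0 : EuclideanSpace ℝ (Fin (n+1))) 1,
    Complex.exp (Complex.I * ((‖η‖ * y 0 : ℝ) : ℂ)) := by
  set w : EuclideanSpace ℝ (Fin (n+1)) := EuclideanSpace.single 0 ‖η‖ with hw
  have hn : ‖w‖ = ‖η‖ := by simp [hw]
  set R := (Submodule.reflection (ℝ ∙ (w - η))ᗮ) with hR
  have hRw : R w = η := Submodule.reflection_sub hn
  have hmp := R.measurePreserving
  have hpre : Metric.closedBall (0 : EuclideanSpace ℝ (Fin (n+1))) 1 =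
    R ⁻¹' Metric.closedBall (0 : EuclideanSpace ℝ (Fin (n+1))) 1 := by
    ext y; simp
  have := hmp.setIntegral_preimage_emb R.toHomeomorph.measurableEmbedding
    (fun y => Complex.exp (Complex.I * ((inner ℝ η y : ℝ) : ℂ)))
    (Metric.closedBall (0 : EuclideanSpace ℝ (Fin (n+1))) 1)
  rw [huH, ← this, ← hpre]
  congr 1
  ext y
  have : inner ℝ η (R y) = ‖η‖ * y 0 := by
    rw [← hRw, LinearIsometryEquiv.inner_map_map, hw, hRw, EuclideanSpace.inner_single_left]
    simp
  rw [this]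

lemma huH_bound (d : ℕ) (hd : 1 ≤ d) : ∃ C : ℝ, 0 ≤ C ∧ ∀ η : EuclideanSpace ℝ (Fin d),
    1 ≤ ‖η‖ → ‖η‖^(d+1) * ‖huH d η‖^2 ≤ C := by
  obtain ⟨n, rfl⟩ : ∃ n, d = n + 1 := ⟨d - 1, by omega⟩
  obtain ⟨C, hC, h⟩ := huI_bound n
  set κ := (volume (Metric.ball (0 : EuclideanSpace ℝ (Fin n)) 1)).toReal with hκ
  refine ⟨κ^2 * C, by positivity, fun η hη => ?_⟩
  rw [huH_rot, hu_slice n (fun s => Complex.exp (Complex.I * ((‖η‖ * s : ℝ) : ℂ))) (by fun_prop)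
    (fun s => by rw [mul_comm, Complex.norm_exp_ofReal_mul_I]), hu_exp_int]
  rw [norm_mul, Complex.norm_real, Complex.norm_real, mul_pow, Real.norm_eq_abs, Real.norm_eq_abs,
    sq_abs, sq_abs]
  have := mul_le_mul_of_nonneg_left (h _ hη) (sq_nonneg κ)
  linarith

/-- the half open unit box -/
def huBox (d : ℕ) : Set (Fin d → ℝ) := Set.univ.pi fun _ => Set.Ico (0:ℝ) 1

/-- integer vector as a real vector -/
def huZ {d : ℕ} (i : Fin d → ℤ) : Fin d → ℝ := fun j => (i j : ℝ)

/-- characters -/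
def huE {d : ℕ} (k : Fin d → ℤ) (x : Fin d → ℝ) : ℂ :=
  Complex.exp (Complex.I * ((-(2 * Real.pi * ∑ j, (k j : ℝ) * x j) : ℝ) : ℂ))

lemma huE_norm {d : ℕ} (k : Fin d → ℤ) (x : Fin d → ℝ) : ‖huE k x‖ = 1 := by
  rw [huE, mul_comm, Complex.norm_exp_ofReal_mul_I]

lemma huE_cont {d : ℕ} (k : Fin d → ℤ) : Continuous (huE k) := by
  unfold huE; fun_prop

lemma huE_add {d : ℕ} (k : Fin d → ℤ) (x y : Fin d → ℝ) : huE k (x + y) = huE k x * huE k y := by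
  rw [huE, huE, huE, ← Complex.exp_add, ← mul_add, ← Complex.ofReal_add]
  congr 3
  simp only [Pi.add_apply, mul_add, Finset.sum_add_distrib]
  ring

lemma huE_int {d : ℕ} (k i : Fin d → ℤ) : huE k (huZ i) = 1 := by
  rw [huE, Complex.exp_eq_one_iff]
  refine ⟨-∑ j, k j * i j, ?_⟩
  simp only [huZ]; push_cast; ring

lemma huE_zero {d : ℕ} (x : Fin d → ℝ) : huE 0 x = 1 := by simp [huE]

lemma huBox_meas (d : ℕ) : MeasurableSet (huBox d) :=
  MeasurableSet.univ_pi fun _ => measurableSet_Ico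

lemma huBox_vol (d : ℕ) : volume (huBox d) = 1 := by
  rw [huBox, volume_pi_pi]; simp

lemma huBox_ae (d : ℕ) : ({x : Fin d → ℝ | ∀ i, x i ∈ Set.Ioc ((fun _ => 0 : Fin d → ℝ) i) ((fun _ => 0 : Fin d → ℝ) i + 1)} : Set (Fin d → ℝ))
    =ᵐ[volume] huBox d := by
  have h1 : ({x : Fin d → ℝ | ∀ i, x i ∈ Set.Ioc ((fun _ => 0 : Fin d → ℝ) i) ((fun _ => 0 : Fin d → ℝ) i + 1)} : Set (Fin d → ℝ)) =
    Set.univ.pi fun _ => Set.Ioc (0:ℝ) 1 := by ext x; simp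
  rw [h1, huBox, volume_pi]
  exact (Measure.univ_pi_Ioc_ae_eq_Icc (f := fun _ => (0:ℝ)) (g := fun _ => (1:ℝ))).trans
    (Measure.univ_pi_Ico_ae_eq_Icc (f := fun _ => (0:ℝ)) (g := fun _ => (1:ℝ))).symm

section torus
local instance : MeasureSpace UnitAddCircle := ⟨AddCircle.haarAddCircle⟩
local instance : Measure.IsAddHaarMeasure (volume : Measure UnitAddCircle) :=
  inferInstanceAs (Measure.IsAddHaarMeasure AddCircle.haarAddCircle)
local instance : IsProbabilityMeasure (volume : Measure UnitAddCircle) :=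
  inferInstanceAs (IsProbabilityMeasure AddCircle.haarAddCircle)

lemma hu_mFourier {d : ℕ} (k : Fin d → ℤ) (x : Fin d → ℝ) :
    UnitAddTorus.mFourier (-k) (fun i => (x i : UnitAddCircle)) = huE k x := by
  simp only [UnitAddTorus.mFourier, ContinuousMap.coe_mk, fourier_coe_apply, huE,
    ← Complex.exp_sum]
  congr 1
  push_cast
  rw [mul_neg, Finset.mul_sum, Finset.mul_sum, ← Finset.sum_neg_distrib]
  refine Finset.sum_congr rfl fun j _ => ?_
  simp; ring

lemma hu_parseval (d : ℕ) (G : (Fin d → ℝ) → ℂ) (hG : Measurable G) (B : ℝ) (hB : ∀ u, ‖G u‖ ≤ B) :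
    HasSum (fun k : Fin d → ℤ => ‖∫ u in huBox d, huE k u * G u‖^2)
      (∫ u in huBox d, ‖G u‖^2) := by
  let Gt : UnitAddTorus (Fin d) → ℂ := fun z =>
    G (UnitAddTorus.measurableEquivPiIoc (fun _ => 0) z).1
  have hGtm : Measurable Gt := hG.comp (measurable_subtype_coe.comp (MeasurableEquiv.measurable _))
  have hmem : MemLp Gt 2 (volume : Measure (UnitAddTorus (Fin d))) :=
    MemLp.of_bound hGtm.aestronglyMeasurable B (Eventually.of_forall fun z => hB _)
  have hGt : ∀ x ∈ {x : Fin d → ℝ | ∀ i, x i ∈ Set.Ioc ((fun _ => 0 : Fin d → ℝ) i) ((fun _ => 0 : Fin d → ℝ) i + 1)},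
      Gt (fun i => (x i : UnitAddCircle)) = G x := by
    intro x hx
    simp only [Gt]
    congr 1
    have := UnitAddTorus.coe_symm_measurableEquivPiIoc_apply (b := fun _ => 0) ⟨x, hx⟩
    change _ = (fun i => (x i : UnitAddCircle)) at this
    have h2 := congrArg (fun z => (UnitAddTorus.measurableEquivPiIoc (fun _ => 0) z).1) this
    simp only [MeasurableEquiv.apply_symm_apply] at h2
    exact h2.symm
  have hmeas : MeasurableSet {x : Fin d → ℝ | ∀ i, x i ∈ Set.Ioc ((fun _ => 0 : Fin d → ℝ) i) ((fun _ => 0 : Fin d → ℝ) i + 1)} :=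
    MeasurableSet.univ_pi' (fun i => measurableSet_Ioc)
  have hP := UnitAddTorus.hasSum_sq_mFourierCoeff (hmem.toLp Gt)
  have e1 : ∫ t, ‖(hmem.toLp Gt) t‖^2 = ∫ u in huBox d, ‖G u‖^2 := by
    rw [integral_congr_ae (g := fun t => ‖Gt t‖^2)
      (by filter_upwards [hmem.coeFn_toLp] with t ht; rw [ht])]
    rw [UnitAddTorus.integral_preimage _ (fun _ => 0), ← setIntegral_congr_set (huBox_ae d)]
    exact setIntegral_congr_fun hmeas fun x hx => by simp only [hGt x hx]
  have e2 : ∀ k, UnitAddTorus.mFourierCoeff (hmem.toLp Gt) k = ∫ u in huBox d, huE k u * G u := by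
    intro k
    rw [UnitAddTorus.mFourierCoeff, integral_congr_ae (g := fun t => UnitAddTorus.mFourier (-k) t • Gt t)
      (by filter_upwards [hmem.coeFn_toLp] with t ht; rw [ht])]
    rw [UnitAddTorus.integral_preimage _ (fun _ => 0), ← setIntegral_congr_set (huBox_ae d)]
    exact setIntegral_congr_fun hmeas fun x hx => by
      simp only [hGt x hx, hu_mFourier, smul_eq_mul]
  rw [e1] at hP
  simpa only [e2] using hP
end torus

lemma hu_cover (d : ℕ) : (⋃ i : Fin d → ℤ, (fun u => huZ i + u) '' huBox d) = Set.univ := by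
  refine Set.eq_univ_of_forall fun x => Set.mem_iUnion.2 ⟨fun j => ⌊x j⌋, fun j => Int.fract (x j), ?_, ?_⟩
  · intro j _
    exact ⟨Int.fract_nonneg _, Int.fract_lt_one _⟩
  · ext j; simp [huZ, Int.floor_add_fract]

lemma hu_disj (d : ℕ) : Pairwise (Function.onFun Disjoint fun i : Fin d → ℤ => (fun u => huZ i + u) '' huBox d) := by
  intro i i' hne
  refine Set.disjoint_left.2 ?_
  rintro _ ⟨u, hu, rfl⟩ ⟨v, hv, h⟩
  apply hne
  ext j
  have h1 := hu j trivial
  have h2 := hv j trivial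
  have h3 := congrFun h j
  simp only [huZ, Pi.add_apply] at h3
  have a1 : ⌊(i j : ℝ) + u j⌋ = i j := by
    rw [Int.floor_intCast_add, Int.floor_eq_zero_iff.2 h1, add_zero]
  have a2 : ⌊(i' j : ℝ) + v j⌋ = i' j := by
    rw [Int.floor_intCast_add, Int.floor_eq_zero_iff.2 h2, add_zero]
  rw [← a1, ← a2, h3]

lemma hu_img_meas (d : ℕ) (i : Fin d → ℤ) : MeasurableSet ((fun u => huZ i + u) '' huBox d) :=
  (measurableEmbedding_addLeft (huZ i)).measurableSet_image.2 (huBox_meas d)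

lemma hu_unfold_l (d : ℕ) (g : (Fin d → ℝ) → ENNReal) :
    ∫⁻ x, g x = ∑' i : Fin d → ℤ, ∫⁻ u in huBox d, g (huZ i + u) := by
  rw [← setLIntegral_univ, ← hu_cover d, lintegral_iUnion (hu_img_meas d) (hu_disj d)]
  congr 1; ext i
  exact ((measurePreserving_add_left volume (huZ i)).setLIntegral_comp_emb
    (measurableEmbedding_addLeft (huZ i)) g (huBox d)).symm

lemma hu_unfold (d : ℕ) (g : (Fin d → ℝ) → ℂ) (hg : Integrable g) :
    HasSum (fun i : Fin d → ℤ => ∫ u in huBox d, g (huZ i + u)) (∫ x, g x) := by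
  have := hasSum_integral_iUnion (hu_img_meas d) (hu_disj d) hg.integrableOn
  rw [hu_cover, setIntegral_univ] at this
  refine this.congr_fun fun i => ?_
  exact ((measurePreserving_add_left volume (huZ i)).setIntegral_image_emb
    (measurableEmbedding_addLeft (huZ i)) g (huBox d)).symm

/-- number of lattice points in a translate of a bounded set is bounded -/
lemma hu_count (d : ℕ) (K : Set (Fin d → ℝ)) (hK : Bornology.IsBounded K) :
    ∃ B : ℕ, ∀ v : Fin d → ℝ, ∑' i : Fin d → ℤ, K.indicator (fun _ => (1:ENNReal)) (huZ i + v) ≤ B := by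
  classical
  obtain ⟨R, hR⟩ := hK.subset_closedBall 0
  refine ⟨(⌈2 * R⌉ + 1).toNat ^ d, fun v => ?_⟩
  let S : Finset (Fin d → ℤ) := Fintype.piFinset fun j => Finset.Icc ⌈-R - v j⌉ ⌊R - v j⌋
  rw [tsum_eq_sum (s := S)]
  · calc ∑ i ∈ S, K.indicator (fun _ => (1:ENNReal)) (huZ i + v) ≤ ∑ i ∈ S, 1 :=
          Finset.sum_le_sum fun i _ => Set.indicator_le_self' (fun _ _ => zero_le) _
      _ = (S.card : ENNReal) := by simp
      _ ≤ _ := by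
        norm_cast
        rw [Fintype.card_piFinset]
        calc _ ≤ ∏ j : Fin d, (⌈2 * R⌉ + 1).toNat := by
              refine Finset.prod_le_prod' fun j _ => ?_
              rw [Int.card_Icc]
              apply Int.toNat_le_toNat
              have h1 := Int.floor_le (R - v j)
              have h2 := Int.le_ceil (-R - v j)
              have h3 := Int.le_ceil (2 * R)
              have : ((⌊R - v j⌋ : ℤ):ℝ) ≤ ((⌈2 * R⌉ + ⌈-R - v j⌉ : ℤ) : ℝ) := by push_cast; linarith
              have := Int.cast_le.1 this
              omega
          _ = _ := by simp
  · intro i hi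
    apply Set.indicator_of_notMem
    intro hmem
    apply hi
    have := hR hmem
    rw [mem_closedBall_zero_iff] at this
    rw [Fintype.mem_piFinset]
    intro j
    have hj := (norm_le_pi_norm _ j).trans this
    rw [Real.norm_eq_abs, abs_le] at hj
    simp only [huZ, Pi.add_apply] at hj
    rw [Finset.mem_Icc, Int.ceil_le, Int.le_floor]
    constructor <;> linarith

lemma hu_period (d : ℕ) (q : (Fin d → ℝ) → ℝ) (hqm : Measurable q) (hq0 : ∀ x, 0 ≤ q x)
    (hqi : Integrable q) (B : ℕ)
    (hB : ∀ u, ∑' i : Fin d → ℤ, ENNReal.ofReal (q (huZ i + u)) ≤ B)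
    (b : (Fin d → ℤ) → ℝ) (hb : Summable b) (hb0 : ∀ k, 0 ≤ b k)
    (hbk : ∀ k, k ≠ 0 → ‖∫ x, huE k x * (q x : ℂ)‖^2 ≤ b k) :
    Integrable (fun u => (∑' i : Fin d → ℤ, q (huZ i + u) - ∫ x, q x)^2) (volume.restrict (huBox d)) ∧
    ∫ u in huBox d, (∑' i : Fin d → ℤ, q (huZ i + u) - ∫ x, q x)^2 ≤ ∑' k, b k := by
  set G : (Fin d → ℝ) → ℝ := fun u => ∑' i : Fin d → ℤ, q (huZ i + u) with hG
  have hprob : IsProbabilityMeasure ((volume : Measure (Fin d → ℝ)).restrict (huBox d)) :=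
    ⟨by rw [Measure.restrict_apply_univ, huBox_vol]⟩
  have hGe : ∀ u, G u = (∑' i : Fin d → ℤ, ENNReal.ofReal (q (huZ i + u))).toReal := by
    intro u
    rw [ENNReal.tsum_toReal_eq (fun _ => ENNReal.ofReal_ne_top)]
    exact tsum_congr fun i => (ENNReal.toReal_ofReal (hq0 _)).symm
  have hGm : Measurable G := by
    have : G = fun u => (∑' i : Fin d → ℤ, ENNReal.ofReal (q (huZ i + u))).toReal := funext hGe
    rw [this]
    exact (Measurable.ennreal_tsum fun i => (hqm.comp (measurable_const_add _)).ennreal_ofReal).ennreal_toReal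
  have hG0 : ∀ u, 0 ≤ G u := fun u => tsum_nonneg fun i => hq0 _
  have hGB : ∀ u, G u ≤ B := by
    intro u
    rw [hGe]
    exact ENNReal.toReal_le_of_le_ofReal (by positivity) (by simpa using hB u)
  have hGn : ∀ u, ‖G u‖ ≤ B := fun u => by rw [Real.norm_eq_abs, abs_of_nonneg (hG0 u)]; exact hGB u
  have hqc : Integrable (fun x => (q x : ℂ)) := hqi.ofReal
  have hcoef : ∀ k, ∫ u in huBox d, huE k u * (G u : ℂ) = ∫ x, huE k x * (q x : ℂ) := by
    intro k
    have hint : Integrable (fun x => huE k x * (q x : ℂ)) := by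
      refine hqc.bdd_mul (c := 1) (huE_cont k).aestronglyMeasurable ?_
      exact Eventually.of_forall fun x => (huE_norm k x).le
    have h1 := hu_unfold d _ hint
    have hsh : ∀ i : Fin d → ℤ, Integrable (fun u => (q (huZ i + u) : ℂ)) (volume.restrict (huBox d)) :=
      fun i => (hqc.comp_add_left (huZ i)).integrableOn
    have h2 := hasSum_integral_of_summable_integral_norm (μ := volume.restrict (huBox d))
      (F := fun (i : Fin d → ℤ) u => huE k u * (q (huZ i + u) : ℂ)) ?_ ?_
    · have e : ∀ i : Fin d → ℤ, ∫ u in huBox d, huE k (huZ i + u) * (q (huZ i + u) : ℂ)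
          = ∫ u in huBox d, huE k u * (q (huZ i + u) : ℂ) := by
        intro i
        congr 1; ext u
        rw [huE_add, huE_int, one_mul]
      simp only [e] at h1
      rw [h1.unique h2]
      congr 1; ext u
      rw [tsum_mul_left, hG, Complex.ofReal_tsum]
    · intro i
      refine (hsh i).bdd_mul (c := 1) (huE_cont k).aestronglyMeasurable ?_
      exact Eventually.of_forall fun x => (huE_norm k x).le
    · have := (hu_unfold d _ hqc).summable.norm
      refine this.congr fun i => ?_
      rw [integral_complex_ofReal]
      simp only [norm_mul, huE_norm, one_mul, Complex.norm_real]
      rw [Real.norm_of_nonneg (integral_nonneg fun u => hq0 _)]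
      congr 1; ext u; rw [Real.norm_of_nonneg (hq0 _)]
  have hP := hu_parseval d (fun u => (G u : ℂ)) (Complex.measurable_ofReal.comp hGm) B
    (fun u => by rw [Complex.norm_real]; exact hGn u)
  simp only [hcoef, Complex.norm_real] at hP
  set c := ∫ x, q x with hc
  have hGint : Integrable G (volume.restrict (huBox d)) :=
    Integrable.of_bound hGm.aestronglyMeasurable B (Eventually.of_forall hGn)
  have hG2int : Integrable (fun u => G u ^2) (volume.restrict (huBox d)) := by
    refine Integrable.of_bound (hGm.pow_const 2).aestronglyMeasurable ((B:ℝ)^2)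
      (Eventually.of_forall fun u => ?_)
    rw [norm_pow]; exact pow_le_pow_left₀ (norm_nonneg _) (hGn u) 2
  have h0 : ∫ u in huBox d, G u = c := by
    have := hcoef 0
    simp only [huE_zero, one_mul, integral_complex_ofReal] at this
    exact_mod_cast this
  have hexp : (fun u => (G u - c)^2) = fun u => G u ^2 - 2 * c * G u + c^2 := by
    ext u; ring
  have hint2 : Integrable (fun u => G u ^2 - 2 * c * G u + c^2) (volume.restrict (huBox d)) :=
    (hG2int.sub (hGint.const_mul _)).add (integrable_const _)
  refine ⟨hexp ▸ hint2, ?_⟩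
  have hval : ∫ u in huBox d, (G u - c)^2 = (∫ u in huBox d, ‖G u‖^2) - c^2 := by
    have i1 : Integrable (fun u => G u^2 - 2*c*G u) (volume.restrict (huBox d)) := hG2int.sub (hGint.const_mul _)
    rw [hexp, integral_add i1 (integrable_const _),
      integral_sub hG2int (hGint.const_mul _), integral_const_mul, h0]
    simp only [Real.norm_eq_abs, sq_abs]
    simp
    ring
  have hs := hasSum_ite_sub_hasSum hP 0
  have hz : ‖∫ x, huE 0 x * (q x : ℂ)‖^2 = c^2 := by
    simp only [huE_zero, one_mul, integral_complex_ofReal, Complex.norm_real, Real.norm_eq_abs, sq_abs, hc]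
  rw [hz] at hs
  rw [hval]
  refine hasSum_le (fun k => ?_) hs hb.hasSum
  split_ifs with h
  · exact hb0 k
  · exact hbk k h

/-- indicator of `K` as a real function -/
def huF {d : ℕ} (K : Set (Fin d → ℝ)) : (Fin d → ℝ) → ℝ := K.indicator (fun _ => (1:ℝ))

/-- smoothed indicator -/
def huQ {d : ℕ} (K : Set (Fin d → ℝ)) (μ : Measure (Fin d → ℝ)) (x : Fin d → ℝ) : ℝ :=
  ∫ y, huF K (x + y) ∂μ

lemma huF_meas {d : ℕ} {K : Set (Fin d → ℝ)} (hK : MeasurableSet K) : Measurable (huF K) :=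
  measurable_const.indicator hK

lemma huF_nonneg {d : ℕ} (K : Set (Fin d → ℝ)) (x) : 0 ≤ huF K x :=
  Set.indicator_nonneg (fun _ _ => zero_le_one) x

lemma huF_le_one {d : ℕ} (K : Set (Fin d → ℝ)) (x) : huF K x ≤ 1 :=
  Set.indicator_le_self' (fun _ _ => zero_le_one) x

lemma huF_sq {d : ℕ} (K : Set (Fin d → ℝ)) (x) : huF K x ^ 2 = huF K x := by
  unfold huF
  by_cases h : x ∈ K <;> simp [h]

lemma huF_ofReal {d : ℕ} (K : Set (Fin d → ℝ)) (x) :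
    ENNReal.ofReal (huF K x) = K.indicator (fun _ => (1:ENNReal)) x := by
  unfold huF
  by_cases h : x ∈ K <;> simp [h]

lemma huF_int {d : ℕ} {K : Set (Fin d → ℝ)} (hK : MeasurableSet K) (μ : Measure (Fin d → ℝ))
    [IsProbabilityMeasure μ] (x : Fin d → ℝ) : Integrable (fun y => huF K (x + y)) μ := by
  refine Integrable.of_bound ((huF_meas hK).comp (measurable_const_add x)).aestronglyMeasurable 1
    (Eventually.of_forall fun y => ?_)
  rw [Real.norm_of_nonneg (huF_nonneg _ _)]
  exact huF_le_one _ _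

lemma huQ_meas {d : ℕ} {K : Set (Fin d → ℝ)} (hK : MeasurableSet K) (μ : Measure (Fin d → ℝ))
    [IsProbabilityMeasure μ] : Measurable (huQ K μ) := by
  have : StronglyMeasurable (fun z : (Fin d → ℝ) × (Fin d → ℝ) => huF K (z.1 + z.2)) :=
    ((huF_meas hK).comp (measurable_fst.add measurable_snd)).stronglyMeasurable
  exact this.integral_prod_right'.measurable

lemma huQ_nonneg {d : ℕ} (K : Set (Fin d → ℝ)) (μ : Measure (Fin d → ℝ)) (x) : 0 ≤ huQ K μ x :=
  integral_nonneg fun _ => huF_nonneg _ _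

lemma huQ_le_one {d : ℕ} {K : Set (Fin d → ℝ)} (hK : MeasurableSet K) (μ : Measure (Fin d → ℝ))
    [IsProbabilityMeasure μ] (x) : huQ K μ x ≤ 1 := by
  have := integral_mono (huF_int hK μ x) (integrable_const (1:ℝ)) (fun y => huF_le_one K (x + y))
  simpa [huQ] using this

lemma huQ_ofReal {d : ℕ} {K : Set (Fin d → ℝ)} (hK : MeasurableSet K) (μ : Measure (Fin d → ℝ))
    [IsProbabilityMeasure μ] (x) :
    ENNReal.ofReal (huQ K μ x) = ∫⁻ y, K.indicator (fun _ => (1:ENNReal)) (x + y) ∂μ := by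
  rw [huQ, ofReal_integral_eq_lintegral_ofReal (huF_int hK μ x)
    (Eventually.of_forall fun _ => huF_nonneg _ _)]
  simp only [huF_ofReal]

lemma huInd_meas {d : ℕ} {K : Set (Fin d → ℝ)} (hK : MeasurableSet K) :
    Measurable (K.indicator (fun _ => (1:ENNReal))) := measurable_const.indicator hK

lemma huQ_lint {d : ℕ} {K : Set (Fin d → ℝ)} (hK : MeasurableSet K) (μ : Measure (Fin d → ℝ))
    [IsProbabilityMeasure μ] : ∫⁻ x, ENNReal.ofReal (huQ K μ x) = volume K := by
  simp only [huQ_ofReal hK]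
  rw [lintegral_lintegral_swap]
  · have : ∀ y : Fin d → ℝ, ∫⁻ x, K.indicator (fun _ => (1:ENNReal)) (x + y) = volume K := by
      intro y
      rw [lintegral_add_right_eq_self (μ := volume) (K.indicator (fun _ => (1:ENNReal))) y]
      rw [lintegral_indicator hK]; simp
    simp [this]
  · exact ((huInd_meas hK).comp (measurable_fst.add measurable_snd)).aemeasurable

lemma huQ_integrable {d : ℕ} {K : Set (Fin d → ℝ)} (hK : MeasurableSet K) (μ : Measure (Fin d → ℝ))
    [IsProbabilityMeasure μ] (hKf : volume K ≠ ⊤) : Integrable (huQ K μ) := by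
  refine ⟨(huQ_meas hK μ).aestronglyMeasurable, ?_⟩
  rw [hasFiniteIntegral_iff_ofReal (Eventually.of_forall fun x => huQ_nonneg K μ x), huQ_lint hK]
  exact hKf.lt_top

lemma huQ_count {d : ℕ} {K : Set (Fin d → ℝ)} (hK : MeasurableSet K) (μ : Measure (Fin d → ℝ))
    [IsProbabilityMeasure μ] (hKb : Bornology.IsBounded K) :
    ∃ B : ℕ, ∀ u, ∑' i : Fin d → ℤ, ENNReal.ofReal (huQ K μ (huZ i + u)) ≤ B := by
  obtain ⟨B, hB⟩ := hu_count d K hKb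
  refine ⟨B, fun u => ?_⟩
  simp only [huQ_ofReal hK]
  rw [← lintegral_tsum]
  · calc ∫⁻ y, ∑' i : Fin d → ℤ, K.indicator (fun _ => (1:ENNReal)) (huZ i + u + y) ∂μ
        ≤ ∫⁻ y, (B : ENNReal) ∂μ := lintegral_mono fun y => by
          simp only [add_assoc]; exact hB (u + y)
      _ = B := by simp
  · intro i
    exact ((huInd_meas hK).comp (measurable_const_add _)).aemeasurable

lemma hu_fin_sum {G : Type*} [AddCommGroup G] [DecidableEq G] (S Λ : Finset G) (a : G → ℝ)
    (ha : ∀ i, 0 ≤ a i) (c : G → G → ℝ)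
    (h1 : ∀ i j, c i j ≤ (a i + a j) / 2) (h2 : ∀ i j, j - i ∉ S → c i j = 0) :
    ∑ i ∈ Λ, ∑ j ∈ Λ, c i j ≤ S.card * ∑ i ∈ Λ, a i := by
  have hc : ∀ i j, c i j ≤ (if j - i ∈ S then a i else 0) / 2 + (if j - i ∈ S then a j else 0) / 2 := by
    intro i j
    split_ifs with h
    · linarith [h1 i j]
    · simp [h2 i j h]
  have k1 : ∀ i, ∑ j ∈ Λ, (if j - i ∈ S then a i else 0) ≤ S.card * a i := by
    intro i
    rw [← Finset.sum_filter, Finset.sum_const, nsmul_eq_mul]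
    refine mul_le_mul_of_nonneg_right ?_ (ha i)
    have : (Λ.filter fun j => j - i ∈ S).card ≤ S.card :=
      Finset.card_le_card_of_injOn (fun j => j - i) (fun j hj => (Finset.mem_filter.1 hj).2)
        (fun x _ y _ h => by simpa using h)
    exact_mod_cast this
  have k2 : ∀ j, ∑ i ∈ Λ, (if j - i ∈ S then a j else 0) ≤ S.card * a j := by
    intro j
    rw [← Finset.sum_filter, Finset.sum_const, nsmul_eq_mul]
    refine mul_le_mul_of_nonneg_right ?_ (ha j)
    have : (Λ.filter fun i => j - i ∈ S).card ≤ S.card :=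
      Finset.card_le_card_of_injOn (fun i => j - i) (fun i hi => (Finset.mem_filter.1 hi).2)
        (fun x _ y _ h => by simpa using h)
    exact_mod_cast this
  calc ∑ i ∈ Λ, ∑ j ∈ Λ, c i j ≤ ∑ i ∈ Λ, ∑ j ∈ Λ, ((if j - i ∈ S then a i else 0) / 2 + (if j - i ∈ S then a j else 0) / 2) :=
        Finset.sum_le_sum fun i _ => Finset.sum_le_sum fun j _ => hc i j
    _ = (∑ i ∈ Λ, ∑ j ∈ Λ, (if j - i ∈ S then a i else 0)) / 2 + (∑ j ∈ Λ, ∑ i ∈ Λ, (if j - i ∈ S then a j else 0)) / 2 := by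
        simp only [Finset.sum_add_distrib, ← Finset.sum_div]
        rw [Finset.sum_comm (f := fun i j => if j - i ∈ S then a j else 0)]
    _ ≤ (∑ i ∈ Λ, S.card * a i) / 2 + (∑ i ∈ Λ, S.card * a i) / 2 := by
        have := Finset.sum_le_sum (s := Λ) fun i _ => k1 i
        have := Finset.sum_le_sum (s := Λ) fun i _ => k2 i
        linarith
    _ = _ := by rw [← Finset.mul_sum]; ring

section
variable {Ω : Type*} [MeasurableSpace Ω] {P : Measure Ω} [IsProbabilityMeasure P] {d : ℕ}
    {K : Set (Fin d → ℝ)} {μ : Measure (Fin d → ℝ)} [IsProbabilityMeasure μ]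

instance huBox_prob (d : ℕ) : IsProbabilityMeasure ((volume : Measure (Fin d → ℝ)).restrict (huBox d)) :=
  ⟨by rw [Measure.restrict_apply_univ, huBox_vol]⟩

lemma huY_bd (hK : MeasurableSet K) (x y) : ‖huF K x - huQ K μ y‖ ≤ 1 := by
  rw [Real.norm_eq_abs, abs_le]
  have := huF_nonneg K x
  have := huF_le_one K x
  have := huQ_nonneg K μ y
  have := huQ_le_one hK μ y
  constructor <;> linarith

lemma huY_sq (hK : MeasurableSet K) {p V : Ω → (Fin d → ℝ)} (hp : Measurable p) (hV : Measurable V)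
    (hVl : P.map V = volume.restrict (huBox d)) (hpl : P.map p = μ) (hi : IndepFun V p P)
    (i : Fin d → ℤ) :
    ∫ ω, (huF K (huZ i + p ω + V ω) - huQ K μ (huZ i + V ω))^2 ∂P
      = ∫ u in huBox d, (huQ K μ (huZ i + u) - huQ K μ (huZ i + u)^2) := by
  have hl : P.map (fun ω => (V ω, p ω)) = (volume.restrict (huBox d)).prod μ := by
    rw [(indepFun_iff_map_prod_eq_prod_map_map hV.aemeasurable hp.aemeasurable).1 hi, hVl, hpl]
  let φ : (Fin d → ℝ) × (Fin d → ℝ) → ℝ := fun z =>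
    (huF K (huZ i + z.1 + z.2) - huQ K μ (huZ i + z.1))^2
  have hφ : Measurable φ := by
    refine Measurable.pow_const (Measurable.sub ?_ ?_) 2
    · exact (huF_meas hK).comp (by fun_prop)
    · exact (huQ_meas hK μ).comp (by fun_prop)
  have hφi : Integrable φ ((volume.restrict (huBox d)).prod μ) := by
    refine Integrable.of_bound hφ.aestronglyMeasurable 1 (Eventually.of_forall fun z => ?_)
    rw [norm_pow]
    exact pow_le_one₀ (norm_nonneg _) (huY_bd hK _ _)
  have h1 : ∫ ω, (huF K (huZ i + p ω + V ω) - huQ K μ (huZ i + V ω))^2 ∂P = ∫ ω, φ (V ω, p ω) ∂P := by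
    congr 1; ext ω
    simp only [φ]
    rw [add_right_comm]
  rw [h1, ← integral_map (φ := fun ω => (V ω, p ω)) (f := φ) (by fun_prop) hφ.aestronglyMeasurable, hl, integral_prod _ hφi]
  congr 1; ext u
  have e : ∀ y, φ (u, y) = huF K (huZ i + u + y) - 2 * huQ K μ (huZ i + u) * huF K (huZ i + u + y) + huQ K μ (huZ i + u)^2 := by
    intro y
    simp only [φ]
    rw [sub_sq, huF_sq]; ring
  simp only [e]
  have i0 := huF_int hK μ (huZ i + u)
  have i1 : Integrable (fun y => huF K (huZ i + u + y) - 2 * huQ K μ (huZ i + u) * huF K (huZ i + u + y)) μ :=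
    i0.sub (i0.const_mul _)
  rw [integral_add i1 (integrable_const _), integral_sub i0 (i0.const_mul _), integral_const_mul]
  change huQ K μ (huZ i + u) - 2 * huQ K μ (huZ i + u) * huQ K μ (huZ i + u) + _ = _
  simp
  ring

lemma huY_cross (hK : MeasurableSet K) {p p' V : Ω → (Fin d → ℝ)} (hp : Measurable p) (hp' : Measurable p') (hV : Measurable V)
    (hVl : P.map V = volume.restrict (huBox d)) (hpl : P.map p = μ) (hpl' : P.map p' = μ)
    (hi : IndepFun V (fun ω => (p ω, p' ω)) P) (hi' : IndepFun p p' P)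
    (i j : Fin d → ℤ) :
    ∫ ω, (huF K (huZ i + p ω + V ω) - huQ K μ (huZ i + V ω)) * (huF K (huZ j + p' ω + V ω) - huQ K μ (huZ j + V ω)) ∂P
      = 0 := by
  have hl : P.map (fun ω => (V ω, p ω, p' ω)) = (volume.restrict (huBox d)).prod (μ.prod μ) := by
    rw [(indepFun_iff_map_prod_eq_prod_map_map hV.aemeasurable (hp.prodMk hp').aemeasurable).1 hi, hVl,
      (indepFun_iff_map_prod_eq_prod_map_map hp.aemeasurable hp'.aemeasurable).1 hi', hpl, hpl']
  let φ : (Fin d → ℝ) × (Fin d → ℝ) × (Fin d → ℝ) → ℝ := fun z =>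
    (huF K (huZ i + z.1 + z.2.1) - huQ K μ (huZ i + z.1)) * (huF K (huZ j + z.1 + z.2.2) - huQ K μ (huZ j + z.1))
  have hφ : Measurable φ := by
    refine Measurable.mul (Measurable.sub ?_ ?_) (Measurable.sub ?_ ?_)
    · exact (huF_meas hK).comp (by fun_prop)
    · exact (huQ_meas hK μ).comp (by fun_prop)
    · exact (huF_meas hK).comp (by fun_prop)
    · exact (huQ_meas hK μ).comp (by fun_prop)
  have hφi : Integrable φ ((volume.restrict (huBox d)).prod (μ.prod μ)) := by
    refine Integrable.of_bound hφ.aestronglyMeasurable 1 (Eventually.of_forall fun z => ?_)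
    rw [norm_mul]
    exact mul_le_one₀ (huY_bd hK _ _) (norm_nonneg _) (huY_bd hK _ _)
  have h1 : ∫ ω, (huF K (huZ i + p ω + V ω) - huQ K μ (huZ i + V ω)) * (huF K (huZ j + p' ω + V ω) - huQ K μ (huZ j + V ω)) ∂P = ∫ ω, φ (V ω, p ω, p' ω) ∂P := by
    congr 1; ext ω
    simp only [φ]
    rw [add_right_comm, add_right_comm (huZ j)]
  rw [h1, ← integral_map (φ := fun ω => (V ω, p ω, p' ω)) (f := φ) (by fun_prop) hφ.aestronglyMeasurable, hl, integral_prod _ hφi]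
  refine integral_eq_zero_of_ae (Eventually.of_forall fun u => ?_)
  change ∫ z : (Fin d → ℝ) × (Fin d → ℝ), (huF K (huZ i + u + z.1) - huQ K μ (huZ i + u)) * (huF K (huZ j + u + z.2) - huQ K μ (huZ j + u)) ∂(μ.prod μ) = 0
  rw [integral_prod_mul (fun y => huF K (huZ i + u + y) - huQ K μ (huZ i + u)) (fun y => huF K (huZ j + u + y) - huQ K μ (huZ j + u)),
    integral_sub (huF_int hK μ _) (integrable_const _)]
  change (huQ K μ (huZ i + u) - _) * _ = 0
  simp
end

section
variable {Ω : Type*} [MeasurableSpace Ω] {P : Measure Ω} [IsProbabilityMeasure P] {d : ℕ}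
    {K : Set (Fin d → ℝ)} {μ : Measure (Fin d → ℝ)} [IsProbabilityMeasure μ]

lemma huQ_sub_sq (hK : MeasurableSet K) (x) : 0 ≤ huQ K μ x - huQ K μ x ^ 2 := by
  have := huQ_nonneg K μ x
  have := huQ_le_one hK μ x
  nlinarith

lemma huQ_sub_sq_int (hK : MeasurableSet K) (hKf : volume K ≠ ⊤) :
    Integrable (fun x => huQ K μ x - huQ K μ x ^ 2) := by
  refine (huQ_integrable hK μ hKf).mono
    ((huQ_meas hK μ).sub ((huQ_meas hK μ).pow_const 2)).aestronglyMeasurable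
    (Eventually.of_forall fun x => ?_)
  rw [Real.norm_of_nonneg (huQ_sub_sq hK x), Real.norm_of_nonneg (huQ_nonneg K μ x)]
  nlinarith [sq_nonneg (huQ K μ x)]

lemma huY_partial (hK : MeasurableSet K) (hKf : volume K ≠ ⊤)
    {p : (Fin d → ℤ) → Ω → (Fin d → ℝ)} {V : Ω → (Fin d → ℝ)}
    (hp : ∀ i, Measurable (p i)) (hV : Measurable V)
    (hVl : P.map V = volume.restrict (huBox d)) (hpl : ∀ i, P.map (p i) = μ)
    (hi : ∀ i j, IndepFun V (fun ω => (p i ω, p j ω)) P) (S : Finset (Fin d → ℤ))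
    (hS : ∀ i j, j - i ∉ S → IndepFun (p i) (p j) P) (Λ : Finset (Fin d → ℤ)) :
    ∫⁻ ω, ENNReal.ofReal ((∑ i ∈ Λ, (huF K (huZ i + p i ω + V ω) - huQ K μ (huZ i + V ω)))^2) ∂P
      ≤ ENNReal.ofReal (S.card * ∫ x, (huQ K μ x - huQ K μ x ^2)) := by
  classical
  set Y : (Fin d → ℤ) → Ω → ℝ := fun i ω => huF K (huZ i + p i ω + V ω) - huQ K μ (huZ i + V ω) with hY
  have hYm : ∀ i, Measurable (Y i) := fun i => by
    refine Measurable.sub ?_ ?_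
    · exact (huF_meas hK).comp (by fun_prop)
    · exact (huQ_meas hK μ).comp (by fun_prop)
  have hYY : ∀ i j, Integrable (fun ω => Y i ω * Y j ω) P := fun i j => by
    refine Integrable.of_bound ((hYm i).mul (hYm j)).aestronglyMeasurable 1 (Eventually.of_forall fun z => ?_)
    rw [norm_mul]
    exact mul_le_one₀ (huY_bd hK _ _) (norm_nonneg _) (huY_bd hK _ _)
  have hsq : ∀ ω, (∑ i ∈ Λ, Y i ω)^2 = ∑ i ∈ Λ, ∑ j ∈ Λ, Y i ω * Y j ω := fun ω => by
    rw [sq, Finset.sum_mul_sum]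
  have hint : Integrable (fun ω => (∑ i ∈ Λ, Y i ω)^2) P := by
    simp only [hsq]
    exact integrable_finset_sum _ fun i _ => integrable_finset_sum _ fun j _ => hYY i j
  rw [← ofReal_integral_eq_lintegral_ofReal hint (Eventually.of_forall fun _ => sq_nonneg _)]
  refine ENNReal.ofReal_le_ofReal ?_
  simp only [hsq]
  rw [integral_finset_sum _ fun i _ => integrable_finset_sum _ fun j _ => hYY i j]
  have : ∀ i ∈ Λ, ∫ ω, ∑ j ∈ Λ, Y i ω * Y j ω ∂P = ∑ j ∈ Λ, ∫ ω, Y i ω * Y j ω ∂P := fun i _ =>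
    integral_finset_sum _ fun j _ => hYY i j
  rw [Finset.sum_congr rfl this]
  have hfin := hu_fin_sum S Λ (fun i => ∫ ω, Y i ω ^2 ∂P) (fun i => integral_nonneg fun _ => sq_nonneg _)
    (fun i j => ∫ ω, Y i ω * Y j ω ∂P) ?_ ?_
  · refine hfin.trans (mul_le_mul_of_nonneg_left ?_ (by positivity))
    have hunf := hu_unfold d _ ((huQ_sub_sq_int (μ := μ) hK hKf).ofReal (𝕜 := ℂ))
    have e : ∀ i, ∫ ω, Y i ω ^2 ∂P = ∫ u in huBox d, (huQ K μ (huZ i + u) - huQ K μ (huZ i + u)^2) :=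
      fun i => huY_sq hK (hp i) hV hVl (hpl i) ((hi i i).comp measurable_id measurable_fst) i
    simp only [e]
    have hunf' : HasSum (fun i : Fin d → ℤ => ∫ u in huBox d, (huQ K μ (huZ i + u) - huQ K μ (huZ i + u)^2))
        (∫ x, (huQ K μ x - huQ K μ x ^2)) := by
      rw [← Complex.hasSum_ofReal]
      have : ∀ f : (Fin d → ℝ) → ℝ, ∀ ν : Measure (Fin d → ℝ), ∫ x, (RCLike.ofReal (f x) : ℂ) ∂ν = ((∫ x, f x ∂ν : ℝ) : ℂ) :=
        fun f ν => integral_ofReal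
      rw [this] at hunf
      refine hunf.congr_fun fun i => ?_
      exact (this _ _).symm
    exact sum_le_hasSum _ (fun i _ => integral_nonneg fun u => huQ_sub_sq hK _) hunf'
  · intro i j
    have a1 := (hYY i i); have a2 := (hYY j j)
    simp only [← sq] at a1 a2
    have := integral_mono (hYY i j) ((a1.add a2).div_const 2) (fun ω => by
      change Y i ω * Y j ω ≤ (Y i ω ^2 + Y j ω ^2)/2
      nlinarith [sq_nonneg (Y i ω - Y j ω)])
    refine this.trans_eq ?_
    change ∫ ω, (Y i ω ^2 + Y j ω ^2)/2 ∂P = _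
    rw [integral_div, integral_add a1 a2]
  · intro i j hij
    exact huY_cross hK (hp i) (hp j) hV hVl (hpl i) (hpl j) (hi i j) (hS i j hij) i j

lemma huN_fatou (hK : MeasurableSet K) (hKb : Bornology.IsBounded K) (hKf : volume K ≠ ⊤)
    {p : (Fin d → ℤ) → Ω → (Fin d → ℝ)} {V : Ω → (Fin d → ℝ)}
    (hp : ∀ i, Measurable (p i)) (hV : Measurable V)
    (hVl : P.map V = volume.restrict (huBox d)) (hpl : ∀ i, P.map (p i) = μ)
    (hi : ∀ i j, IndepFun V (fun ω => (p i ω, p j ω)) P) (S : Finset (Fin d → ℤ))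
    (hS : ∀ i j, j - i ∉ S → IndepFun (p i) (p j) P) :
    ∫⁻ ω, ENNReal.ofReal ((∑' i, huF K (huZ i + p i ω + V ω) - ∑' i, huQ K μ (huZ i + V ω))^2) ∂P
      ≤ ENNReal.ofReal (S.card * ∫ x, (huQ K μ x - huQ K μ x ^2)) := by
  obtain ⟨B, hB⟩ := huQ_count hK μ hKb
  have hQs : ∀ u, Summable fun i : Fin d → ℤ => huQ K μ (huZ i + u) := by
    intro u
    have := ENNReal.summable_toReal (ne_top_of_le_ne_top (ENNReal.natCast_ne_top B) (hB u))
    exact this.congr fun i => ENNReal.toReal_ofReal (huQ_nonneg _ _ _)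
  have hFm : ∀ i, Measurable fun ω => ENNReal.ofReal (huF K (huZ i + p i ω + V ω)) := fun i =>
    ((huF_meas hK).comp (by fun_prop)).ennreal_ofReal
  have hone : ∀ i, ∫⁻ ω, ENNReal.ofReal (huF K (huZ i + p i ω + V ω)) ∂P
      = ∫⁻ u in huBox d, ENNReal.ofReal (huQ K μ (huZ i + u)) := by
    intro i
    have hl : P.map (fun ω => (V ω, p i ω)) = (volume.restrict (huBox d)).prod μ := by
      rw [(indepFun_iff_map_prod_eq_prod_map_map hV.aemeasurable (hp i).aemeasurable).1
        ((hi i i).comp measurable_id measurable_fst), hVl, hpl]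
    let φ : (Fin d → ℝ) × (Fin d → ℝ) → ENNReal := fun z =>
      K.indicator (fun _ => (1:ENNReal)) (huZ i + z.1 + z.2)
    have hφ : Measurable φ := (huInd_meas hK).comp (by fun_prop)
    have h1 : ∀ ω, ENNReal.ofReal (huF K (huZ i + p i ω + V ω)) = φ (V ω, p i ω) := by
      intro ω
      rw [huF_ofReal, add_right_comm]
    simp only [h1]
    rw [← lintegral_map (f := φ) (g := fun ω => (V ω, p i ω)) hφ (by fun_prop), hl, lintegral_prod _ hφ.aemeasurable]
    simp only [huQ_ofReal hK, φ]
  have hfin : ∫⁻ ω, ∑' i, ENNReal.ofReal (huF K (huZ i + p i ω + V ω)) ∂P ≠ ⊤ := by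
    rw [lintegral_tsum fun i => (hFm i).aemeasurable]
    simp only [hone]
    rw [← hu_unfold_l d (fun x => ENNReal.ofReal (huQ K μ x)), huQ_lint hK]
    exact hKf
  have hae : ∀ᵐ ω ∂P, Summable fun i => huF K (huZ i + p i ω + V ω) := by
    filter_upwards [ae_lt_top' (AEMeasurable.ennreal_tsum fun i => (hFm i).aemeasurable) hfin] with ω hω
    exact (ENNReal.summable_toReal hω.ne).congr fun i => ENNReal.toReal_ofReal (huF_nonneg _ _)
  obtain ⟨Λ, hΛ⟩ := exists_seq_tendsto (atTop : Filter (Finset (Fin d → ℤ)))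
  have hYm : ∀ n, Measurable fun ω => ENNReal.ofReal ((∑ i ∈ Λ n, (huF K (huZ i + p i ω + V ω) - huQ K μ (huZ i + V ω)))^2) := by
    intro n
    refine (Measurable.pow_const (Finset.measurable_sum _ fun i _ => Measurable.sub ?_ ?_) 2).ennreal_ofReal
    · exact (huF_meas hK).comp (by fun_prop)
    · exact (huQ_meas hK μ).comp (by fun_prop)
  calc _ = ∫⁻ ω, liminf (fun n => ENNReal.ofReal ((∑ i ∈ Λ n, (huF K (huZ i + p i ω + V ω) - huQ K μ (huZ i + V ω)))^2)) atTop ∂P := by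
        refine lintegral_congr_ae ?_
        filter_upwards [hae] with ω hω
        symm
        apply Tendsto.liminf_eq
        have h := (hω.hasSum.sub (hQs (V ω)).hasSum)
        exact ENNReal.tendsto_ofReal ((Tendsto.comp h hΛ).pow 2)
    _ ≤ _ := lintegral_liminf_le hYm
    _ ≤ ENNReal.ofReal (S.card * ∫ x, (huQ K μ x - huQ K μ x ^2)) := by
        refine (liminf_le_liminf (v := fun _ => ENNReal.ofReal (S.card * ∫ x, (huQ K μ x - huQ K μ x ^2)))
          (Eventually.of_forall fun n => ?_)).trans_eq ?_
        · exact huY_partial hK hKf hp hV hVl hpl hi S hS (Λ n)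
        · simp

lemma huN_var (hK : MeasurableSet K) (hKb : Bornology.IsBounded K) (hKf : volume K ≠ ⊤)
    {p : (Fin d → ℤ) → Ω → (Fin d → ℝ)} {V : Ω → (Fin d → ℝ)}
    (hp : ∀ i, Measurable (p i)) (hV : Measurable V)
    (hVl : P.map V = volume.restrict (huBox d)) (hpl : ∀ i, P.map (p i) = μ)
    (hi : ∀ i j, IndepFun V (fun ω => (p i ω, p j ω)) P) (S : Finset (Fin d → ℤ))
    (hS : ∀ i j, j - i ∉ S → IndepFun (p i) (p j) P)
    (b : (Fin d → ℤ) → ℝ) (hb : Summable b) (hb0 : ∀ k, 0 ≤ b k)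
    (hbk : ∀ k, k ≠ 0 → ‖∫ x, huE k x * (huQ K μ x : ℂ)‖^2 ≤ b k) :
    variance (fun ω => ∑' i, huF K (huZ i + p i ω + V ω)) P ≤
      2 * (S.card * ∫ x, (huQ K μ x - huQ K μ x ^2)) + 2 * ∑' k, b k := by
  obtain ⟨B, hB⟩ := huQ_count hK μ hKb
  obtain ⟨hint, hle⟩ := hu_period d (huQ K μ) (huQ_meas hK μ) (huQ_nonneg K μ) (huQ_integrable hK μ hKf)
    B hB b hb hb0 hbk
  have hf := huN_fatou hK hKb hKf hp hV hVl hpl hi S hS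
  set c := ∫ x, huQ K μ x
  set N : Ω → ℝ := fun ω => ∑' i, huF K (huZ i + p i ω + V ω) with hN
  set G : (Fin d → ℝ) → ℝ := fun u => ∑' i, huQ K μ (huZ i + u) with hG
  set X := (S.card * ∫ x, (huQ K μ x - huQ K μ x ^2)) with hX
  have hX0 : 0 ≤ X := mul_nonneg (by positivity) (integral_nonneg fun x => huQ_sub_sq hK x)
  have hb00 : 0 ≤ ∑' k, b k := tsum_nonneg hb0
  have hNm : Measurable N := by
    have : N = fun ω => (∑' i, ENNReal.ofReal (huF K (huZ i + p i ω + V ω))).toReal := by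
      ext ω
      rw [ENNReal.tsum_toReal_eq (fun _ => ENNReal.ofReal_ne_top)]
      exact tsum_congr fun i => (ENNReal.toReal_ofReal (huF_nonneg _ _)).symm
    rw [this]
    exact (Measurable.ennreal_tsum fun i => ((huF_meas hK).comp (by fun_prop)).ennreal_ofReal).ennreal_toReal
  have hGm : Measurable G := by
    have : G = fun u => (∑' i : Fin d → ℤ, ENNReal.ofReal (huQ K μ (huZ i + u))).toReal := by
      ext u
      rw [ENNReal.tsum_toReal_eq (fun _ => ENNReal.ofReal_ne_top)]
      exact tsum_congr fun i => (ENNReal.toReal_ofReal (huQ_nonneg _ _ _)).symm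
    rw [this]
    exact (Measurable.ennreal_tsum fun i => ((huQ_meas hK μ).comp (measurable_const_add _)).ennreal_ofReal).ennreal_toReal
  have h2 : ∫⁻ ω, ENNReal.ofReal ((G (V ω) - c)^2) ∂P ≤ ENNReal.ofReal (∑' k, b k) := by
    have hm : Measurable fun u => ENNReal.ofReal ((G u - c)^2) :=
      ((hGm.sub_const c).pow_const 2).ennreal_ofReal
    rw [← lintegral_map (f := fun u => ENNReal.ofReal ((G u - c)^2)) hm hV, hVl,
      ← ofReal_integral_eq_lintegral_ofReal hint (Eventually.of_forall fun _ => sq_nonneg _)]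
    exact ENNReal.ofReal_le_ofReal hle
  have h3 : ∫⁻ ω, ENNReal.ofReal ((N ω - c)^2) ∂P ≤ ENNReal.ofReal (2 * X + 2 * ∑' k, b k) := by
    calc ∫⁻ ω, ENNReal.ofReal ((N ω - c)^2) ∂P
        ≤ ∫⁻ ω, (2 * ENNReal.ofReal ((N ω - G (V ω))^2) + 2 * ENNReal.ofReal ((G (V ω) - c)^2)) ∂P := by
          refine lintegral_mono fun ω => ?_
          rw [show (2:ENNReal) = ENNReal.ofReal 2 by simp, ← ENNReal.ofReal_mul (by norm_num),
            ← ENNReal.ofReal_mul (by norm_num), ← ENNReal.ofReal_add (by positivity) (by positivity)]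
          refine ENNReal.ofReal_le_ofReal ?_
          nlinarith [sq_nonneg ((N ω - G (V ω)) - (G (V ω) - c))]
      _ = 2 * ∫⁻ ω, ENNReal.ofReal ((N ω - G (V ω))^2) ∂P + 2 * ∫⁻ ω, ENNReal.ofReal ((G (V ω) - c)^2) ∂P := by
          have m1 : Measurable fun ω => ENNReal.ofReal ((N ω - G (V ω))^2) :=
            ((hNm.sub (hGm.comp hV)).pow_const 2).ennreal_ofReal
          have m2 : Measurable fun ω => ENNReal.ofReal ((G (V ω) - c)^2) :=
            (((hGm.comp hV).sub_const c).pow_const 2).ennreal_ofReal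
          rw [lintegral_add_left (m1.const_mul 2), lintegral_const_mul _ m1, lintegral_const_mul _ m2]
      _ ≤ 2 * ENNReal.ofReal X + 2 * ENNReal.ofReal (∑' k, b k) := by gcongr
      _ = _ := by
          rw [show (2:ENNReal) = ENNReal.ofReal 2 by simp, ← ENNReal.ofReal_mul (by norm_num),
            ← ENNReal.ofReal_mul (by norm_num), ← ENNReal.ofReal_add (by positivity) (by positivity)]
  have hsqint : Integrable (fun ω => (N ω - c)^2) P := by
    refine ⟨((hNm.sub_const c).pow_const 2).aestronglyMeasurable, ?_⟩
    rw [hasFiniteIntegral_iff_ofReal (Eventually.of_forall fun x => sq_nonneg _)]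
    exact h3.trans_lt ENNReal.ofReal_lt_top
  rw [← variance_sub_const hNm.aestronglyMeasurable c]
  refine (variance_le_expectation_sq (hNm.sub_const c).aestronglyMeasurable).trans ?_
  have h4 : ENNReal.ofReal (∫ ω, (N ω - c)^2 ∂P) ≤ ENNReal.ofReal (2 * X + 2 * ∑' k, b k) := by
    rw [ofReal_integral_eq_lintegral_ofReal hsqint (Eventually.of_forall fun _ => sq_nonneg _)]
    exact h3
  exact (ENNReal.ofReal_le_ofReal_iff (by positivity)).1 h4
end

lemma hu_summable_aux (d : ℕ) (L : Submodule ℤ (Fin d → ℝ)) [DiscreteTopology L] [IsZLattice ℝ L]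
    (hmem : ∀ k : Fin d → ℤ, huZ k ∈ L) : Summable fun k : Fin d → ℤ => ‖huZ k‖⁻¹ ^ (d + 1) := by
  have hr : Module.finrank ℤ L = d := by
    rw [ZLattice.rank ℝ L]; simp
  have h := ZLattice.summable_norm_pow_inv L (d+1) (by rw [hr]; exact Nat.lt_succ_self d)
  have hinj : Function.Injective (fun k : Fin d → ℤ => (⟨huZ k, hmem k⟩ : L)) := by
    intro k k' hkk
    have h1 : huZ k = huZ k' := congrArg Subtype.val hkk
    ext j
    have := congrFun h1 j
    simpa [huZ] using this
  have h2 := h.comp_injective hinj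
  refine h2.congr fun k => ?_
  simp only [Function.comp_apply, Submodule.coe_norm]

lemma hu_mem_span (d : ℕ) (k : Fin d → ℤ) :
    huZ k ∈ Submodule.span ℤ (Set.range (Pi.basisFun ℝ (Fin d))) := by
  have : huZ k = ∑ j, k j • (Pi.basisFun ℝ (Fin d) j) := by
    ext i
    simp [huZ, Finset.sum_apply, Pi.single_apply]
  rw [this]
  exact Submodule.sum_mem _ fun j _ => Submodule.smul_mem _ _ (Submodule.subset_span ⟨j, rfl⟩)

lemma hu_summable (d : ℕ) : Summable fun k : Fin d → ℤ => ‖huZ k‖⁻¹ ^ (d + 1) :=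
  hu_summable_aux d (Submodule.span ℤ (Set.range (Pi.basisFun ℝ (Fin d)))) (hu_mem_span d)

/-- ellipsoid -/
def huK {d : ℕ} (T : (Fin d → ℝ) ≃L[ℝ] EuclideanSpace ℝ (Fin d)) (r : ℝ) : Set (Fin d → ℝ) :=
  {x | ‖T x‖ ≤ r}

section
variable {d : ℕ} (T : (Fin d → ℝ) ≃L[ℝ] EuclideanSpace ℝ (Fin d))

lemma huK_meas (r : ℝ) : MeasurableSet (huK T r) :=
  (isClosed_le (T.continuous.norm) continuous_const).measurableSet

lemma huK_pre (r : ℝ) : huK T r = T ⁻¹' (Metric.closedBall 0 r) := by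
  ext x; simp [huK]

lemma huK_img (r : ℝ) : huK T r = T.symm '' (Metric.closedBall 0 r) := by
  rw [huK_pre]
  exact (T.symm.toEquiv.image_eq_preimage_symm _).symm

lemma huK_bdd (r : ℝ) : Bornology.IsBounded (huK T r) := by
  rw [huK_img]
  exact ((isCompact_closedBall _ _).image T.symm.continuous).isBounded

lemma huK_fin (r : ℝ) : volume (huK T r) ≠ ⊤ := (huK_bdd T r).measure_lt_top.ne

open scoped Pointwise in
lemma huK_vol {r : ℝ} (hr : 0 < r) : (volume (huK T r)).toReal = r ^ d * (volume (huK T 1)).toReal := by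
  have : huK T r = r • huK T 1 := by
    ext x
    rw [Set.mem_smul_set_iff_inv_smul_mem₀ hr.ne']
    simp only [huK, Set.mem_ofPred_eq, map_smul, norm_smul, norm_inv, Real.norm_eq_abs, abs_of_pos hr]
    rw [inv_mul_le_iff₀ hr, mul_one]
  rw [this, Measure.addHaar_smul_of_nonneg _ hr.le, ENNReal.toReal_mul, ENNReal.toReal_ofReal (by positivity)]
  simp

lemma hu_tight (μ : Measure (Fin d → ℝ)) [IsProbabilityMeasure μ] {δ : ℝ} (hδ : 0 < δ) :
    ∃ M : ℝ, 0 < M ∧ 1 - δ ≤ μ.real (huK T M) := by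
  have hmono : Monotone fun n : ℕ => huK T n := by
    intro m n hmn x hx
    have h1 : ‖T x‖ ≤ (m:ℝ) := hx
    have h2 : (m:ℝ) ≤ n := by exact_mod_cast hmn
    exact h1.trans h2
  have hU : (⋃ n : ℕ, huK T n) = Set.univ := by
    refine Set.eq_univ_of_forall fun x => Set.mem_iUnion.2 ?_
    exact exists_nat_ge ‖T x‖
  have h := tendsto_measure_iUnion_atTop (μ := μ) hmono
  rw [hU, measure_univ] at h
  have h' := (ENNReal.tendsto_toReal ENNReal.one_ne_top).comp h
  have h'' := h'.eventually (lt_mem_nhds (show 1 - δ < ENNReal.toReal 1 by simp [hδ]))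
  obtain ⟨n, hn1, hn2⟩ := (h''.and (eventually_gt_atTop 0)).exists
  exact ⟨n, by exact_mod_cast hn2, hn1.le⟩

lemma huQ_real {K : Set (Fin d → ℝ)} (hK : MeasurableSet K) (μ : Measure (Fin d → ℝ)) (x : Fin d → ℝ) :
    huQ K μ x = μ.real {y | x + y ∈ K} := by
  have : (fun y => huF K (x + y)) = Set.indicator {y | x + y ∈ K} (fun _ => (1:ℝ)) := by
    ext y
    simp [huF, Set.indicator]
  rw [huQ, this, integral_indicator (show MeasurableSet {y | x + y ∈ K} from measurable_const_add x hK)]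
  simp

lemma huQ_bulk (μ : Measure (Fin d → ℝ)) [IsProbabilityMeasure μ] {δ : ℝ} (hδ : 0 < δ) :
    ∃ M : ℝ, 0 < M ∧ ∀ r, M < r → ∫ x, (huQ (huK T r) μ x - huQ (huK T r) μ x ^ 2) ≤
      (volume (huK T 1)).toReal * (r ^ d - (1 - 2 * δ) * (r - M)^d) := by
  obtain ⟨M, hM, hMδ⟩ := hu_tight T μ hδ
  refine ⟨M, hM, fun r hr => ?_⟩
  have hrM : 0 < r - M := by linarith
  have hK := huK_meas T r
  have hqi := huQ_integrable hK μ (huK_fin T r)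
  have hind : Integrable ((huK T (r - M)).indicator (fun _ => (2 * δ - 1))) :=
    (integrable_indicator_iff (huK_meas T _)).2 (integrableOn_const (huK_fin T _))
  have hle := integral_mono (huQ_sub_sq_int (μ := μ) hK (huK_fin T r)) (hqi.add hind) (fun x => by
    change huQ (huK T r) μ x - huQ (huK T r) μ x ^ 2 ≤ huQ (huK T r) μ x + (huK T (r - M)).indicator (fun _ => (2 * δ - 1)) x
    by_cases hx : x ∈ huK T (r - M)
    · have h1 : 1 - δ ≤ huQ (huK T r) μ x := by
        rw [huQ_real hK]
        refine hMδ.trans (measureReal_mono ?_)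
        intro y hy
        change ‖T (x + y)‖ ≤ r
        rw [map_add]
        have a1 : ‖T x‖ ≤ r - M := hx
        have a2 : ‖T y‖ ≤ M := hy
        linarith [norm_add_le (T x) (T y)]
      have h2 := huQ_le_one hK μ x
      have h3 := huQ_nonneg (huK T r) μ x
      simp only [Set.indicator_of_mem hx]
      nlinarith
    · simp only [Set.indicator_of_notMem hx]
      nlinarith [sq_nonneg (huQ (huK T r) μ x)])
  refine hle.trans_eq ?_
  have hq : ∫ x, huQ (huK T r) μ x = (volume (huK T r)).toReal := by
    rw [integral_eq_lintegral_of_nonneg_ae (Eventually.of_forall (huQ_nonneg _ _)) (huQ_meas hK μ).aestronglyMeasurable,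
      huQ_lint hK]
  change ∫ x, (huQ (huK T r) μ x + (huK T (r - M)).indicator (fun _ => (2 * δ - 1)) x) = _
  rw [integral_add hqi hind, hq, integral_indicator (huK_meas T _), setIntegral_const, measureReal_def,
    huK_vol T (hM.trans hr), huK_vol T hrM, smul_eq_mul]
  ring

lemma huQ_bulk_tendsto (μ : Measure (Fin d → ℝ)) [IsProbabilityMeasure μ] :
    Tendsto (fun r : ℝ => (∫ x, (huQ (huK T r) μ x - huQ (huK T r) μ x ^ 2)) / r ^ d) atTop (nhds 0) := by
  rw [tendsto_order]
  constructor
  · intro a ha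
    filter_upwards [eventually_gt_atTop 0] with r hr
    refine ha.trans_le (div_nonneg (integral_nonneg fun x => huQ_sub_sq (huK_meas T r) x) (by positivity))
  · intro a ha
    set κ := (volume (huK T 1)).toReal with hκ
    have hκ0 : 0 ≤ κ := ENNReal.toReal_nonneg
    obtain ⟨δ, hδ, hδa⟩ : ∃ δ : ℝ, 0 < δ ∧ κ * (2 * δ) < a := by
      refine ⟨a / (2 * (κ + 1)) / 2, by positivity, ?_⟩
      have : κ * (2 * (a / (2 * (κ + 1)) / 2)) = a * (κ / (2 * (κ + 1))) := by
        field_simp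
      rw [this]
      have : κ / (2 * (κ + 1)) < 1 := by rw [div_lt_one (by positivity)]; linarith
      nlinarith
    obtain ⟨M, hM, h⟩ := huQ_bulk T μ hδ
    have hlim : Tendsto (fun r : ℝ => κ * (1 - (1 - 2 * δ) * (1 - M / r)^d)) atTop (nhds (κ * (1 - (1 - 2 * δ) * (1 - 0)^d))) := by
      refine ((((tendsto_const_nhds.sub ?_).pow d).const_mul _).const_sub 1).const_mul κ
      exact tendsto_const_nhds.div_atTop tendsto_id
    have hlt : κ * (1 - (1 - 2 * δ) * (1 - 0)^d) < a := by
      simpa using hδa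
    filter_upwards [hlim.eventually (gt_mem_nhds hlt), eventually_gt_atTop M] with r h1 hr
    have hr0 : 0 < r := hM.trans hr
    refine lt_of_le_of_lt ?_ h1
    rw [div_le_iff₀ (by positivity)]
    refine (h r hr).trans_eq ?_
    have : (r - M)^d = (1 - M/r)^d * r^d := by
      rw [← mul_pow]; congr 1; field_simp
    rw [this]; ring

lemma huQ_fourier {K : Set (Fin d → ℝ)} (hK : MeasurableSet K) (hKf : volume K ≠ ⊤)
    (μ : Measure (Fin d → ℝ)) [IsProbabilityMeasure μ] (k : Fin d → ℤ) :
    ‖∫ x, huE k x * (huQ K μ x : ℂ)‖ ≤ ‖∫ x in K, huE k x‖ := by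
  let g : (Fin d → ℝ) → (Fin d → ℝ) → ℂ := fun x y => huE k x * (huF K (x + y) : ℂ)
  have hgm : Measurable (Function.uncurry g) := by
    refine Measurable.mul ((huE_cont k).measurable.comp measurable_fst) ?_
    exact Complex.measurable_ofReal.comp ((huF_meas hK).comp (measurable_fst.add measurable_snd))
  have hFi : Integrable (huF K) := (integrable_indicator_iff hK).2 (integrableOn_const hKf)
  have hgn : ∀ x y, ‖g x y‖ = huF K (x + y) := by
    intro x y
    simp only [g, norm_mul, huE_norm, one_mul, Complex.norm_real, Real.norm_of_nonneg (huF_nonneg _ _)]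
  have hgi : Integrable (Function.uncurry g) (volume.prod μ) := by
    rw [integrable_prod_iff' hgm.aestronglyMeasurable]
    constructor
    · refine Eventually.of_forall fun y => ?_
      refine (hFi.comp_add_right y).mono (hgm.comp (measurable_id.prodMk measurable_const)).aestronglyMeasurable (Eventually.of_forall fun x => ?_)
      change ‖g x y‖ ≤ _
      rw [hgn]; exact le_abs_self _
    · have : ∀ y, ∫ x, ‖Function.uncurry g (x, y)‖ = ∫ x, huF K x := by
        intro y
        simp only [Function.uncurry, hgn]
        exact integral_add_right_eq_self (μ := volume) (huF K) y
      simp only [this]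
      exact integrable_const _
  have h1 : ∀ x, huE k x * (huQ K μ x : ℂ) = ∫ y, g x y ∂μ := by
    intro x
    simp only [g]
    rw [integral_const_mul, integral_complex_ofReal]; rfl
  simp only [h1]
  rw [integral_integral_swap hgi]
  have h2 : ∀ y, ∫ x, g x y = huE k (-y) * ∫ x in K, huE k x := by
    intro y
    have e : ∀ x, g x y = (fun z => huE k (-y) * K.indicator (huE k) z) (x + y) := by
      intro x
      simp only [g, huF]
      by_cases hx : x + y ∈ K
      · simp only [Set.indicator_of_mem hx]
        rw [← huE_add, neg_add_cancel_comm_assoc]; simp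
      · simp [Set.indicator_of_notMem hx]
    simp only [e]
    rw [integral_add_right_eq_self (μ := volume) (fun z => huE k (-y) * K.indicator (huE k) z) y, integral_const_mul,
      integral_indicator hK]
  simp only [h2]
  rw [integral_mul_const, norm_mul]
  refine mul_le_of_le_one_left (norm_nonneg _) ?_
  refine (norm_integral_le_integral_norm _).trans ?_
  simp [huE_norm]

lemma hu_haar : ∃ c : NNReal, c ≠ 0 ∧ Measure.map T volume = c • (volume : Measure (EuclideanSpace ℝ (Fin d))) := by
  have := T.isAddHaarMeasure_map (volume : Measure (Fin d → ℝ))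
  refine ⟨Measure.addHaarScalarFactor (Measure.map T volume) volume, ?_, Measure.isAddLeftInvariant_eq_smul _ _⟩
  exact (Measure.addHaarScalarFactor_pos_of_isAddHaarMeasure _ _).ne'

/-- dual frequency -/
def huEta (k : Fin d → ℤ) : EuclideanSpace ℝ (Fin d) :=
  (InnerProductSpace.toDual ℝ (EuclideanSpace ℝ (Fin d))).symm
    ((∑ j, (k j : ℝ) • (ContinuousLinearMap.proj (R := ℝ) (φ := fun _ : Fin d => ℝ) j)).comp
      (T.symm : EuclideanSpace ℝ (Fin d) →L[ℝ] (Fin d → ℝ)))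

lemma huEta_inner (k : Fin d → ℤ) (y : EuclideanSpace ℝ (Fin d)) :
    inner ℝ (huEta T k) y = ∑ j, (k j : ℝ) * T.symm y j := by
  rw [huEta, InnerProductSpace.toDual_symm_apply]
  simp

lemma huEta_bound : ∃ A : ℝ, 1 ≤ A ∧ ∀ k, ‖huZ k‖ ≤ A * ‖huEta T k‖ := by
  refine ⟨1 + ∑ j, ‖T (Pi.single j 1)‖, ?_, fun k => ?_⟩
  · have : 0 ≤ ∑ j, ‖T (Pi.single j 1)‖ := Finset.sum_nonneg fun _ _ => norm_nonneg _
    linarith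
  · have hs : 0 ≤ ∑ j, ‖T (Pi.single j 1)‖ := Finset.sum_nonneg fun _ _ => norm_nonneg _
    rw [pi_norm_le_iff_of_nonneg (by positivity)]
    intro j
    have h := huEta_inner T k (T (Pi.single j 1))
    have : inner ℝ (huEta T k) (T (Pi.single j 1)) = (k j : ℝ) := by
      rw [h]; simp [Pi.single_apply]
    change ‖(k j : ℝ)‖ ≤ _
    rw [← this, mul_comm]
    refine (norm_inner_le_norm _ _).trans (mul_le_mul_of_nonneg_left ?_ (norm_nonneg _))
    have := Finset.single_le_sum (f := fun j => ‖T (Pi.single j 1)‖) (fun _ _ => norm_nonneg _) (Finset.mem_univ j)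
    linarith

open scoped Pointwise in
lemma huK_fourier {c : NNReal} (hc : Measure.map T volume = c • (volume : Measure (EuclideanSpace ℝ (Fin d))))
    {r : ℝ} (hr : 0 < r) (k : Fin d → ℤ) :
    ‖∫ x in huK T r, huE k x‖ = c * r ^ d * ‖huH d ((-(2 * Real.pi * r)) • huEta T k)‖ := by
  have h1 : ∫ x in huK T r, huE k x = ∫ x in T ⁻¹' (Metric.closedBall 0 r), (fun y => huE k (T.symm y)) (T x) := by
    rw [huK_pre]; simp
  have h2 : ∫ x in T ⁻¹' (Metric.closedBall 0 r), (fun y => huE k (T.symm y)) (T x) =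
      ∫ y in Metric.closedBall 0 r, huE k (T.symm y) ∂(Measure.map T volume) := by
    have := (T.toHomeomorph.measurableEmbedding).setIntegral_map (μ := volume)
      (fun y => huE k (T.symm y)) (Metric.closedBall 0 r)
    exact this.symm
  have h3 := Measure.setIntegral_comp_smul_of_pos (volume : Measure (EuclideanSpace ℝ (Fin d)))
    (fun y => huE k (T.symm y)) (Metric.closedBall 0 1) hr
  have h4 : r • Metric.closedBall (0 : EuclideanSpace ℝ (Fin d)) 1 = Metric.closedBall 0 r := by
    rw [smul_unitClosedBall_of_nonneg hr.le]
  have h5 : ∫ y in Metric.closedBall (0 : EuclideanSpace ℝ (Fin d)) 1, huE k (T.symm (r • y)) = huH d ((-(2 * Real.pi * r)) • huEta T k) := by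
    unfold huH
    congr 1; ext y
    rw [huE]
    congr 3
    rw [inner_smul_left, huEta_inner, map_smul]
    simp only [Pi.smul_apply, smul_eq_mul, conj_trivial, Finset.mul_sum, ← Finset.sum_neg_distrib]
    refine Finset.sum_congr rfl fun j _ => ?_
    ring
  rw [h4, h5] at h3
  rw [h1, h2, hc, Measure.restrict_smul, integral_smul_nnreal_measure]
  have h6 : ∫ y in Metric.closedBall (0 : EuclideanSpace ℝ (Fin d)) r, huE k (T.symm y) = (r ^ d : ℝ) • huH d ((-(2 * Real.pi * r)) • huEta T k) := by
    rw [h3]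
    simp only [finrank_euclideanSpace, Fintype.card_fin]
    rw [smul_smul, mul_inv_cancel₀ (by positivity), one_smul]
  rw [h6, NNReal.smul_def, norm_smul, norm_smul]
  simp [abs_of_pos hr, mul_assoc]

lemma huK_decay (hd : 1 ≤ d) : ∃ C R : ℝ, 0 ≤ C ∧ 0 < R ∧ ∀ r, R ≤ r → ∀ k : Fin d → ℤ, k ≠ 0 →
    ‖∫ x in huK T r, huE k x‖^2 ≤ C * (r ^ d / r) * ‖huZ k‖⁻¹ ^ (d+1) := by
  obtain ⟨c, -, hc⟩ := hu_haar T
  obtain ⟨C, hC0, hC⟩ := huH_bound d hd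
  obtain ⟨A, hA1, hA⟩ := huEta_bound T
  have hA0 : 0 < A := by linarith
  refine ⟨c^2 * C * A^(d+1), A, by positivity, hA0, fun r hr k hk => ?_⟩
  have hr0 : 0 < r := hA0.trans_le hr
  have hk1 : 1 ≤ ‖huZ k‖ := by
    obtain ⟨j, hj⟩ := Function.ne_iff.1 hk
    refine le_trans ?_ (norm_le_pi_norm (huZ k) j)
    change 1 ≤ ‖(k j : ℝ)‖
    rw [Real.norm_eq_abs]
    have : (1:ℤ) ≤ |k j| := Int.one_le_abs hj
    exact_mod_cast this
  rw [huK_fourier T hc hr0]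
  set η := (-(2 * Real.pi * r)) • huEta T k with hη
  have hηn : ‖η‖ = 2 * Real.pi * r * ‖huEta T k‖ := by
    rw [hη, norm_smul, norm_neg, Real.norm_of_nonneg (by positivity)]
  have hpi : 1 ≤ 2 * Real.pi := by linarith [Real.pi_gt_three]
  have hlow : r / A * ‖huZ k‖ ≤ ‖η‖ := by
    rw [hηn]
    calc r / A * ‖huZ k‖ ≤ r / A * (A * ‖huEta T k‖) := by gcongr; exact hA k
      _ = 1 * r * ‖huEta T k‖ := by field_simp
      _ ≤ _ := by gcongr
  have hrA : 1 ≤ r / A := by rwa [one_le_div hA0]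
  have hη1 : 1 ≤ ‖η‖ := le_trans (by nlinarith) hlow
  have hb := hC η hη1
  have hpow : (r / A * ‖huZ k‖)^(d+1) ≤ ‖η‖^(d+1) := pow_le_pow_left₀ (by positivity) hlow _
  have hb2 : (r / A * ‖huZ k‖)^(d+1) * ‖huH d η‖^2 ≤ C :=
    le_trans (mul_le_mul_of_nonneg_right hpow (by positivity)) hb
  have hpos : 0 < (r / A * ‖huZ k‖)^(d+1) := by positivity
  have hb3 : ‖huH d η‖^2 ≤ C / (r / A * ‖huZ k‖)^(d+1) := by
    rw [le_div_iff₀ hpos]; linarith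
  have hz : 0 < ‖huZ k‖ := by linarith
  calc (c * r ^ d * ‖huH d η‖)^2 = (c:ℝ)^2 * (r^d)^2 * ‖huH d η‖^2 := by ring
    _ ≤ (c:ℝ)^2 * (r^d)^2 * (C / (r / A * ‖huZ k‖)^(d+1)) := by gcongr
    _ = _ := by
      rw [mul_pow, div_pow, inv_pow, pow_succ r d]
      field_simp
end

lemma hu_basis (d : ℕ) (hd : 1 ≤ d) (a : Fin d → EuclideanSpace ℝ (Fin d)) (ha : LinearIndependent ℝ a) :
    ∃ T : (Fin d → ℝ) ≃L[ℝ] EuclideanSpace ℝ (Fin d), ∀ x, T x = ∑ j, x j • a j := by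
  have : Nonempty (Fin d) := ⟨⟨0, hd⟩⟩
  let b := basisOfLinearIndependentOfCardEqFinrank ha (by simp)
  refine ⟨b.equivFun.symm.toContinuousLinearEquiv, fun x => ?_⟩
  change b.equivFun.symm x = _
  rw [Module.Basis.equivFun_symm_apply]
  simp [b]

lemma hu_lawV {Ω : Type*} [MeasurableSpace Ω] (P : Measure Ω) [IsProbabilityMeasure P] (d : ℕ)
    (T : (Fin d → ℝ) ≃L[ℝ] EuclideanSpace ℝ (Fin d)) (U : Ω → EuclideanSpace ℝ (Fin d))
    (hUmeas : Measurable U) (β : ENNReal)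
    (hU : Measure.map U P = β • volume.restrict (T.symm ⁻¹' huBox d)) :
    Measure.map (fun ω => T.symm (U ω)) P = volume.restrict (huBox d) := by
  obtain ⟨c, hc0, hc⟩ := hu_haar T
  have hTm : Measurable T := T.continuous.measurable
  have hTsm : Measurable T.symm := T.symm.continuous.measurable
  have h1 : (volume : Measure (EuclideanSpace ℝ (Fin d))) = (c⁻¹ : NNReal) • Measure.map T volume := by
    rw [hc, smul_smul, inv_mul_cancel₀ hc0, one_smul]
  have h2 : Measure.map (fun ω => T.symm (U ω)) P = Measure.map T.symm (Measure.map U P) :=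
    (Measure.map_map hTsm hUmeas).symm
  have h3 : Measure.map T.symm ((Measure.map T volume).restrict (T.symm ⁻¹' huBox d)) = volume.restrict (huBox d) := by
    rw [← Measure.restrict_map hTsm (huBox_meas d), Measure.map_map hTsm hTm]
    have : (T.symm : EuclideanSpace ℝ (Fin d) → (Fin d → ℝ)) ∘ T = id := by ext x; simp
    rw [this, Measure.map_id]
  have h4 : Measure.map (fun ω => T.symm (U ω)) P = (β * (c⁻¹ : NNReal)) • volume.restrict (huBox d) := by
    rw [h2, hU, h1, Measure.restrict_smul, Measure.map_smul]
    have : Measure.map T.symm ((c⁻¹ : NNReal) • (Measure.map T volume).restrict (T.symm ⁻¹' huBox d))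
      = (c⁻¹ : NNReal) • volume.restrict (huBox d) := by
      rw [← h3]; exact Measure.map_smul _ _ _
    rw [this, mul_smul]; rfl
  have hpr : IsProbabilityMeasure (Measure.map (fun ω => T.symm (U ω)) P) :=
    Measure.isProbabilityMeasure_map (hTsm.comp hUmeas).aemeasurable
  have h5 := hpr.measure_univ
  rw [h4] at h5
  simp only [Measure.smul_apply, measure_univ, smul_eq_mul, mul_one] at h5
  rw [h4, h5, one_smul]

lemma hu_finS (d : ℕ) (T : (Fin d → ℝ) ≃L[ℝ] EuclideanSpace ℝ (Fin d)) (m : ℝ) :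
    {k : Fin d → ℤ | ‖T (huZ k)‖ ≤ m}.Finite := by
  obtain ⟨R, hR⟩ := (huK_bdd T m).subset_closedBall 0
  refine (Set.finite_Icc (fun _ => -⌈R⌉ : Fin d → ℤ) (fun _ => ⌈R⌉)).subset fun k hk => ?_
  have h1 : ‖huZ k‖ ≤ R := by simpa using hR (show huZ k ∈ huK T m from hk)
  have h2 : ∀ j, |k j| ≤ ⌈R⌉ := by
    intro j
    have h3 : ‖(k j : ℝ)‖ ≤ R := (norm_le_pi_norm (huZ k) j).trans h1
    rw [Real.norm_eq_abs] at h3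
    have : ((|k j| : ℤ) : ℝ) ≤ (⌈R⌉ : ℝ) := by push_cast; exact h3.trans (Int.le_ceil R)
    exact_mod_cast this
  exact ⟨fun j => (abs_le.1 (h2 j)).1, fun j => (abs_le.1 (h2 j)).2⟩

theorem statement3
    {Ω : Type*} [MeasurableSpace Ω] (P : Measure Ω) [IsProbabilityMeasure P]
    (d : ℕ) (hd : 1 ≤ d)
    -- the lattice 𝓛, generated by a basis `a` of ℝ^d
    (a : Fin d → EuclideanSpace ℝ (Fin d))
    (ha : LinearIndependent ℝ a)
    (Lpt : (Fin d → ℤ) → EuclideanSpace ℝ (Fin d))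
    (hLpt : ∀ m, Lpt m = ∑ i, (m i : ℝ) • a i)
    -- the fundamental domain 𝒟
    (D : Set (EuclideanSpace ℝ (Fin d)))
    (hD : D = {x | ∃ t : Fin d → ℝ, (∀ i, t i ∈ Set.Ico (0:ℝ) 1) ∧ x = ∑ i, t i • a i})
    -- the random field of perturbations
    (p : (Fin d → ℤ) → Ω → EuclideanSpace ℝ (Fin d))
    (hpm : ∀ m, Measurable (p m))
    -- strict stationarity of the field
    (hstat : ∀ (j : Fin d → ℤ) (Λ : Finset (Fin d → ℤ)),
      Measure.map (fun ω => fun m : Λ => p (↑m + j) ω) P =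
      Measure.map (fun ω => fun m : Λ => p ↑m ω) P)
    -- U uniform on 𝒟, independent of the field
    (U : Ω → EuclideanSpace ℝ (Fin d))
    (hUmeas : Measurable U)
    (hU : Measure.map U P = (volume D)⁻¹ • volume.restrict D)
    (hindep : IndepFun U (fun ω => fun m : Fin d → ℤ => p m ω) P)
    -- the field is m-dependent: families of perturbations indexed by sets at lattice
    -- distance greater than m are independent
    (m : ℕ)
    (hdep : ∀ A B : Finset (Fin d → ℤ),
      (∀ i ∈ A, ∀ j ∈ B, (m : ℝ) < ‖Lpt i - Lpt j‖) →
      IndepFun (fun ω => fun i : A => p ↑i ω) (fun ω => fun j : B => p ↑j ω) P)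
    -- E|p₀|^d < ∞
    (hmom : ∫⁻ ω, (‖p 0 ω‖₊ : ENNReal) ^ (d : ℝ) ∂P < ⊤)
    -- the number of points of the perturbed lattice Ξ in the closed ball B_r
    (N : ℝ → Ω → ℝ)
    (hN : ∀ r ω, N r ω = ∑' m : Fin d → ℤ,
      (Metric.closedBall (0 : EuclideanSpace ℝ (Fin d)) r).indicator (fun _ => (1:ℝ))
        (Lpt m + p m ω + U ω)) :
    -- Ξ is hyperuniform
    Tendsto (fun r : ℝ =>
      variance (N r) P /
        (volume (Metric.closedBall (0 : EuclideanSpace ℝ (Fin d)) r)).toReal)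
      atTop (nhds 0) := by

  classical
  obtain ⟨T, hT⟩ := hu_basis d hd a ha
  have hTL : ∀ k, T (huZ k) = Lpt k := fun k => by rw [hT, hLpt]; rfl
  have hTm : Measurable T := T.continuous.measurable
  have hTsm : Measurable T.symm := T.symm.continuous.measurable
  have hDpre : D = T.symm ⁻¹' huBox d := by
    rw [hD]
    ext x
    constructor
    · rintro ⟨t, ht, rfl⟩
      rw [← hT t]
      intro j _
      simpa using ht j
    · intro hx
      refine ⟨T.symm x, fun j => hx j (Set.mem_univ j), ?_⟩
      rw [← hT]; simp
  set V : Ω → (Fin d → ℝ) := fun ω => T.symm (U ω) with hVdef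
  set p' : (Fin d → ℤ) → Ω → (Fin d → ℝ) := fun i ω => T.symm (p i ω) with hp'
  have hVm : Measurable V := hTsm.comp hUmeas
  have hpm' : ∀ i, Measurable (p' i) := fun i => hTsm.comp (hpm i)
  have hVl : P.map V = volume.restrict (huBox d) := by
    rw [hDpre] at hU
    exact hu_lawV P d T U hUmeas _ hU
  have hpl0 : ∀ i, P.map (p i) = P.map (p 0) := by
    intro i
    have h := hstat i {0}
    have h2 := congrArg (Measure.map (fun f : ({0} : Finset (Fin d → ℤ)) → EuclideanSpace ℝ (Fin d) => f ⟨0, by simp⟩)) h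
    rw [Measure.map_map (by fun_prop) (measurable_pi_lambda _ fun _ => hpm _),
      Measure.map_map (by fun_prop) (measurable_pi_lambda _ fun _ => hpm _)] at h2
    simpa [Function.comp_def] using h2
  set μ := P.map (p' 0) with hμ
  have hμp : IsProbabilityMeasure μ := Measure.isProbabilityMeasure_map (hpm' 0).aemeasurable
  have hpl : ∀ i, P.map (p' i) = μ := by
    intro i
    have e : ∀ i, P.map (p' i) = (P.map (p i)).map T.symm := fun i => (Measure.map_map hTsm (hpm i)).symm
    rw [hμ, e i, e 0, hpl0 i]
  have hi : ∀ i j, IndepFun V (fun ω => (p' i ω, p' j ω)) P := by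
    intro i j
    exact hindep.comp (φ := T.symm) (ψ := fun f : (Fin d → ℤ) → EuclideanSpace ℝ (Fin d) => (T.symm (f i), T.symm (f j)))
      hTsm ((hTsm.comp (measurable_pi_apply i)).prodMk (hTsm.comp (measurable_pi_apply j)))
  set S : Finset (Fin d → ℤ) := (hu_finS d T m).toFinset with hSdef
  have hS : ∀ i j, j - i ∉ S → IndepFun (p' i) (p' j) P := by
    intro i j hij
    have h1 : (m:ℝ) < ‖Lpt i - Lpt j‖ := by
      have h2 : ¬ ‖T (huZ (j - i))‖ ≤ m := by simpa [hSdef] using hij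
      have h3 : huZ (j - i) = huZ j - huZ i := by ext l; simp [huZ]
      rw [h3, map_sub, hTL, hTL, norm_sub_rev] at h2
      exact not_le.1 h2
    have h4 := hdep {i} {j} (by
      intro i' hi' j' hj'
      rw [Finset.mem_singleton] at hi' hj'
      rw [hi', hj']; exact h1)
    exact h4.comp (φ := fun f : ({i} : Finset (Fin d → ℤ)) → EuclideanSpace ℝ (Fin d) => T.symm (f ⟨i, by simp⟩))
      (ψ := fun f : ({j} : Finset (Fin d → ℤ)) → EuclideanSpace ℝ (Fin d) => T.symm (f ⟨j, by simp⟩))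
      (hTsm.comp (measurable_pi_apply _)) (hTsm.comp (measurable_pi_apply _))
  have hNr : ∀ r, N r = fun ω => ∑' i, huF (huK T r) (huZ i + p' i ω + V ω) := by
    intro r
    ext ω
    rw [hN]
    refine tsum_congr fun i => ?_
    have e : T (huZ i + p' i ω + V ω) = Lpt i + p i ω + U ω := by
      rw [map_add, map_add, hTL]; simp [hp', hVdef]
    rw [← e, huF, huK_pre]
    rfl
  obtain ⟨C, R, hC0, hR0, hdecay⟩ := huK_decay T hd
  set ZZ := ∑' k : Fin d → ℤ, ‖huZ k‖⁻¹ ^ (d+1) with hZZ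
  have hvar : ∀ r, R ≤ r → variance (N r) P ≤
      2 * (S.card * ∫ x, (huQ (huK T r) μ x - huQ (huK T r) μ x ^2)) + 2 * (C * (r ^ d / r) * ZZ) := by
    intro r hr
    have hr0 : 0 < r := hR0.trans_le hr
    rw [hNr r, hZZ, ← tsum_mul_left]
    exact huN_var (huK_meas T r) (huK_bdd T r) (huK_fin T r) hpm' hVm hVl hpl hi S hS
      (fun k => C * (r ^ d / r) * ‖huZ k‖⁻¹ ^ (d+1)) ((hu_summable d).mul_left _) (fun k => by positivity)
      (fun k hk => (pow_le_pow_left₀ (norm_nonneg _) (huQ_fourier (huK_meas T r) (huK_fin T r) μ k) 2).trans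
        (hdecay r hr k hk))
  set v := (volume (Metric.closedBall (0 : EuclideanSpace ℝ (Fin d)) 1)).toReal with hv
  have hv0 : 0 < v := ENNReal.toReal_pos (Metric.measure_closedBall_pos _ _ one_pos).ne' measure_closedBall_lt_top.ne
  have hvol : ∀ r : ℝ, 0 < r → (volume (Metric.closedBall (0 : EuclideanSpace ℝ (Fin d)) r)).toReal = r ^ d * v := by
    intro r hr
    rw [Measure.addHaar_closedBall' _ _ hr.le, ENNReal.toReal_mul, ENNReal.toReal_ofReal (by positivity)]
    simp [hv]
  have hlim : Tendsto (fun r : ℝ => (2 * S.card * ((∫ x, (huQ (huK T r) μ x - huQ (huK T r) μ x ^2)) / r ^ d)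
      + 2 * C * ZZ / r) / v) atTop (nhds ((2 * S.card * 0 + 0) / v)) := by
    refine Tendsto.div_const (Tendsto.add ((huQ_bulk_tendsto T μ).const_mul _) ?_) v
    exact tendsto_const_nhds.div_atTop tendsto_id
  simp only [mul_zero, add_zero, zero_div] at hlim
  refine squeeze_zero' ?_ ?_ hlim
  · exact Eventually.of_forall fun r => div_nonneg (variance_nonneg _ _) ENNReal.toReal_nonneg
  · filter_upwards [eventually_ge_atTop R] with r hr
    have hr0 : 0 < r := hR0.trans_le hr
    rw [hvol r hr0, ← div_div]
    refine div_le_div_of_nonneg_right ?_ hv0.le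
    rw [div_le_iff₀ (by positivity)]
    refine (hvar r hr).trans_eq ?_
    field_simp
end
end
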